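/- A three-dimensional reflexive polytope P ⊆ ℝ³ is terminal if and only if every facet of P is either a triangle whose vertices form a ℤ-basis of ℤ³, or a parallelogram conv(v, w, x, y) where the vertices v, x, w form a ℤ-basis of ℤ³ and satisfy v + x = w + y. Moreover, there are exactly 100 three-dimensional terminal reflexive polytopes up to unimodular equivalence. -/

import Mathlib

open scoped BigOperators

noncomputable section

/-- The standard dot product on `ℝ^d`. -/
def dotProd {d : ℕ} (x y : Fin d → ℝ) : ℝ := ∑ i, x i * y i

/-- A point of `ℝ^d` is a lattice point (element of `ℤ^d`) if all coordinates are integers. -/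
def IsLatticePoint {d : ℕ} (x : Fin d → ℝ) : Prop := ∀ i, ∃ n : ℤ, x i = (n : ℝ)

/-- A lattice polytope is the convex hull of finitely many lattice points. -/
def IsLatticePolytope {d : ℕ} (P : Set (Fin d → ℝ)) : Prop :=
  ∃ V : Finset (Fin d → ℝ), (∀ v ∈ V, IsLatticePoint v) ∧ P = convexHull ℝ (V : Set (Fin d → ℝ))

/-- The dual polytope `P* = {y | ⟨x,y⟩ ≥ -1 ∀ x ∈ P}`. -/
def dualPolytope {d : ℕ} (P : Set (Fin d → ℝ)) : Set (Fin d → ℝ) :=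
  {y | ∀ x ∈ P, -1 ≤ dotProd x y}

/-- A reflexive polytope: a full-dimensional lattice polytope with `0` in its interior whose
dual polytope is again a lattice polytope. -/
def IsReflexive {d : ℕ} (P : Set (Fin d → ℝ)) : Prop :=
  IsLatticePolytope P ∧ (0 : Fin d → ℝ) ∈ interior P ∧ IsLatticePolytope (dualPolytope P)

/-- A face of `P`: the subset of `P` where some linear functional attains its maximum bound. -/
def IsFace {d : ℕ} (P F : Set (Fin d → ℝ)) : Prop :=
  ∃ (u : Fin d → ℝ) (c : ℝ), (∀ x ∈ P, dotProd u x ≤ c) ∧ F = {x ∈ P | dotProd u x = c}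

/-- A facet of a `d`-dimensional polytope: a nonempty face of dimension `d - 1`. -/
def IsFacet {d : ℕ} (P F : Set (Fin d → ℝ)) : Prop :=
  IsFace P F ∧ F.Nonempty ∧ Module.finrank ℝ (vectorSpan ℝ F) = d - 1

/-- `x ∼ y` : `x` and `y` lie in a common facet of `P`. -/
def SameFacet {d : ℕ} (P : Set (Fin d → ℝ)) (x y : Fin d → ℝ) : Prop :=
  ∃ F, IsFacet P F ∧ x ∈ F ∧ y ∈ F

/-- The star set of `x`: the union of all facets of `P` containing `x`. -/
def starSet {d : ℕ} (P : Set (Fin d → ℝ)) (x : Fin d → ℝ) : Set (Fin d → ℝ) :=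
  {y | SameFacet P x y}

/-- A family of lattice points forming a `ℤ`-basis of the lattice `ℤ^d`. -/
def IsZBasisFamily {d n : ℕ} (s : Fin n → (Fin d → ℝ)) : Prop :=
  LinearIndependent ℝ s ∧ (∀ i, IsLatticePoint (s i)) ∧
    ∀ z : Fin d → ℝ, IsLatticePoint z → ∃ c : Fin n → ℤ, z = ∑ i, (c i : ℝ) • s i

/-- A primitive lattice point: a nonzero lattice point such that no lattice point lies
strictly between `0` and it. -/
def IsPrimitivePoint {d : ℕ} (x : Fin d → ℝ) : Prop :=
  IsLatticePoint x ∧ x ≠ 0 ∧ ∀ y ∈ openSegment ℝ (0 : Fin d → ℝ) x, ¬ IsLatticePoint y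

/-- A Fano polytope: a full-dimensional lattice polytope with `0` in its interior all of whose
vertices are primitive lattice points. -/
def IsFanoPolytope {d : ℕ} (P : Set (Fin d → ℝ)) : Prop :=
  IsLatticePolytope P ∧ (0 : Fin d → ℝ) ∈ interior P ∧
    ∀ v ∈ Set.extremePoints ℝ P, IsPrimitivePoint v

/-- Canonical: the only interior lattice point is the origin. -/
def IsCanonicalPolytope {d : ℕ} (P : Set (Fin d → ℝ)) : Prop :=
  {x ∈ interior P | IsLatticePoint x} = {0}

/-- Terminal: the only lattice points of `P` are the origin and the vertices. -/
def IsTerminalPolytope {d : ℕ} (P : Set (Fin d → ℝ)) : Prop :=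
  {x ∈ P | IsLatticePoint x} = insert (0 : Fin d → ℝ) (Set.extremePoints ℝ P)

/-- Simplicial: every facet has exactly `d` vertices. -/
def IsSimplicial {d : ℕ} (P : Set (Fin d → ℝ)) : Prop :=
  ∀ F, IsFacet P F → (Set.extremePoints ℝ F).ncard = d

/-- Smooth: the vertices of every facet form a `ℤ`-basis of the lattice. -/
def IsSmoothPolytope {d : ℕ} (P : Set (Fin d → ℝ)) : Prop :=
  ∀ F, IsFacet P F → ∃ s : Fin d → (Fin d → ℝ),
    Set.extremePoints ℝ F = Set.range s ∧ IsZBasisFamily s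

/-- Semi-terminal: any two distinct vertices in a common facet are joined by a lattice-point
free segment. -/
def IsSemiTerminal {d : ℕ} (P : Set (Fin d → ℝ)) : Prop :=
  ∀ v ∈ Set.extremePoints ℝ P, ∀ w ∈ Set.extremePoints ℝ P, v ≠ w → SameFacet P v w →
    {x ∈ segment ℝ v w | IsLatticePoint x} = {v, w}

/-- The quotient space `ℝ^d / ℝv`. -/
abbrev QuotSpace {d : ℕ} (v : Fin d → ℝ) := (Fin d → ℝ) ⧸ (Submodule.span ℝ {v})

/-- The canonical projection `π_v : ℝ^d → ℝ^d/ℝv`. -/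
def projAlong {d : ℕ} (v : Fin d → ℝ) : (Fin d → ℝ) →ₗ[ℝ] QuotSpace v :=
  (Submodule.span ℝ {v}).mkQ

/-- The quotient lattice `ℤ^d/ℤv`, regarded as the image of `ℤ^d` in `ℝ^d/ℝv`. -/
def quotLattice {d : ℕ} (v : Fin d → ℝ) : Set (QuotSpace v) :=
  projAlong v '' {x | IsLatticePoint x}

/-- A primitive point of the quotient lattice `ℤ^d/ℤv`. -/
def QuotPrimitive {d : ℕ} (v : Fin d → ℝ) (q : QuotSpace v) : Prop :=
  q ∈ quotLattice v ∧ q ≠ 0 ∧ ∀ t ∈ openSegment ℝ (0 : QuotSpace v) q, t ∉ quotLattice v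

/-- A Fano polytope in the quotient space `ℝ^d/ℝv` with respect to the lattice `ℤ^d/ℤv`. -/
def QuotIsFanoPolytope {d : ℕ} (v : Fin d → ℝ) (Q : Set (QuotSpace v)) : Prop :=
  (∃ V : Finset (QuotSpace v), (∀ q ∈ V, q ∈ quotLattice v) ∧
      Q = convexHull ℝ (V : Set (QuotSpace v))) ∧
  (0 : QuotSpace v) ∈ interior Q ∧
  ∀ q ∈ Set.extremePoints ℝ Q, QuotPrimitive v q

/-- Unimodular equivalence: a real linear isomorphism mapping lattice onto lattice and one
polytope onto the other. -/
def LatticeEquivTo {d e : ℕ} (P : Set (Fin d → ℝ)) (Q : Set (Fin e → ℝ)) : Prop :=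
  ∃ f : (Fin d → ℝ) ≃ₗ[ℝ] (Fin e → ℝ),
    (∀ x, IsLatticePoint x ↔ IsLatticePoint (f x)) ∧ f '' P = Q

/-- The hexagon `Z₂ = conv(±(1,0), ±(0,1), ±(1,1)) ⊆ ℝ²`. -/
def Z2 : Set (Fin 2 → ℝ) :=
  convexHull ℝ ({![1,0], ![0,1], ![1,1], ![-1,0], ![0,-1], ![-1,-1]} : Set (Fin 2 → ℝ))

/-- The `j`-th coordinate pair of a point of `ℝ^{2m}`. -/
def pairCoords {m : ℕ} (x : Fin (2 * m) → ℝ) (j : Fin m) : Fin 2 → ℝ :=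
  fun i => x ⟨2 * (j : ℕ) + (i : ℕ), by have := j.isLt; have := i.isLt; omega⟩

/-- The `m`-fold product `Z₂ × ⋯ × Z₂ ⊆ ℝ^{2m}`. -/
def prodZ2 (m : ℕ) : Set (Fin (2 * m) → ℝ) := {x | ∀ j : Fin m, pairCoords x j ∈ Z2}

/-- The `j`-th coordinate pair of a point of `ℝ^{2m+1}` (first `2m` coordinates). -/
def pairCoords' {m : ℕ} (x : Fin (2 * m + 1) → ℝ) (j : Fin m) : Fin 2 → ℝ :=
  fun i => x ⟨2 * (j : ℕ) + (i : ℕ), by have := j.isLt; have := i.isLt; omega⟩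

/-- The product `[-1,1] × Z₂ × ⋯ × Z₂ ⊆ ℝ^{2m+1}` with `m` hexagon factors. -/
def boxProdZ2 (m : ℕ) : Set (Fin (2 * m + 1) → ℝ) :=
  {x | x ⟨2 * m, by omega⟩ ∈ Set.Icc (-1 : ℝ) 1 ∧ ∀ j : Fin m, pairCoords' x j ∈ Z2}

/-- A lattice point of `ℤ³`. -/
@[ext] structure Pt where
  x : ℤ
  y : ℤ
  z : ℤ

namespace Pt

/-- The origin. -/
def zero : Pt := ⟨0, 0, 0⟩

def add (p q : Pt) : Pt := ⟨p.x + q.x, p.y + q.y, p.z + q.z⟩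

def sub (p q : Pt) : Pt := ⟨p.x - q.x, p.y - q.y, p.z - q.z⟩

def dot (p q : Pt) : ℤ := p.x * q.x + p.y * q.y + p.z * q.z

def cross (p q : Pt) : Pt :=
  ⟨p.y * q.z - p.z * q.y, p.z * q.x - p.x * q.z, p.x * q.y - p.y * q.x⟩

/-- The determinant of three lattice points. -/
def det (p q r : Pt) : ℤ := p.dot (q.cross r)

/-- The linear map of `ℤ³` sending the standard basis to `a, b, c`. -/
def lin (a b c q : Pt) : Pt :=
  ⟨q.x * a.x + q.y * b.x + q.z * c.x, q.x * a.y + q.y * b.y + q.z * c.y,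
    q.x * a.z + q.y * b.z + q.z * c.z⟩

/-- The lattice point as a vector of `ℝ³`. -/
def vec (p : Pt) : Fin 3 → ℝ := ![(p.x : ℝ), (p.y : ℝ), (p.z : ℝ)]

theorem vec_injective : Function.Injective vec := by
  intro p q h
  have h0 := congrFun h 0
  have h1 := congrFun h 1
  have h2 := congrFun h 2
  simp only [vec, Matrix.cons_val_zero, Matrix.cons_val_one, Matrix.cons_val] at h0 h1 h2
  exact Pt.ext (by exact_mod_cast h0) (by exact_mod_cast h1) (by exact_mod_cast h2)

theorem vec_zero : zero.vec = 0 := by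
  ext i; fin_cases i <;> simp [vec, zero]

theorem vec_add (p q : Pt) : (p.add q).vec = p.vec + q.vec := by
  ext i; fin_cases i <;> simp [vec, add]

theorem isLatticePoint_vec (p : Pt) : IsLatticePoint p.vec := by
  intro i; fin_cases i
  exacts [⟨p.x, rfl⟩, ⟨p.y, rfl⟩, ⟨p.z, rfl⟩]

theorem vec_lin (a b c q : Pt) :
    (lin a b c q).vec = (q.x : ℝ) • a.vec + (q.y : ℝ) • b.vec + (q.z : ℝ) • c.vec := by
  ext i; fin_cases i <;> simp [vec, lin]

end Pt

theorem IsLatticePoint.exists_pt {x : Fin 3 → ℝ} (h : IsLatticePoint x) : ∃ p : Pt, p.vec = x := by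
  obtain ⟨a, ha⟩ := h 0
  obtain ⟨b, hb⟩ := h 1
  obtain ⟨c, hc⟩ := h 2
  refine ⟨⟨a, b, c⟩, ?_⟩
  ext i; fin_cases i <;> simp [Pt.vec, *]

theorem dotProd_three (x y : Fin 3 → ℝ) :
    dotProd x y = x 0 * y 0 + x 1 * y 1 + x 2 * y 2 := by
  simp [dotProd, Fin.sum_univ_three]

theorem dotProd_comm (x y : Fin 3 → ℝ) : dotProd x y = dotProd y x := by
  simp only [dotProd_three]; ring

theorem dotProd_add (x y z : Fin 3 → ℝ) : dotProd x (y + z) = dotProd x y + dotProd x z := by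
  simp only [dotProd_three, Pi.add_apply]; ring

theorem dotProd_smul (x y : Fin 3 → ℝ) (t : ℝ) : dotProd x (t • y) = t * dotProd x y := by
  simp only [dotProd_three, Pi.smul_apply, smul_eq_mul]; ring

theorem add_dotProd (x y z : Fin 3 → ℝ) : dotProd (x + y) z = dotProd x z + dotProd y z := by
  simp only [dotProd_three, Pi.add_apply]; ring

theorem smul_dotProd (x y : Fin 3 → ℝ) (t : ℝ) : dotProd (t • x) y = t * dotProd x y := by
  simp only [dotProd_three, Pi.smul_apply, smul_eq_mul]; ring

theorem dotProd_zero (x : Fin 3 → ℝ) : dotProd x 0 = 0 := by simp [dotProd]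

theorem neg_dotProd (x y : Fin 3 → ℝ) : dotProd (-x) y = -dotProd x y := by
  simp [dotProd]

theorem dotProd_neg (x y : Fin 3 → ℝ) : dotProd x (-y) = -dotProd x y := by
  simp [dotProd]

theorem dotProd_sub (x y z : Fin 3 → ℝ) : dotProd x (y - z) = dotProd x y - dotProd x z := by
  simp only [dotProd_three, Pi.sub_apply]; ring

theorem dotProd_vec (p q : Pt) : dotProd p.vec q.vec = (p.dot q : ℝ) := by
  simp [dotProd_three, Pt.vec, Pt.dot]

/-- `dotProd u` as a linear functional. -/
def dotLin (u : Fin 3 → ℝ) : (Fin 3 → ℝ) →ₗ[ℝ] ℝ where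
  toFun := dotProd u
  map_add' := dotProd_add u
  map_smul' t y := by simp [dotProd_smul]

@[simp] theorem dotLin_apply (u x : Fin 3 → ℝ) : dotLin u x = dotProd u x := rfl

theorem exists_dotProd_eq (f : (Fin 3 → ℝ) →ₗ[ℝ] ℝ) : ∃ u, ∀ x, f x = dotProd u x := by
  refine ⟨fun i => f (Pi.single i 1), fun x => ?_⟩
  rw [f.pi_apply_eq_sum_univ x]
  simp only [dotProd, smul_eq_mul]
  refine Finset.sum_congr rfl fun i _ => ?_
  rw [mul_comm]
  congr 2
  ext j; simp [Pi.single_apply, eq_comm]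

theorem continuous_dotProd (u : Fin 3 → ℝ) : Continuous (dotProd u) := by
  unfold dotProd; fun_prop

/-- A linear inequality on a set persists on its convex hull. -/
theorem dotProd_le_of_mem_convexHull {A : Set (Fin 3 → ℝ)} {u x : Fin 3 → ℝ} {c : ℝ}
    (h : ∀ a ∈ A, dotProd u a ≤ c) (hx : x ∈ convexHull ℝ A) : dotProd u x ≤ c :=
  convexHull_min (t := {x | dotLin u x ≤ c}) h (convex_halfSpace_le (dotLin u).isLinear c) hx

theorem linearIndependent_iff_det (a b c : Fin 3 → ℝ) :
    LinearIndependent ℝ ![a, b, c] ↔ Matrix.det (Matrix.of ![a, b, c]) ≠ 0 := by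
  rw [← isUnit_iff_ne_zero, ← Matrix.isUnit_iff_isUnit_det,
    ← Matrix.linearIndependent_rows_iff_isUnit]
  rfl

theorem det_vec (a b c : Pt) :
    Matrix.det (Matrix.of ![a.vec, b.vec, c.vec]) = (Pt.det a b c : ℝ) := by
  simp [Matrix.det_fin_three, Pt.vec, Pt.det, Pt.dot, Pt.cross]; ring

theorem linearIndependent_vec_iff (a b c : Pt) :
    LinearIndependent ℝ ![a.vec, b.vec, c.vec] ↔ Pt.det a b c ≠ 0 := by
  rw [linearIndependent_iff_det, det_vec]; exact_mod_cast Iff.rfl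

/-- Three linearly independent vectors determine every vector by its scalar products. -/
theorem eq_of_dotProd_eq {a b c y z : Fin 3 → ℝ} (h : LinearIndependent ℝ ![a, b, c])
    (ha : dotProd y a = dotProd z a) (hb : dotProd y b = dotProd z b)
    (hc : dotProd y c = dotProd z c) : y = z := by
  rw [linearIndependent_iff_det] at h
  have : (Matrix.of ![a, b, c]).mulVec (y - z) = 0 := by
    ext i
    fin_cases i <;> simp [Matrix.mulVec, dotProduct, Fin.sum_univ_three] <;>
      simp only [dotProd_three] at ha hb hc <;> linarith
  exact sub_eq_zero.1 (Matrix.eq_zero_of_mulVec_eq_zero h this)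

/-- Three linearly independent vectors span `ℝ³`. -/
theorem exists_coords {a b c : Fin 3 → ℝ} (h : LinearIndependent ℝ ![a, b, c]) (x : Fin 3 → ℝ) :
    ∃ α β γ : ℝ, x = α • a + β • b + γ • c := by
  have hs := h.span_eq_top_of_card_eq_finrank' (by simp)
  have hx : x ∈ Submodule.span ℝ (Set.range ![a, b, c]) := hs ▸ Submodule.mem_top
  obtain ⟨k, hk⟩ := (Submodule.mem_span_range_iff_exists_fun ℝ).1 hx
  exact ⟨k 0, k 1, k 2, by rw [← hk]; simp [Fin.sum_univ_three]⟩

/-- The dual polytope with the opposite sign convention. -/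
def polar (P : Set (Fin 3 → ℝ)) : Set (Fin 3 → ℝ) := {y | ∀ x ∈ P, dotProd y x ≤ 1}

theorem mem_polar_iff_neg_mem_dualPolytope {P : Set (Fin 3 → ℝ)} {y : Fin 3 → ℝ} :
    y ∈ polar P ↔ -y ∈ dualPolytope P := by
  simp only [polar, dualPolytope, Set.mem_ofPred_eq, dotProd_neg]
  exact forall₂_congr fun x _ => by rw [dotProd_comm x y]; constructor <;> intro h <;> linarith

theorem isLatticePoint_neg {x : Fin 3 → ℝ} (h : IsLatticePoint x) : IsLatticePoint (-x) := by
  intro i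
  obtain ⟨n, hn⟩ := h i
  exact ⟨-n, by simp [hn]⟩

theorem polar_eq_neg (P : Set (Fin 3 → ℝ)) : polar P = -dualPolytope P := by
  ext y; rw [mem_polar_iff_neg_mem_dualPolytope]; rfl

theorem isLatticePolytope_polar_iff {P : Set (Fin 3 → ℝ)} :
    IsLatticePolytope (polar P) ↔ IsLatticePolytope (dualPolytope P) := by
  classical
  have key : ∀ A : Set (Fin 3 → ℝ), IsLatticePolytope A → IsLatticePolytope (-A) := by
    rintro A ⟨V, hV, rfl⟩
    refine ⟨V.image (-·), ?_, ?_⟩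
    · simp only [Finset.mem_image]
      rintro _ ⟨v, hv, rfl⟩
      exact isLatticePoint_neg (hV v hv)
    · rw [← convexHull_neg]; simp
  rw [polar_eq_neg]
  exact ⟨fun h => by simpa using key _ h, key _⟩

theorem polar_convexHull (V : Set (Fin 3 → ℝ)) : polar (convexHull ℝ V) = polar V :=
  Set.Subset.antisymm (fun _ h x hx => h x (subset_convexHull ℝ V hx))
    fun _ h _ hx => dotProd_le_of_mem_convexHull h hx

theorem convex_polar (P : Set (Fin 3 → ℝ)) : Convex ℝ (polar P) := by
  intro y hy z hz a b ha hb hab x hx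
  rw [add_dotProd, smul_dotProd, smul_dotProd]
  nlinarith [hy x hx, hz x hx]

theorem isClosed_polar (P : Set (Fin 3 → ℝ)) : IsClosed (polar P) := by
  have : polar P = ⋂ x ∈ P, {y | dotProd x y ≤ 1} := by
    ext y; simp [polar, dotProd_comm y]
  rw [this]
  exact isClosed_biInter fun x _ => isClosed_le (continuous_dotProd x) continuous_const

theorem exists_pos_smul_mem {P : Set (Fin 3 → ℝ)} (h0 : (0 : Fin 3 → ℝ) ∈ interior P)
    (v : Fin 3 → ℝ) : ∃ t : ℝ, 0 < t ∧ t • v ∈ P := by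
  have hc : Continuous fun t : ℝ => t • v := by fun_prop
  have ho : IsOpen ((fun t : ℝ => t • v) ⁻¹' interior P) := isOpen_interior.preimage hc
  obtain ⟨ε, hε, hb⟩ := Metric.isOpen_iff.1 ho 0 (by simpa using h0)
  refine ⟨ε / 2, by positivity, interior_subset (hb (a := ε / 2) ?_)⟩
  simp only [Metric.mem_ball, dist_zero_right, Real.norm_eq_abs]
  rw [abs_of_pos (by positivity)]; linarith

theorem dotProd_self_pos {y : Fin 3 → ℝ} (hy : y ≠ 0) : 0 < dotProd y y := by
  have : ∃ i, y i ≠ 0 := by by_contra! h; exact hy (funext h)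
  obtain ⟨i, hi⟩ := this
  exact Finset.sum_pos' (fun j _ => mul_self_nonneg _) ⟨i, Finset.mem_univ _, mul_self_pos.2 hi⟩

theorem exists_dotProd_pos {V : Set (Fin 3 → ℝ)}
    (h0 : (0 : Fin 3 → ℝ) ∈ interior (convexHull ℝ V)) {y : Fin 3 → ℝ} (hy : y ≠ 0) :
    ∃ v ∈ V, 0 < dotProd y v := by
  by_contra! h
  obtain ⟨t, ht, hm⟩ := exists_pos_smul_mem h0 y
  have := dotProd_le_of_mem_convexHull h hm
  rw [dotProd_smul] at this
  nlinarith [dotProd_self_pos hy]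

theorem dotProd_single (y : Fin 3 → ℝ) (i : Fin 3) : dotProd y (Pi.single i 1) = y i := by
  simp [dotProd, Pi.single_apply]

theorem isCompact_polar {P : Set (Fin 3 → ℝ)} (h0 : (0 : Fin 3 → ℝ) ∈ interior P) :
    IsCompact (polar P) := by
  choose s hs hsP using fun i : Fin 3 => exists_pos_smul_mem h0 (Pi.single i 1)
  choose t ht htP using fun i : Fin 3 => exists_pos_smul_mem h0 (-Pi.single i 1)
  refine (isCompact_Icc (a := fun i => -(t i)⁻¹) (b := fun i => (s i)⁻¹)).of_isClosed_subset
    (isClosed_polar P) fun y hy => ⟨fun i => ?_, fun i => ?_⟩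
  · have := hy _ (htP i)
    rw [dotProd_smul, dotProd_neg, dotProd_single] at this
    have h2 : t i * (t i)⁻¹ = 1 := mul_inv_cancel₀ (ht i).ne'
    nlinarith [ht i]
  · have := hy _ (hsP i)
    rw [dotProd_smul, dotProd_single] at this
    have h2 : s i * (s i)⁻¹ = 1 := mul_inv_cancel₀ (hs i).ne'
    nlinarith [hs i]

theorem isExtreme_face {P : Set (Fin 3 → ℝ)} {u : Fin 3 → ℝ} {c : ℝ}
    (h : ∀ x ∈ P, dotProd u x ≤ c) : IsExtreme ℝ P {x ∈ P | dotProd u x = c} := by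
  refine ⟨fun x hx => hx.1, ?_⟩
  rintro x hx y hy z ⟨-, hz⟩ ⟨a, b, ha, hb, hab, rfl⟩
  refine ⟨hx, ?_⟩
  rw [dotProd_add, dotProd_smul, dotProd_smul] at hz
  have h1 := h x hx
  have h2 := h y hy
  by_contra hne
  have h3 := lt_of_le_of_ne h1 hne
  have : b = 1 - a := by linarith
  subst this
  nlinarith

theorem isCompact_face {P : Set (Fin 3 → ℝ)} (hP : IsCompact P) (u : Fin 3 → ℝ) (c : ℝ) :
    IsCompact {x ∈ P | dotProd u x = c} :=
  hP.inter_right (isClosed_eq (continuous_dotProd u) continuous_const)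

theorem convex_face {P : Set (Fin 3 → ℝ)} (hP : Convex ℝ P) (u : Fin 3 → ℝ) (c : ℝ) :
    Convex ℝ {x ∈ P | dotProd u x = c} :=
  hP.inter (convex_hyperplane (dotLin u).isLinear c)

theorem eq_convexHull_extremePoints {K : Set (Fin 3 → ℝ)} (hK : IsCompact K) (hc : Convex ℝ K)
    (hf : (K.extremePoints ℝ).Finite) : K = convexHull ℝ (K.extremePoints ℝ) := by
  conv_lhs => rw [← closure_convexHull_extremePoints hK hc]
  exact (hf.isClosed_convexHull ℝ).closure_eq

/-- A face of a polytope is the convex hull of the generators it contains. -/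
theorem face_convexHull {V : Set (Fin 3 → ℝ)} (hV : V.Finite) {u : Fin 3 → ℝ} {c : ℝ}
    (h : ∀ x ∈ V, dotProd u x ≤ c) :
    {x ∈ convexHull ℝ V | dotProd u x = c} = convexHull ℝ {v ∈ V | dotProd u v = c} := by
  have hle : ∀ x ∈ convexHull ℝ V, dotProd u x ≤ c := fun x => dotProd_le_of_mem_convexHull h
  have hcv := convex_face (convex_convexHull ℝ V) u c
  refine Set.Subset.antisymm ?_ (convexHull_min
    (fun v hv => ⟨subset_convexHull ℝ V hv.1, hv.2⟩) hcv)
  have hsub : Set.extremePoints ℝ {x ∈ convexHull ℝ V | dotProd u x = c} ⊆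
      {v ∈ V | dotProd u v = c} := fun x hx =>
    ⟨extremePoints_convexHull_subset ((isExtreme_face hle).extremePoints_subset_extremePoints hx),
      hx.1.2⟩
  conv_lhs => rw [eq_convexHull_extremePoints (isCompact_face (hV.isCompact_convexHull ℝ) u c) hcv
    ((hV.subset fun v hv => hv.1).subset hsub)]
  exact convexHull_mono hsub

theorem exists_extremePoint_max {K : Set (Fin 3 → ℝ)} (hK : IsCompact K) (hne : K.Nonempty)
    (x : Fin 3 → ℝ) : ∃ u ∈ K.extremePoints ℝ, ∀ y ∈ K, dotProd y x ≤ dotProd u x := by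
  obtain ⟨m, hm, hmax⟩ := hK.exists_isMaxOn hne (continuous_dotProd x).continuousOn
  have hle : ∀ y ∈ K, dotProd x y ≤ dotProd x m := fun y hy => hmax hy
  obtain ⟨u, hu⟩ := (isCompact_face hK x (dotProd x m)).extremePoints_nonempty ⟨m, hm, rfl⟩
  refine ⟨u, (isExtreme_face hle).extremePoints_subset_extremePoints hu, fun y hy => ?_⟩
  rw [dotProd_comm y, dotProd_comm u, hu.1.2]
  exact hle y hy

theorem zero_mem_polar (P : Set (Fin 3 → ℝ)) : (0 : Fin 3 → ℝ) ∈ polar P := by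
  intro x _; simp [dotProd]

/-- Some vertex of the dual is positive on a given nonzero vector, and maximal there. -/
theorem exists_extremePoint_polar_pos {P : Set (Fin 3 → ℝ)} (hP : IsCompact P)
    (h0 : (0 : Fin 3 → ℝ) ∈ interior P) {x : Fin 3 → ℝ} (hx : x ≠ 0) :
    ∃ u ∈ (polar P).extremePoints ℝ, 0 < dotProd u x := by
  obtain ⟨u, hu, hmax⟩ := exists_extremePoint_max (isCompact_polar h0) ⟨0, zero_mem_polar P⟩ x
  refine ⟨u, hu, ?_⟩
  obtain ⟨m, -, hm⟩ := hP.exists_isMaxOn ⟨0, interior_subset h0⟩ (continuous_dotProd x).continuousOn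
  have hM : 0 < |dotProd x m| + 1 := by positivity
  have hmem : (|dotProd x m| + 1)⁻¹ • x ∈ polar P := fun p hp => by
    rw [smul_dotProd, inv_mul_le_iff₀ hM, mul_one]
    have : dotProd x p ≤ dotProd x m := hm hp
    linarith [le_abs_self (dotProd x m)]
  refine lt_of_lt_of_le ?_ (hmax _ hmem)
  rw [smul_dotProd]
  have := dotProd_self_pos hx
  positivity

theorem exists_linearIndependent_triple {A : Set (Fin 3 → ℝ)} (h : Submodule.span ℝ A = ⊤) :
    ∃ a ∈ A, ∃ b ∈ A, ∃ c ∈ A, LinearIndependent ℝ ![a, b, c] := by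
  obtain ⟨B, hBA, hB, hli⟩ := exists_linearIndependent ℝ A
  have hfin : Finite B := hli.finite
  have hcard : B.ncard = 3 := by
    have := Fintype.ofFinite B
    have h1 := finrank_span_set_eq_card hli
    rw [hB, h, finrank_top] at h1
    rw [Set.ncard_eq_toFinset_card']; simpa using h1.symm
  obtain ⟨a, b, c, hab, hac, hbc, rfl⟩ := Set.ncard_eq_three.1 hcard
  refine ⟨a, hBA (by simp), b, hBA (by simp), c, hBA (by simp), ?_⟩
  have := hli.comp (fun i : Fin 3 => (⟨![a, b, c] i, by fin_cases i <;> simp⟩ : ({a, b, c} : Set _)))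
    (by
      intro i j hij
      have hij := congrArg Subtype.val hij
      fin_cases i <;> fin_cases j <;> simp_all)
  exact this

theorem exists_dotProd_eq_zero {A : Set (Fin 3 → ℝ)} (h : Submodule.span ℝ A ≠ ⊤) :
    ∃ z : Fin 3 → ℝ, z ≠ 0 ∧ ∀ a ∈ A, dotProd z a = 0 := by
  obtain ⟨f, hf, hle⟩ := Submodule.exists_le_ker_of_lt_top _ (lt_top_iff_ne_top.2 h)
  obtain ⟨z, hz⟩ := exists_dotProd_eq f
  refine ⟨z, ?_, fun a ha => ?_⟩
  · rintro rfl
    exact hf (LinearMap.ext fun x => by rw [hz]; simp [dotProd])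
  · rw [← hz]; exact hle (Submodule.subset_span ha)

/-- At a vertex of the dual polytope three linearly independent inequalities are tight. -/
theorem exists_triple_of_extremePoint {V : Set (Fin 3 → ℝ)} (hV : V.Finite) {y : Fin 3 → ℝ}
    (hy : y ∈ (polar V).extremePoints ℝ) :
    ∃ a ∈ V, ∃ b ∈ V, ∃ c ∈ V, LinearIndependent ℝ ![a, b, c] ∧
      dotProd y a = 1 ∧ dotProd y b = 1 ∧ dotProd y c = 1 := by
  by_cases hs : Submodule.span ℝ {v ∈ V | dotProd y v = 1} = ⊤
  · obtain ⟨a, ha, b, hb, c, hc, hli⟩ := exists_linearIndependent_triple hs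
    exact ⟨a, ha.1, b, hb.1, c, hc.1, hli, ha.2, hb.2, hc.2⟩
  exfalso
  obtain ⟨z, hz, hzA⟩ := exists_dotProd_eq_zero hs
  have hev : ∀ v ∈ V, ∀ᶠ ε in nhds (0 : ℝ), dotProd y v + ε * dotProd z v ≤ 1 := by
    intro v hv
    rcases eq_or_lt_of_le (hy.1 v hv) with h | h
    · exact Filter.Eventually.of_forall fun ε => by rw [hzA v ⟨hv, h⟩, h]; simp
    · have hc : Continuous fun ε : ℝ => dotProd y v + ε * dotProd z v := by fun_prop
      have := hc.tendsto 0
      simp only [zero_mul, add_zero] at this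
      exact (this.eventually (gt_mem_nhds h)).mono fun _ => le_of_lt
  obtain ⟨δ, hδ, hball⟩ := Metric.eventually_nhds_iff.1 ((hV.eventually_all).2 hev)
  have hmem : ∀ ε : ℝ, |ε| < δ → y + ε • z ∈ polar V := fun ε hε v hv => by
    rw [add_dotProd, smul_dotProd]
    exact hball (by simpa using hε) v hv
  have h1 := hmem (δ / 2) (by rw [abs_of_pos (by positivity)]; linarith)
  have h2 := hmem (-(δ / 2)) (by rw [abs_neg, abs_of_pos (by positivity)]; linarith)
  have := hy.2 h1 h2 ⟨1 / 2, 1 / 2, by norm_num, by norm_num, by norm_num, by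
    ext i; simp; ring⟩
  have hzz : (δ / 2) • z = 0 := by simpa using this
  rcases smul_eq_zero.1 hzz with h | h
  · linarith
  · exact hz h

/-- A point of the dual with three linearly independent tight inequalities is a vertex. -/
theorem mem_extremePoints_polar {P : Set (Fin 3 → ℝ)} {y a b c : Fin 3 → ℝ} (hy : y ∈ polar P)
    (ha : a ∈ P) (hb : b ∈ P) (hc : c ∈ P) (hli : LinearIndependent ℝ ![a, b, c])
    (hya : dotProd y a = 1) (hyb : dotProd y b = 1) (hyc : dotProd y c = 1) :
    y ∈ (polar P).extremePoints ℝ := by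
  refine ⟨hy, fun y₁ h₁ y₂ h₂ hseg => ?_⟩
  have key : ∀ p ∈ P, dotProd y p = 1 → dotProd y₁ p = 1 := by
    intro p hp hyp
    have h := isExtreme_face (P := polar P) (u := p) (c := 1)
      fun z hz => by rw [dotProd_comm]; exact hz p hp
    have := h.2 h₁ h₂ ⟨hy, by rw [dotProd_comm]; exact hyp⟩ hseg
    rw [dotProd_comm]; exact this.2
  exact eq_of_dotProd_eq hli (by rw [key a ha hya, hya]) (by rw [key b hb hyb, hyb])
    (by rw [key c hc hyc, hyc])

/-- The normal form of a facet. -/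
theorem IsFacet.exists_normal {V F : Set (Fin 3 → ℝ)} (hV : V.Finite)
    (h0 : (0 : Fin 3 → ℝ) ∈ interior (convexHull ℝ V)) (hF : IsFacet (convexHull ℝ V) F) :
    ∃ y ∈ polar V, F = {x ∈ convexHull ℝ V | dotProd y x = 1} ∧
      ∃ a ∈ V, ∃ b ∈ V, ∃ c ∈ V, LinearIndependent ℝ ![a, b, c] ∧
        dotProd y a = 1 ∧ dotProd y b = 1 ∧ dotProd y c = 1 := by
  obtain ⟨⟨u, c, hle, rfl⟩, hne, hrank⟩ := hF
  have hc0 : 0 ≤ c := by simpa [dotProd_zero] using hle 0 (interior_subset h0)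
  have hu : u ≠ 0 := by
    rintro rfl
    have hz : ∀ x, dotProd (0 : Fin 3 → ℝ) x = 0 := fun x => by simp [dotProd]
    obtain ⟨p, hp⟩ := hne
    have hc : c = 0 := by rw [← hp.2, hz]
    subst hc
    have htop : vectorSpan ℝ {x ∈ convexHull ℝ V | dotProd 0 x = 0} = ⊤ := by
      rw [eq_top_iff]
      intro v _
      obtain ⟨t, ht, hm⟩ := exists_pos_smul_mem h0 v
      have := vsub_mem_vectorSpan ℝ
        (show t • v ∈ {x ∈ convexHull ℝ V | dotProd 0 x = 0} from ⟨hm, hz _⟩)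
        (show (0 : Fin 3 → ℝ) ∈ {x ∈ convexHull ℝ V | dotProd 0 x = 0} from
          ⟨interior_subset h0, hz _⟩)
      rw [vsub_eq_sub, sub_zero] at this
      exact (Submodule.smul_mem_iff _ ht.ne').1 this
    rw [htop] at hrank
    simp at hrank
  have hc : 0 < c := by
    obtain ⟨v, hv, hpos⟩ := exists_dotProd_pos h0 hu
    exact hpos.trans_le (hle v (subset_convexHull ℝ V hv))
  have hset : ∀ x, dotProd (c⁻¹ • u) x = 1 ↔ dotProd u x = c := fun x => by
    rw [smul_dotProd, inv_mul_eq_iff_eq_mul₀ hc.ne', mul_one]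
  have hpol : c⁻¹ • u ∈ polar V := fun x hx => by
    rw [smul_dotProd, inv_mul_le_iff₀ hc, mul_one]
    exact hle x (subset_convexHull ℝ V hx)
  refine ⟨c⁻¹ • u, hpol, by ext x; simp [hset], ?_⟩
  have hF := face_convexHull hV fun v hv => hle v (subset_convexHull ℝ V hv)
  have hspan : Submodule.span ℝ {v ∈ V | dotProd u v = c} = ⊤ := by
    by_contra hns
    obtain ⟨z, hz, hzA⟩ := exists_dotProd_eq_zero hns
    have hzF : ∀ x ∈ {x ∈ convexHull ℝ V | dotProd u x = c}, dotProd z x = 0 := by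
      rw [hF]
      exact convexHull_min (t := {x | dotLin z x = 0}) hzA
        (convex_hyperplane (dotLin z).isLinear 0)
    have hu' : dotLin u ≠ 0 := fun h => by
      have := dotProd_self_pos hu
      rw [← dotLin_apply, h] at this
      simp at this
    have hk : Module.finrank ℝ (LinearMap.ker (dotLin u)) = 2 := by
      have := Module.Dual.finrank_ker_add_one_of_ne_zero (K := ℝ) (f := dotLin u) hu'
      simp at this; omega
    have hker : vectorSpan ℝ {x ∈ convexHull ℝ V | dotProd u x = c} =
        LinearMap.ker (dotLin u) := by
      refine Submodule.eq_of_le_of_finrank_eq ?_ (by rw [hrank, hk])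
      rw [vectorSpan_def, Submodule.span_le]
      rintro _ ⟨x, hx, y, hy, rfl⟩
      simp [dotProd_sub, hx.2, hy.2]
    have hker' : LinearMap.ker (dotLin u) ≤ LinearMap.ker (dotLin z) := by
      rw [← hker, vectorSpan_def, Submodule.span_le]
      rintro _ ⟨x, hx, y, hy, rfl⟩
      simp [dotProd_sub, hzF x hx, hzF y hy]
    obtain ⟨p, hp⟩ := hne
    have hmem : z - (dotProd u z / c) • p ∈ LinearMap.ker (dotLin u) := by
      simp [dotProd_sub, dotProd_smul, hp.2, hc.ne']
    have := hker' hmem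
    simp only [LinearMap.mem_ker, dotLin_apply, dotProd_sub, dotProd_smul, hzF p hp, mul_zero,
      sub_zero] at this
    exact (dotProd_self_pos hz).ne' this
  obtain ⟨a, ha, b, hb, d, hd, hli⟩ := exists_linearIndependent_triple hspan
  exact ⟨a, ha.1, b, hb.1, d, hd.1, hli, (hset a).2 ha.2, (hset b).2 hb.2, (hset d).2 hd.2⟩

theorem isFacet_of_triple {P : Set (Fin 3 → ℝ)} {y a b c : Fin 3 → ℝ} (hy : y ∈ polar P)
    (ha : a ∈ P) (hb : b ∈ P) (hc : c ∈ P) (hli : LinearIndependent ℝ ![a, b, c])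
    (hya : dotProd y a = 1) (hyb : dotProd y b = 1) (hyc : dotProd y c = 1) :
    IsFacet P {x ∈ P | dotProd y x = 1} := by
  refine ⟨⟨y, 1, hy, rfl⟩, ⟨a, ha, hya⟩, ?_⟩
  have hy0 : dotLin y ≠ 0 := fun h => by
    rw [← dotLin_apply, h] at hya; simp at hya
  have hk : Module.finrank ℝ (LinearMap.ker (dotLin y)) = 2 := by
    have := Module.Dual.finrank_ker_add_one_of_ne_zero (K := ℝ) (f := dotLin y) hy0
    simp at this; omega
  have : vectorSpan ℝ {x ∈ P | dotProd y x = 1} = LinearMap.ker (dotLin y) := by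
    apply le_antisymm
    · rw [vectorSpan_def, Submodule.span_le]
      rintro _ ⟨p, hp, q, hq, rfl⟩
      simp [dotProd_sub, hp.2, hq.2]
    · intro x hx
      obtain ⟨α, β, γ, rfl⟩ := exists_coords hli x
      have hsum : α + β + γ = 0 := by
        simpa [dotProd_add, dotProd_smul, hya, hyb, hyc] using hx
      have : α • a + β • b + γ • c = β • (b -ᵥ a) + γ • (c -ᵥ a) := by
        have : α = -β - γ := by linarith
        subst this; ext i; simp; ring
      rw [this]
      exact add_mem
        (Submodule.smul_mem _ _ (vsub_mem_vectorSpan ℝ (⟨hb, hyb⟩ : b ∈ {x ∈ P | dotProd y x = 1})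
          ⟨ha, hya⟩))
        (Submodule.smul_mem _ _ (vsub_mem_vectorSpan ℝ (⟨hc, hyc⟩ : c ∈ {x ∈ P | dotProd y x = 1})
          ⟨ha, hya⟩))
  rw [this, hk]

namespace Pt

theorem det_lin (a b c p q r : Pt) :
    det (lin a b c p) (lin a b c q) (lin a b c r) = det a b c * det p q r := by
  simp only [det, lin, dot, cross]; ring

/-- Cramer's rule. -/
theorem lin_cramer (a b c q : Pt) :
    lin a b c ⟨det q b c, det a q c, det a b q⟩ =
      ⟨det a b c * q.x, det a b c * q.y, det a b c * q.z⟩ := by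
  ext <;> simp only [det, lin, dot, cross] <;> ring

theorem dot_lin (u a b c q : Pt) :
    u.dot (lin a b c q) = q.x * u.dot a + q.y * u.dot b + q.z * u.dot c := by
  simp only [lin, dot]; ring

theorem dot_add (u p q : Pt) : u.dot (p.add q) = u.dot p + u.dot q := by
  simp only [add, dot]; ring

theorem dot_zero (u : Pt) : u.dot zero = 0 := by
  simp [dot, zero]

/-- Three lattice points spanning a parallelepiped of volume one. -/
def IsBasis (a b c : Pt) : Prop := det a b c = 1 ∨ det a b c = -1

theorem IsBasis.sq {a b c : Pt} (h : IsBasis a b c) : det a b c * det a b c = 1 := by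
  rcases h with h | h <;> simp [h]

theorem IsBasis.ne_zero {a b c : Pt} (h : IsBasis a b c) : det a b c ≠ 0 := by
  rcases h with h | h <;> simp [h]

theorem IsBasis.linearIndependent {a b c : Pt} (h : IsBasis a b c) :
    LinearIndependent ℝ ![a.vec, b.vec, c.vec] :=
  (linearIndependent_vec_iff a b c).2 h.ne_zero

theorem IsBasis.swap_left {a b c : Pt} (h : IsBasis a b c) : IsBasis b a c := by
  have : det b a c = -det a b c := by simp only [det, dot, cross]; ring
  rcases h with h | h <;> simp [IsBasis, this, h]

theorem IsBasis.rotate {a b c : Pt} (h : IsBasis a b c) : IsBasis b c a := by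
  have : det b c a = det a b c := by simp only [det, dot, cross]; ring
  rwa [IsBasis, this]

theorem IsBasis.exists_lin_eq {a b c : Pt} (h : IsBasis a b c) (p : Pt) :
    ∃ q, lin a b c q = p := by
  have hs := h.sq
  have := lin_cramer a b c p
  simp only [lin, Pt.mk.injEq] at this
  obtain ⟨h1, h2, h3⟩ := this
  refine ⟨⟨det a b c * det p b c, det a b c * det a p c, det a b c * det a b p⟩, ?_⟩
  ext <;> simp only [lin]
  · linear_combination det a b c * h1 + p.x * hs
  · linear_combination det a b c * h2 + p.y * hs
  · linear_combination det a b c * h3 + p.z * hs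

theorem IsBasis.exists_dot_eq {a b c : Pt} (h : IsBasis a b c) (i j k : ℤ) :
    ∃ u : Pt, u.dot a = i ∧ u.dot b = j ∧ u.dot c = k := by
  have hs := h.sq
  set D := det a b c with hD
  refine ⟨lin (b.cross c) (c.cross a) (a.cross b) ⟨D * i, D * j, D * k⟩, ?_, ?_, ?_⟩
  · have : (lin (b.cross c) (c.cross a) (a.cross b) ⟨D * i, D * j, D * k⟩).dot a = D * i * D := by
      rw [hD]; simp only [lin, dot, cross, det]; ring
    rw [this]; linear_combination i * hs
  · have : (lin (b.cross c) (c.cross a) (a.cross b) ⟨D * i, D * j, D * k⟩).dot b = D * j * D := by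
      rw [hD]; simp only [lin, dot, cross, det]; ring
    rw [this]; linear_combination j * hs
  · have : (lin (b.cross c) (c.cross a) (a.cross b) ⟨D * i, D * j, D * k⟩).dot c = D * k * D := by
      rw [hD]; simp only [lin, dot, cross, det]; ring
    rw [this]; linear_combination k * hs

theorem IsBasis.isZBasisFamily {a b c : Pt} (h : IsBasis a b c) :
    IsZBasisFamily ![a.vec, b.vec, c.vec] := by
  refine ⟨h.linearIndependent, ?_, fun z hz => ?_⟩
  · intro i; fin_cases i
    exacts [a.isLatticePoint_vec, b.isLatticePoint_vec, c.isLatticePoint_vec]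
  · obtain ⟨p, rfl⟩ := hz.exists_pt
    obtain ⟨q, rfl⟩ := h.exists_lin_eq p
    exact ⟨![q.x, q.y, q.z], by simp [vec_lin, Fin.sum_univ_three]⟩

end Pt

theorem coords_unique {a b c : Fin 3 → ℝ} (h : LinearIndependent ℝ ![a, b, c])
    {i j k i' j' k' : ℝ} (he : i • a + j • b + k • c = i' • a + j' • b + k' • c) :
    i = i' ∧ j = j' ∧ k = k' := by
  have := Fintype.linearIndependent_iff.1 h ![i - i', j - j', k - k'] (by
    simp only [Fin.sum_univ_three, Matrix.cons_val_zero, Matrix.cons_val_one, Matrix.cons_val]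
    rw [← sub_eq_zero] at he
    rw [← he]; ext t; simp; ring)
  have h0 := this 0
  have h1 := this 1
  have h2 := this 2
  simp only [Matrix.cons_val_zero, Matrix.cons_val_one, Matrix.cons_val] at h0 h1 h2
  exact ⟨by linarith, by linarith, by linarith⟩

theorem mem_convexHull_triple {a b c x : Fin 3 → ℝ} :
    x ∈ convexHull ℝ {a, b, c} ↔
      ∃ i j k : ℝ, 0 ≤ i ∧ 0 ≤ j ∧ 0 ≤ k ∧ i + j + k = 1 ∧ i • a + j • b + k • c = x := by
  constructor
  · intro h
    rw [convexHull_insert (Set.insert_nonempty _ _), convexHull_pair] at h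
    simp only [mem_convexJoin, Set.mem_singleton_iff, exists_eq_left] at h
    obtain ⟨y, ⟨s, t, hs, ht, hst, rfl⟩, ⟨p, q, hp, hq, hpq, rfl⟩⟩ := h
    exact ⟨p, q * s, q * t, hp, by positivity, by positivity, by
      rw [add_assoc, ← mul_add, hst, mul_one, hpq], by ext; simp; ring⟩
  · rintro ⟨i, j, k, hi, hj, hk, hs, rfl⟩
    have := (convex_convexHull ℝ {a, b, c}).sum_mem (t := Finset.univ) (w := ![i, j, k])
      (z := ![a, b, c]) (by intro n _; fin_cases n <;> simpa)
      (by simpa [Fin.sum_univ_three] using hs)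
      (by intro n _; fin_cases n <;> exact subset_convexHull ℝ _ (by simp))
    simpa [Fin.sum_univ_three] using this

theorem exists_coords_of_mem_convexHull_four {a b c d x : Fin 3 → ℝ}
    (h : x ∈ convexHull ℝ {a, b, c, d}) :
    ∃ i j k l : ℝ, 0 ≤ i ∧ 0 ≤ j ∧ 0 ≤ k ∧ 0 ≤ l ∧ i + j + k + l = 1 ∧
      i • a + j • b + k • c + l • d = x := by
  rw [convexHull_insert (Set.insert_nonempty _ _)] at h
  simp only [mem_convexJoin, Set.mem_singleton_iff, exists_eq_left] at h
  obtain ⟨y, hy, ⟨p, q, hp, hq, hpq, rfl⟩⟩ := h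
  obtain ⟨s, t, r, hs, ht, hr, hst, rfl⟩ := mem_convexHull_triple.1 hy
  exact ⟨p, q * s, q * t, q * r, hp, by positivity, by positivity, by positivity, by
    linear_combination hpq + q * hst, by ext; simp; ring⟩

/-- An empty lattice triangle at height one is unimodular. -/
theorem isBasis_of_empty {u a b c : Pt} (hdet : Pt.det a b c ≠ 0)
    (ha : u.dot a = 1) (hb : u.dot b = 1) (hc : u.dot c = 1)
    (hempty : ∀ p : Pt, p.vec ∈ convexHull ℝ {a.vec, b.vec, c.vec} → p = a ∨ p = b ∨ p = c) :
    Pt.IsBasis a b c := by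
  have hli := (linearIndependent_vec_iff a b c).2 hdet
  have small : ∀ i j k : ℝ, 0 ≤ i → 0 ≤ j → 0 ≤ k → i + j + k = 1 → ∀ p : Pt,
      i • a.vec + j • b.vec + k • c.vec = p.vec →
      (i = 1 ∧ j = 0 ∧ k = 0) ∨ (i = 0 ∧ j = 1 ∧ k = 0) ∨ (i = 0 ∧ j = 0 ∧ k = 1) := by
    intro i j k hi hj hk hs p hp
    rcases hempty p (mem_convexHull_triple.2 ⟨i, j, k, hi, hj, hk, hs, hp⟩) with rfl | rfl | rfl
    · exact Or.inl (coords_unique hli (by rw [hp]; simp))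
    · exact Or.inr (Or.inl (coords_unique hli (by rw [hp]; simp)))
    · exact Or.inr (Or.inr (coords_unique hli (by rw [hp]; simp)))
  have key : ∀ p : Pt, ∃ q, Pt.lin a b c q = p := by
    intro p
    obtain ⟨α, β, γ, hp⟩ := exists_coords hli p.vec
    set q : Pt := ⟨⌊α⌋, ⌊β⌋, ⌊γ⌋⟩ with hq
    set r : Pt := p.sub (Pt.lin a b c q) with hr
    have hrv : Int.fract α • a.vec + Int.fract β • b.vec + Int.fract γ • c.vec = r.vec := by
      have : r.vec = p.vec - (Pt.lin a b c q).vec := by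
        rw [hr]; ext i; fin_cases i <;> simp [Pt.vec, Pt.sub]
      rw [this, hp, Pt.vec_lin]
      simp only [hq, ← Int.self_sub_floor]
      ext i; simp only [Pi.add_apply, Pi.sub_apply, Pi.smul_apply, smul_eq_mul]; ring
    have hsum : Int.fract α + Int.fract β + Int.fract γ = (u.dot r : ℝ) := by
      rw [← dotProd_vec, ← hrv]
      simp [dotProd_add, dotProd_smul, dotProd_vec, ha, hb, hc]
    have h1 := Int.fract_nonneg α
    have h2 := Int.fract_nonneg β
    have h3 := Int.fract_nonneg γ
    have h1' := Int.fract_lt_one α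
    have h2' := Int.fract_lt_one β
    have h3' := Int.fract_lt_one γ
    have hlo : (-1 : ℝ) < (u.dot r : ℝ) := by rw [← hsum]; linarith
    have hhi : (u.dot r : ℝ) < 3 := by rw [← hsum]; linarith
    have hlo' : -1 < u.dot r := by exact_mod_cast hlo
    have hhi' : u.dot r < 3 := by exact_mod_cast hhi
    have hcases : u.dot r = 0 ∨ u.dot r = 1 ∨ u.dot r = 2 := by omega
    rcases hcases with h | h | h <;> rw [h] at hsum
    · refine ⟨q, ?_⟩
      have e1 : Int.fract α = 0 := by push_cast at hsum; linarith
      have e2 : Int.fract β = 0 := by push_cast at hsum; linarith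
      have e3 : Int.fract γ = 0 := by push_cast at hsum; linarith
      rw [e1, e2, e3] at hrv
      have : r = Pt.zero := Pt.vec_injective (by rw [← hrv, Pt.vec_zero]; simp)
      rw [hr] at this
      simp only [Pt.sub, Pt.zero, Pt.mk.injEq] at this
      ext <;> omega
    · push_cast at hsum
      rcases small _ _ _ h1 h2 h3 hsum r hrv with h | h | h <;> linarith [h.1, h.2.1, h.2.2]
    · push_cast at hsum
      have := small (1 - Int.fract α) (1 - Int.fract β) (1 - Int.fract γ) (by linarith)
        (by linarith) (by linarith) (by linarith) (((a.add b).add c).sub r) (by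
          have : (((a.add b).add c).sub r).vec = a.vec + b.vec + c.vec - r.vec := by
            ext i; fin_cases i <;> simp [Pt.vec, Pt.sub, Pt.add]
          rw [this, ← hrv]
          ext i; simp; ring)
      rcases this with h | h | h <;> linarith [h.1, h.2.1, h.2.2]
  obtain ⟨p, hp⟩ := key ⟨1, 0, 0⟩
  obtain ⟨q, hq⟩ := key ⟨0, 1, 0⟩
  obtain ⟨r, hr⟩ := key ⟨0, 0, 1⟩
  have := Pt.det_lin a b c p q r
  rw [hp, hq, hr] at this
  exact Int.isUnit_iff.1 (IsUnit.of_mul_eq_one _ this.symm)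

/-- The lattice polytope spanned by a set of lattice points. -/
def Pt.hull (S : Set Pt) : Set (Fin 3 → ℝ) := convexHull ℝ (Pt.vec '' S)

/-- The combinatorial properties of the set of vertices of a terminal reflexive polytope which
determine the classification. -/
structure Good (S : Set Pt) : Prop where
  odd : ∀ v ∈ S, ¬(2 ∣ v.x ∧ 2 ∣ v.y ∧ 2 ∣ v.z)
  cong : ∀ v ∈ S, ∀ w ∈ S, v ≠ w → 2 ∣ v.x - w.x → 2 ∣ v.y - w.y → 2 ∣ v.z - w.z →
    v.add w = Pt.zero
  pos : ∀ n : Pt, n ≠ Pt.zero → ∃ s ∈ S, 0 < n.dot s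
  unimod : ∀ a ∈ S, ∀ b ∈ S, ∀ c ∈ S, ∀ (y : Pt) (d : ℤ), 0 < d → y.dot a = d → y.dot b = d →
    y.dot c = d → (∀ s ∈ S, y.dot s ≤ d) → Pt.det a b c ≠ 0 → Pt.IsBasis a b c

theorem midpoint_extreme {P : Set (Fin 3 → ℝ)} {x y m : Fin 3 → ℝ} (hm : m ∈ P.extremePoints ℝ)
    (hx : x ∈ P) (hy : y ∈ P) (h : x + y = (2 : ℝ) • m) : x = y := by
  have hseg : m ∈ openSegment ℝ x y :=
    ⟨1 / 2, 1 / 2, by norm_num, by norm_num, by norm_num, by rw [← smul_add, h, smul_smul]; simp⟩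
  have h1 := hm.2 hx hy hseg
  rw [openSegment_symm] at hseg
  rw [h1, hm.2 hy hx hseg]

theorem IsReflexive.exists_pt_of_extremePoint {P : Set (Fin 3 → ℝ)} (hP : IsReflexive P)
    {y : Fin 3 → ℝ} (hy : y ∈ (polar P).extremePoints ℝ) : ∃ u : Pt, u.vec = y := by
  obtain ⟨V, hV, h⟩ := isLatticePolytope_polar_iff.2 hP.2.2
  rw [h] at hy
  exact (hV y (extremePoints_convexHull_subset hy)).exists_pt

theorem IsReflexive.isCompact {P : Set (Fin 3 → ℝ)} (hP : IsReflexive P) : IsCompact P := by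
  obtain ⟨V, hV, rfl⟩ := hP.1
  exact V.finite_toSet.isCompact_convexHull ℝ

theorem IsReflexive.finite_extremePoints {P : Set (Fin 3 → ℝ)} (hP : IsReflexive P) :
    (P.extremePoints ℝ).Finite := by
  obtain ⟨V, hV, rfl⟩ := hP.1
  exact V.finite_toSet.subset extremePoints_convexHull_subset

theorem IsReflexive.convex {P : Set (Fin 3 → ℝ)} (hP : IsReflexive P) : Convex ℝ P := by
  obtain ⟨V, hV, rfl⟩ := hP.1
  exact convex_convexHull ℝ _

theorem IsReflexive.isLatticePoint_of_extremePoint {P : Set (Fin 3 → ℝ)} (hP : IsReflexive P)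
    {x : Fin 3 → ℝ} (hx : x ∈ P.extremePoints ℝ) : IsLatticePoint x := by
  obtain ⟨V, hV, rfl⟩ := hP.1
  exact hV x (extremePoints_convexHull_subset hx)

theorem IsReflexive.zero_notMem_extremePoints {P : Set (Fin 3 → ℝ)} (hP : IsReflexive P) :
    (0 : Fin 3 → ℝ) ∉ P.extremePoints ℝ := by
  intro h
  obtain ⟨s, hs, hsP⟩ := exists_pos_smul_mem hP.2.1 (Pi.single 0 1)
  obtain ⟨t, ht, htP⟩ := exists_pos_smul_mem hP.2.1 (-Pi.single 0 1)
  have := h.2 hsP htP ⟨t / (s + t), s / (s + t), by positivity, by positivity, by field_simp; ring,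
    by ext i; simp; field_simp; simp⟩
  have := congrFun this 0
  simp at this
  linarith

/-- The vertices of a terminal reflexive polytope. -/
theorem exists_good {P : Set (Fin 3 → ℝ)} (hP : IsReflexive P) (hT : IsTerminalPolytope P) :
    ∃ S : Set Pt, S.Finite ∧ P = Pt.hull S ∧ Pt.vec '' S = P.extremePoints ℝ ∧ Good S := by
  set S : Set Pt := {p | p.vec ∈ P.extremePoints ℝ} with hS
  have himg : Pt.vec '' S = P.extremePoints ℝ := by
    refine Set.Subset.antisymm ?_ fun x hx => ?_
    · rintro _ ⟨p, hp, rfl⟩; exact hp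
    · obtain ⟨p, rfl⟩ := (hP.isLatticePoint_of_extremePoint hx).exists_pt
      exact ⟨p, hx, rfl⟩
  have hfin : S.Finite :=
    Set.Finite.of_finite_image (by rw [himg]; exact hP.finite_extremePoints)
      Pt.vec_injective.injOn
  have hhull : P = Pt.hull S := by
    rw [Pt.hull, himg]
    exact eq_convexHull_extremePoints hP.isCompact hP.convex hP.finite_extremePoints
  have hlat : ∀ p : Pt, p.vec ∈ P → p = Pt.zero ∨ p ∈ S := by
    intro p hp
    have : p.vec ∈ {x ∈ P | IsLatticePoint x} := ⟨hp, p.isLatticePoint_vec⟩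
    rw [hT] at this
    rcases this with h | h
    · exact Or.inl (Pt.vec_injective (by rw [h, Pt.vec_zero]))
    · exact Or.inr h
  have h0S : Pt.zero ∉ S := fun h => hP.zero_notMem_extremePoints (Pt.vec_zero ▸ h)
  have h0P : (0 : Fin 3 → ℝ) ∈ P := interior_subset hP.2.1
  have hmid : ∀ x ∈ P, ∀ y ∈ P, ∀ m : Pt, x + y = (2 : ℝ) • m.vec → m.vec ∈ P := by
    intro x hx y hy m h
    have := hP.convex hx hy (a := 1 / 2) (b := 1 / 2) (by norm_num) (by norm_num) (by norm_num)
    rwa [← smul_add, h, smul_smul, one_div, inv_mul_cancel₀ two_ne_zero, one_smul] at this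
  refine ⟨S, hfin, hhull, himg, ?_, ?_, ?_, ?_⟩
  · rintro ⟨x, y, z⟩ hv ⟨⟨i, hi⟩, ⟨j, hj⟩, ⟨k, hk⟩⟩
    simp only at hi hj hk
    have he : (⟨x, y, z⟩ : Pt).vec + 0 = (2 : ℝ) • (⟨i, j, k⟩ : Pt).vec := by
      subst hi hj hk; ext t; fin_cases t <;> simp [Pt.vec]
    rcases hlat _ (hmid _ hv.1 _ h0P _ he) with h | h
    · rw [h, Pt.vec_zero, smul_zero, add_zero, ← Pt.vec_zero] at he
      exact h0S (Pt.vec_injective he ▸ hv)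
    · have := midpoint_extreme h hv.1 h0P he
      rw [← Pt.vec_zero] at this
      exact h0S (Pt.vec_injective this ▸ hv)
  · rintro ⟨x, y, z⟩ hv ⟨x', y', z'⟩ hw hne ⟨i, hi⟩ ⟨j, hj⟩ ⟨k, hk⟩
    simp only at hi hj hk
    have e1 : x = x' + 2 * i := by omega
    have e2 : y = y' + 2 * j := by omega
    have e3 : z = z' + 2 * k := by omega
    subst e1 e2 e3
    have he : (⟨x' + 2 * i, y' + 2 * j, z' + 2 * k⟩ : Pt).vec + (⟨x', y', z'⟩ : Pt).vec =
        (2 : ℝ) • (⟨x' + i, y' + j, z' + k⟩ : Pt).vec := by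
      ext t; fin_cases t <;> simp [Pt.vec] <;> ring
    rcases hlat _ (hmid _ hv.1 _ hw.1 _ he) with h | h
    · simp only [Pt.zero, Pt.mk.injEq] at h
      simp only [Pt.add, Pt.zero, Pt.mk.injEq]
      omega
    · exact absurd (Pt.vec_injective (midpoint_extreme h hv.1 hw.1 he)) hne
  · intro n hn
    have hi : (0 : Fin 3 → ℝ) ∈ interior (convexHull ℝ (Pt.vec '' S)) := by
      have := hP.2.1; rw [hhull] at this; exact this
    obtain ⟨_, ⟨s, hs, rfl⟩, h⟩ := exists_dotProd_pos hi (y := n.vec)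
      fun h => hn (Pt.vec_injective (by rw [h, Pt.vec_zero]))
    rw [dotProd_vec] at h
    exact ⟨s, hs, by exact_mod_cast h⟩
  · intro a ha b hb c hc y d hd hya hyb hyc hle hdet
    have hd' : (0 : ℝ) < d := by exact_mod_cast hd
    have heq : ∀ s : Pt, y.dot s = d → dotProd ((d : ℝ)⁻¹ • y.vec) s.vec = 1 := by
      intro s hs
      rw [smul_dotProd, dotProd_vec, hs]; exact inv_mul_cancel₀ hd'.ne'
    have hpol : (d : ℝ)⁻¹ • y.vec ∈ polar P := by
      rw [hhull, Pt.hull, polar_convexHull]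
      rintro _ ⟨s, hs, rfl⟩
      rw [smul_dotProd, dotProd_vec, inv_mul_le_iff₀ hd', mul_one]
      exact_mod_cast hle s hs
    obtain ⟨u, hu⟩ := hP.exists_pt_of_extremePoint (mem_extremePoints_polar hpol ha.1 hb.1 hc.1
      ((linearIndependent_vec_iff a b c).2 hdet) (heq a hya) (heq b hyb) (heq c hyc))
    have heq' : ∀ s : Pt, y.dot s = d → u.dot s = 1 := by
      intro s hs
      have := heq s hs
      rw [← hu, dotProd_vec] at this
      exact_mod_cast this
    refine isBasis_of_empty hdet (heq' a hya) (heq' b hyb) (heq' c hyc) fun p hp => ?_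
    have hsub : convexHull ℝ {a.vec, b.vec, c.vec} ⊆ P :=
      convexHull_min (by
        rintro _ (rfl | rfl | rfl)
        exacts [ha.1, hb.1, hc.1]) hP.convex
    have hup : (1 : ℝ) ≤ dotProd u.vec p.vec := by
      have := dotProd_le_of_mem_convexHull (u := -u.vec) (c := -1) (A := {a.vec, b.vec, c.vec}) (by
        rintro _ (rfl | rfl | rfl) <;>
        simp [neg_dotProd, dotProd_vec, heq' a hya, heq' b hyb, heq' c hyc]) hp
      rw [neg_dotProd] at this; linarith
    rcases hlat p (hsub hp) with rfl | h
    · rw [Pt.vec_zero, dotProd_zero] at hup; linarith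
    · have hext := extremePoints_convexHull_subset
        (inter_extremePoints_subset_extremePoints_of_subset hsub ⟨hp, h⟩)
      rcases hext with h | h | h
      · exact Or.inl (Pt.vec_injective h)
      · exact Or.inr (Or.inl (Pt.vec_injective h))
      · exact Or.inr (Or.inr (Pt.vec_injective h))

namespace Pt

/-- The fourth vertex of the parallelogram with diagonal `a, b` and third vertex `c`. -/
def fourth (a b c : Pt) : Pt := (a.add b).sub c

theorem dot_fourth (u a b c : Pt) : u.dot (fourth a b c) = u.dot a + u.dot b - u.dot c := by
  simp only [fourth, add, sub, dot]; ring

theorem vec_fourth (a b c : Pt) : (fourth a b c).vec = a.vec + b.vec - c.vec := by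
  ext i; fin_cases i <;> simp [vec, fourth, add, sub]

theorem lin_eq_iff (a b c : Pt) (h : det a b c ≠ 0) (q q' : Pt) :
    lin a b c q = lin a b c q' ↔ q = q' := by
  refine ⟨fun he => ?_, fun he => he ▸ rfl⟩
  have := congrArg vec he
  rw [vec_lin, vec_lin] at this
  obtain ⟨h1, h2, h3⟩ := coords_unique ((linearIndependent_vec_iff a b c).2 h) this
  exact Pt.ext (by exact_mod_cast h1) (by exact_mod_cast h2) (by exact_mod_cast h3)

end Pt

/-- The shape of a facet: a unimodular triangle or a unimodular parallelogram. -/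
def IsUnimodularFacet (F : Set (Fin 3 → ℝ)) : Prop :=
  (∃ x y z : Fin 3 → ℝ, Set.extremePoints ℝ F = {x, y, z} ∧ IsZBasisFamily ![x, y, z]) ∨
  (∃ v w x y : Fin 3 → ℝ, Set.extremePoints ℝ F = {v, w, x, y} ∧
    F = convexHull ℝ ({v, w, x, y} : Set (Fin 3 → ℝ)) ∧
    IsZBasisFamily ![v, x, w] ∧ v + x = w + y)

/-- The lattice points of `S` on the hyperplane `u = 1`. -/
def tight (S : Set Pt) (u : Pt) : Set Pt := {s ∈ S | u.dot s = 1}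

theorem mem_extremePoints_of_lt {A : Set (Fin 3 → ℝ)} {p w : Fin 3 → ℝ} (hA : A.Finite)
    (hp : p ∈ A) (h : ∀ q ∈ A, q ≠ p → dotProd w q < dotProd w p) :
    p ∈ (convexHull ℝ A).extremePoints ℝ := by
  have hle : ∀ q ∈ A, dotProd w q ≤ dotProd w p := fun q hq => by
    by_cases hqp : q = p
    · rw [hqp]
    · exact (h q hq hqp).le
  have hface := face_convexHull hA hle
  have hsing : {v ∈ A | dotProd w v = dotProd w p} = {p} := by
    ext v; constructor
    · rintro ⟨hv, he⟩
      by_contra hne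
      exact (h v hv hne).ne he
    · rintro rfl; exact ⟨hp, rfl⟩
  rw [hsing, convexHull_singleton] at hface
  have := isExtreme_face (P := convexHull ℝ A)
    fun x hx => dotProd_le_of_mem_convexHull hle hx
  rw [hface] at this
  exact this.extremePoints_subset_extremePoints (by simp)

theorem mem_extremePoints_hull {A : Set Pt} {p w : Pt} (hA : A.Finite)
    (hp : p ∈ A) (h : ∀ q ∈ A, q ≠ p → w.dot q < w.dot p) :
    p.vec ∈ (Pt.hull A).extremePoints ℝ := by
  refine mem_extremePoints_of_lt (hA.image _) ⟨p, hp, rfl⟩ (w := w.vec) ?_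
  rintro _ ⟨q, hq, rfl⟩ hne
  rw [dotProd_vec, dotProd_vec]
  exact_mod_cast h q hq fun e => hne (by rw [e])

theorem extremePoints_hull_triple {a b c : Pt} (h : Pt.IsBasis a b c) :
    (Pt.hull {a, b, c}).extremePoints ℝ = {a.vec, b.vec, c.vec} := by
  have himg : Pt.vec '' {a, b, c} = {a.vec, b.vec, c.vec} := by simp [Set.image_insert_eq]
  refine Set.Subset.antisymm (himg ▸ extremePoints_convexHull_subset) ?_
  have hfin : ({a, b, c} : Set Pt).Finite := Set.toFinite _
  rintro _ (rfl | rfl | rfl)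
  · obtain ⟨w, h1, h2, h3⟩ := h.exists_dot_eq 1 0 0
    refine mem_extremePoints_hull (w := w) hfin (by simp) ?_
    rintro q (rfl | rfl | rfl) hne <;> simp_all
  · obtain ⟨w, h1, h2, h3⟩ := h.exists_dot_eq 0 1 0
    refine mem_extremePoints_hull (w := w) hfin (by simp) ?_
    rintro q (rfl | rfl | rfl) hne <;> simp_all
  · obtain ⟨w, h1, h2, h3⟩ := h.exists_dot_eq 0 0 1
    refine mem_extremePoints_hull (w := w) hfin (by simp) ?_
    rintro q (rfl | rfl | rfl) hne <;> simp_all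

theorem extremePoints_hull_parallelogram {a b c : Pt} (h : Pt.IsBasis a b c) :
    (Pt.hull {a, b, c, Pt.fourth a b c}).extremePoints ℝ =
      {a.vec, c.vec, b.vec, (Pt.fourth a b c).vec} := by
  have himg : Pt.vec '' {a, b, c, Pt.fourth a b c} =
      {a.vec, c.vec, b.vec, (Pt.fourth a b c).vec} := by
    simp only [Set.image_insert_eq, Set.image_singleton]
    rw [Set.insert_comm b.vec]
  refine Set.Subset.antisymm (himg ▸ extremePoints_convexHull_subset) ?_
  have hfin : ({a, b, c, Pt.fourth a b c} : Set Pt).Finite := Set.toFinite _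
  rintro _ (rfl | rfl | rfl | rfl)
  · obtain ⟨w, h1, h2, h3⟩ := h.exists_dot_eq 1 (-1) 0
    refine mem_extremePoints_hull (w := w) hfin (by simp) ?_
    rintro q (rfl | rfl | rfl | rfl) hne <;> simp_all [Pt.dot_fourth]
  · obtain ⟨w, h1, h2, h3⟩ := h.exists_dot_eq 0 0 1
    refine mem_extremePoints_hull (w := w) hfin (by simp) ?_
    rintro q (rfl | rfl | rfl | rfl) hne <;> simp_all [Pt.dot_fourth]
  · obtain ⟨w, h1, h2, h3⟩ := h.exists_dot_eq (-1) 1 0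
    refine mem_extremePoints_hull (w := w) hfin (by simp) ?_
    rintro q (rfl | rfl | rfl | rfl) hne <;> simp_all [Pt.dot_fourth]
  · obtain ⟨w, h1, h2, h3⟩ := h.exists_dot_eq 0 0 (-1)
    refine mem_extremePoints_hull (w := w) hfin (by simp) ?_
    rintro q (rfl | rfl | rfl | rfl) hne <;> simp_all [Pt.dot_fourth]

/-- `A` consists of a lattice basis, or of a lattice basis `a, b, c` together with `a + b - c`. -/
def IsUnimodularSet (A : Set Pt) : Prop :=
  ∃ a b c, Pt.IsBasis a b c ∧ (A = {a, b, c} ∨ A = {a, b, c, Pt.fourth a b c})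

theorem IsUnimodularSet.isUnimodularFacet {A : Set Pt} (h : IsUnimodularSet A) :
    IsUnimodularFacet (Pt.hull A) := by
  obtain ⟨a, b, c, hb, rfl | rfl⟩ := h
  · exact Or.inl ⟨_, _, _, extremePoints_hull_triple hb, hb.isZBasisFamily⟩
  · refine Or.inr ⟨a.vec, c.vec, b.vec, (Pt.fourth a b c).vec,
      extremePoints_hull_parallelogram hb, ?_, hb.isZBasisFamily, ?_⟩
    · simp only [Pt.hull, Set.image_insert_eq, Set.image_singleton]
      rw [Set.insert_comm b.vec]
    · rw [Pt.vec_fourth]; abel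

theorem hull_face {S : Set Pt} (hS : S.Finite) {u : Pt} (hle : ∀ s ∈ S, u.dot s ≤ 1) :
    {x ∈ Pt.hull S | dotProd u.vec x = 1} = Pt.hull (tight S u) := by
  rw [Pt.hull, face_convexHull (hS.image _)]
  · rw [Pt.hull]
    congr 1
    ext x
    constructor
    · rintro ⟨⟨s, hs, rfl⟩, h⟩
      rw [dotProd_vec] at h
      exact ⟨s, ⟨hs, by exact_mod_cast h⟩, rfl⟩
    · rintro ⟨s, ⟨hs, h⟩, rfl⟩
      exact ⟨⟨s, hs, rfl⟩, by rw [dotProd_vec, h]; simp⟩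
  · rintro _ ⟨s, hs, rfl⟩
    rw [dotProd_vec]; exact_mod_cast hle s hs

theorem IsUnimodularSet.of_subset {A : Set Pt} {a b c : Pt} (hb : Pt.IsBasis a b c)
    (haA : a ∈ A) (hbA : b ∈ A) (hcA : c ∈ A)
    (hdet : ∀ s ∈ A, s ≠ a → s ≠ b → s ≠ c →
      s = Pt.fourth a b c ∨ s = Pt.fourth a c b ∨ s = Pt.fourth b c a)
    (huniq : ∀ s ∈ A, ∀ t ∈ A, s ≠ a → s ≠ b → s ≠ c → t ≠ a → t ≠ b → t ≠ c → s = t) :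
    IsUnimodularSet A := by
  by_cases hex : ∃ s ∈ A, s ≠ a ∧ s ≠ b ∧ s ≠ c
  · obtain ⟨s, hs, h1, h2, h3⟩ := hex
    have hA : A = {a, b, c, s} := by
      ext t; constructor
      · intro ht
        by_contra hn
        simp only [Set.mem_insert_iff, Set.mem_singleton_iff, not_or] at hn
        exact hn.2.2.2 (huniq t ht s hs hn.1 hn.2.1 hn.2.2.1 h1 h2 h3)
      · rintro (rfl | rfl | rfl | rfl) <;> assumption
    rcases hdet s hs h1 h2 h3 with rfl | rfl | rfl
    · exact ⟨a, b, c, hb, Or.inr hA⟩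
    · refine ⟨a, c, b, hb.rotate.rotate.swap_left, Or.inr ?_⟩
      rw [hA]; ext t; simp only [Set.mem_insert_iff, Set.mem_singleton_iff]; tauto
    · refine ⟨b, c, a, hb.rotate, Or.inr ?_⟩
      rw [hA]; ext t; simp only [Set.mem_insert_iff, Set.mem_singleton_iff]; tauto
  · push Not at hex
    refine ⟨a, b, c, hb, Or.inl ?_⟩
    ext t; constructor
    · intro ht
      by_contra hn
      simp only [Set.mem_insert_iff, Set.mem_singleton_iff, not_or] at hn
      exact hn.2.2 (hex t ht hn.1 hn.2.1)
    · rintro (rfl | rfl | rfl) <;> assumption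

theorem Good.isUnimodularSet {S : Set Pt} (hS : Good S) {u a b c : Pt} (ha : a ∈ S) (hb : b ∈ S)
    (hc : c ∈ S) (hdet : Pt.det a b c ≠ 0) (hua : u.dot a = 1) (hub : u.dot b = 1)
    (huc : u.dot c = 1) (hle : ∀ s ∈ S, u.dot s ≤ 1) : IsUnimodularSet (tight S u) := by
  have hu : ∀ i ∈ S, ∀ j ∈ S, ∀ k ∈ S, u.dot i = 1 → u.dot j = 1 → u.dot k = 1 →
      Pt.det i j k ≠ 0 → Pt.IsBasis i j k := fun i hi j hj k hk h1 h2 h3 h =>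
    hS.unimod i hi j hj k hk u 1 one_pos h1 h2 h3 hle h
  have hbas := hu a ha b hb c hc hua hub huc hdet
  have hne : ∀ s ∈ S, ∀ t ∈ S, u.dot s = 1 → u.dot t = 1 → 2 ∣ s.x - t.x → 2 ∣ s.y - t.y →
      2 ∣ s.z - t.z → s = t := by
    intro s hs t ht h1 h2 hx hy hz
    by_contra hst
    have := congrArg u.dot (hS.cong s hs t ht hst hx hy hz)
    rw [Pt.dot_add, Pt.dot_zero] at this
    omega
  have hlin : ∀ q q' : Pt, 2 ∣ q.x - q'.x → 2 ∣ q.y - q'.y → 2 ∣ q.z - q'.z →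
      Pt.lin a b c q ∈ S → Pt.lin a b c q' ∈ S → u.dot (Pt.lin a b c q) = 1 →
      u.dot (Pt.lin a b c q') = 1 → Pt.lin a b c q = Pt.lin a b c q' := by
    rintro q q' ⟨i, hi⟩ ⟨j, hj⟩ ⟨k, hk⟩ h1 h2 h3 h4
    refine hne _ h1 _ h2 h3 h4 ⟨i * a.x + j * b.x + k * c.x, ?_⟩
      ⟨i * a.y + j * b.y + k * c.y, ?_⟩ ⟨i * a.z + j * b.z + k * c.z, ?_⟩ <;>
      simp only [Pt.lin]
    · linear_combination a.x * hi + b.x * hj + c.x * hk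
    · linear_combination a.y * hi + b.y * hj + c.y * hk
    · linear_combination a.z * hi + b.z * hj + c.z * hk
  have ea : Pt.lin a b c ⟨1, 0, 0⟩ = a := by ext <;> simp [Pt.lin]
  have eb : Pt.lin a b c ⟨0, 1, 0⟩ = b := by ext <;> simp [Pt.lin]
  have ec : Pt.lin a b c ⟨0, 0, 1⟩ = c := by ext <;> simp [Pt.lin]
  have hodd : ∀ q : Pt, Pt.lin a b c q ∈ tight S u → Pt.lin a b c q ≠ a → Pt.lin a b c q ≠ b →
      Pt.lin a b c q ≠ c → q.x + q.y + q.z = 1 ∧ ¬2 ∣ q.x ∧ ¬2 ∣ q.y ∧ ¬2 ∣ q.z := by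
    rintro q ⟨hq, hq1⟩ h1 h2 h3
    have hsum : q.x + q.y + q.z = 1 := by
      rw [Pt.dot_lin, hua, hub, huc] at hq1; linarith
    have k1 := hlin q ⟨1, 0, 0⟩
    have k2 := hlin q ⟨0, 1, 0⟩
    have k3 := hlin q ⟨0, 0, 1⟩
    rw [ea] at k1; rw [eb] at k2; rw [ec] at k3
    refine ⟨hsum, ?_⟩
    by_contra hn
    by_cases c1 : 2 ∣ q.x <;> by_cases c2 : 2 ∣ q.y <;> by_cases c3 : 2 ∣ q.z
    · omega
    · exact h3 (k3 (by simpa) (by simpa) (by simp only; omega) hq hc hq1 huc)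
    · exact h2 (k2 (by simpa) (by simp only; omega) (by simpa) hq hb hq1 hub)
    · omega
    · exact h1 (k1 (by simp only; omega) (by simpa) (by simpa) hq ha hq1 hua)
    · omega
    · omega
    · exact hn ⟨c1, c2, c3⟩
  have hunit : ∀ {D t : ℤ}, (D = 1 ∨ D = -1) → (t * D = 1 ∨ t * D = -1) → t = 1 ∨ t = -1 := by
    intro D t hD ht
    rcases hD with rfl | rfl <;> omega
  refine IsUnimodularSet.of_subset hbas ⟨ha, hua⟩ ⟨hb, hub⟩ ⟨hc, huc⟩ ?_ ?_
  · intro s hs h1 h2 h3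
    obtain ⟨q, rfl⟩ := hbas.exists_lin_eq s
    obtain ⟨hsum, ox, oy, oz⟩ := hodd q hs h1 h2 h3
    have dx : Pt.det (Pt.lin a b c q) b c = q.x * Pt.det a b c := by
      simp only [Pt.det, Pt.lin, Pt.dot, Pt.cross]; ring
    have dy : Pt.det a (Pt.lin a b c q) c = q.y * Pt.det a b c := by
      simp only [Pt.det, Pt.lin, Pt.dot, Pt.cross]; ring
    have dz : Pt.det a b (Pt.lin a b c q) = q.z * Pt.det a b c := by
      simp only [Pt.det, Pt.lin, Pt.dot, Pt.cross]; ring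
    have ux := hu _ hs.1 b hb c hc hs.2 hub huc (by rw [dx]; exact mul_ne_zero (by omega) hdet)
    have uy := hu a ha _ hs.1 c hc hua hs.2 huc (by rw [dy]; exact mul_ne_zero (by omega) hdet)
    have uz := hu a ha b hb _ hs.1 hua hub hs.2 (by rw [dz]; exact mul_ne_zero (by omega) hdet)
    rw [Pt.IsBasis, dx] at ux; rw [Pt.IsBasis, dy] at uy; rw [Pt.IsBasis, dz] at uz
    have vx := hunit hbas ux
    have vy := hunit hbas uy
    have vz := hunit hbas uz
    have hcase : (q = ⟨1, 1, -1⟩) ∨ (q = ⟨1, -1, 1⟩) ∨ (q = ⟨-1, 1, 1⟩) := by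
      obtain ⟨x, y, z⟩ := q
      simp only [Pt.mk.injEq] at *
      omega
    rcases hcase with rfl | rfl | rfl
    · exact Or.inl (by ext <;> simp [Pt.lin, Pt.fourth, Pt.add, Pt.sub] <;> ring)
    · exact Or.inr (Or.inl (by ext <;> simp [Pt.lin, Pt.fourth, Pt.add, Pt.sub] <;> ring))
    · exact Or.inr (Or.inr (by ext <;> simp [Pt.lin, Pt.fourth, Pt.add, Pt.sub] <;> ring))
  · intro s hs t ht h1 h2 h3 h4 h5 h6
    obtain ⟨q, rfl⟩ := hbas.exists_lin_eq s
    obtain ⟨r, rfl⟩ := hbas.exists_lin_eq t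
    obtain ⟨-, ox, oy, oz⟩ := hodd q hs h1 h2 h3
    obtain ⟨-, px, py, pz⟩ := hodd r ht h4 h5 h6
    exact hlin q r (by omega) (by omega) (by omega) hs.1 ht.1 hs.2 ht.2

theorem IsTerminalPolytope.isUnimodularFacet {P F : Set (Fin 3 → ℝ)} (hP : IsReflexive P)
    (hT : IsTerminalPolytope P) (hF : IsFacet P F) : IsUnimodularFacet F := by
  obtain ⟨S, hfin, rfl, -, hS⟩ := exists_good hP hT
  obtain ⟨y, hy, rfl, _, ⟨a, ha, rfl⟩, _, ⟨b, hb, rfl⟩, _, ⟨c, hc, rfl⟩, hli, hya, hyb, hyc⟩ :=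
    hF.exists_normal (hfin.image _) hP.2.1
  have hext := mem_extremePoints_polar hy ⟨a, ha, rfl⟩ ⟨b, hb, rfl⟩ ⟨c, hc, rfl⟩ hli hya hyb hyc
  rw [← polar_convexHull] at hext
  obtain ⟨u, rfl⟩ := hP.exists_pt_of_extremePoint hext
  have hle : ∀ s ∈ S, u.dot s ≤ 1 := fun s hs => by
    have := hy _ ⟨s, hs, rfl⟩
    rw [dotProd_vec] at this
    exact_mod_cast this
  rw [dotProd_vec] at hya hyb hyc
  have := hS.isUnimodularSet ha hb hc ((linearIndependent_vec_iff a b c).1 hli)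
    (by exact_mod_cast hya) (by exact_mod_cast hyb) (by exact_mod_cast hyc) hle
  have hface := hull_face hfin hle
  rw [Pt.hull] at hface
  rw [hface]
  exact this.isUnimodularFacet

theorem IsUnimodularFacet.mem_extremePoints {F : Set (Fin 3 → ℝ)} (h : IsUnimodularFacet F)
    (hF : F = convexHull ℝ (F.extremePoints ℝ)) {p : Fin 3 → ℝ} (hp : p ∈ F)
    (hl : IsLatticePoint p) : p ∈ F.extremePoints ℝ := by
  rcases h with ⟨x, y, z, he, hli, -, hb⟩ | ⟨v, w, x, y, he, -, ⟨hli, -, hb⟩, hpar⟩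
  · rw [hF, he] at hp
    obtain ⟨i, j, k, hi, hj, hk, hs, h⟩ := mem_convexHull_triple.1 hp
    obtain ⟨c, hc⟩ := hb p hl
    simp only [Fin.sum_univ_three, Matrix.cons_val_zero, Matrix.cons_val_one, Matrix.cons_val]
      at hc
    obtain ⟨rfl, rfl, rfl⟩ := coords_unique hli (h.trans hc)
    have hi' : 0 ≤ c 0 := by exact_mod_cast hi
    have hj' : 0 ≤ c 1 := by exact_mod_cast hj
    have hk' : 0 ≤ c 2 := by exact_mod_cast hk
    have hs' : c 0 + c 1 + c 2 = 1 := by exact_mod_cast hs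
    have hcases : (c 0 = 1 ∧ c 1 = 0 ∧ c 2 = 0) ∨ (c 0 = 0 ∧ c 1 = 1 ∧ c 2 = 0) ∨
        (c 0 = 0 ∧ c 1 = 0 ∧ c 2 = 1) := by omega
    rw [he, hc]
    rcases hcases with ⟨h0, h1, h2⟩ | ⟨h0, h1, h2⟩ | ⟨h0, h1, h2⟩ <;> simp [h0, h1, h2]
  · rw [hF, he] at hp
    obtain ⟨i, j, k, l, hi, hj, hk, hl', hs, h⟩ := exists_coords_of_mem_convexHull_four hp
    obtain ⟨c, hc⟩ := hb p hl
    simp only [Fin.sum_univ_three, Matrix.cons_val_zero, Matrix.cons_val_one, Matrix.cons_val]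
      at hc
    have hy : y = v + x - w := by rw [hpar]; abel
    have h' : (i + l) • v + (k + l) • x + (j - l) • w = p := by
      rw [← h, hy]; ext; simp; ring
    obtain ⟨e0, e1, e2⟩ := coords_unique hli (h'.trans hc)
    have h0 : (0 : ℝ) ≤ (c 0 : ℝ) := by rw [← e0]; linarith
    have h0' : (c 0 : ℝ) ≤ 1 := by rw [← e0]; linarith
    have h1 : (0 : ℝ) ≤ (c 1 : ℝ) := by rw [← e1]; linarith
    have h1' : (c 1 : ℝ) ≤ 1 := by rw [← e1]; linarith
    have hs' : (c 0 : ℝ) + c 1 + c 2 = 1 := by rw [← e0, ← e1, ← e2]; linarith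
    have g0 : 0 ≤ c 0 := by exact_mod_cast h0
    have g0' : c 0 ≤ 1 := by exact_mod_cast h0'
    have g1 : 0 ≤ c 1 := by exact_mod_cast h1
    have g1' : c 1 ≤ 1 := by exact_mod_cast h1'
    have gs : c 0 + c 1 + c 2 = 1 := by exact_mod_cast hs'
    have hcases : (c 0 = 1 ∧ c 1 = 0 ∧ c 2 = 0) ∨ (c 0 = 0 ∧ c 1 = 1 ∧ c 2 = 0) ∨
        (c 0 = 0 ∧ c 1 = 0 ∧ c 2 = 1) ∨ (c 0 = 1 ∧ c 1 = 1 ∧ c 2 = -1) := by omega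
    rw [he, hc]
    rcases hcases with ⟨h0, h1, h2⟩ | ⟨h0, h1, h2⟩ | ⟨h0, h1, h2⟩ | ⟨h0, h1, h2⟩ <;>
      simp [h0, h1, h2]
    · right; right; right; rw [hy]; abel

theorem isTerminalPolytope_of_facets {P : Set (Fin 3 → ℝ)} (hP : IsReflexive P)
    (hF : ∀ F, IsFacet P F → IsUnimodularFacet F) : IsTerminalPolytope P := by
  have h0P : (0 : Fin 3 → ℝ) ∈ P := interior_subset hP.2.1
  refine Set.Subset.antisymm ?_ ?_
  · rintro x ⟨hx, hl⟩
    by_cases hx0 : x = 0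
    · exact Or.inl hx0
    right
    obtain ⟨y, hy, hpos⟩ := exists_extremePoint_polar_pos hP.isCompact hP.2.1 hx0
    have hxy : dotProd y x = 1 := by
      have hle := hy.1 x hx
      obtain ⟨u, rfl⟩ := hP.exists_pt_of_extremePoint hy
      obtain ⟨p, rfl⟩ := hl.exists_pt
      rw [dotProd_vec] at hle hpos ⊢
      have h1 : u.dot p ≤ 1 := by exact_mod_cast hle
      have h2 : 0 < u.dot p := by exact_mod_cast hpos
      have : u.dot p = 1 := by omega
      simp [this]
    have hV := hP.finite_extremePoints
    have hPV := eq_convexHull_extremePoints hP.isCompact hP.convex hV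
    have hyV : y ∈ (polar (P.extremePoints ℝ)).extremePoints ℝ := by
      rw [← polar_convexHull, ← hPV]; exact hy
    obtain ⟨a, ha, b, hb, c, hc, hli, hya, hyb, hyc⟩ := exists_triple_of_extremePoint hV hyV
    have hfac := isFacet_of_triple hy.1 ha.1 hb.1 hc.1 hli hya hyb hyc
    have hsub := (isExtreme_face (P := P) hy.1).extremePoints_subset_extremePoints
    refine hsub ((hF _ hfac).mem_extremePoints ?_ ⟨hx, hxy⟩ hl)
    exact eq_convexHull_extremePoints (isCompact_face hP.isCompact _ _) (convex_face hP.convex _ _)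
      (hV.subset hsub)
  · rintro x (rfl | hx)
    · exact ⟨h0P, fun i => ⟨0, by simp⟩⟩
    · exact ⟨hx.1, hP.isLatticePoint_of_extremePoint hx⟩

theorem LatticeEquivTo.symm {P Q : Set (Fin 3 → ℝ)} (h : LatticeEquivTo P Q) :
    LatticeEquivTo Q P := by
  obtain ⟨f, hf, rfl⟩ := h
  refine ⟨f.symm, fun x => ?_, ?_⟩
  · rw [hf (f.symm x), f.apply_symm_apply]
  · rw [Set.image_image]; simp

theorem LatticeEquivTo.trans {P Q R : Set (Fin 3 → ℝ)} (h : LatticeEquivTo P Q)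
    (h' : LatticeEquivTo Q R) : LatticeEquivTo P R := by
  obtain ⟨f, hf, rfl⟩ := h
  obtain ⟨g, hg, rfl⟩ := h'
  exact ⟨f.trans g, fun x => (hf x).trans (hg (f x)), by rw [Set.image_image]; rfl⟩

/-- The real extension of `Pt.lin`. -/
def Pt.realLin (a b c : Pt) : (Fin 3 → ℝ) →ₗ[ℝ] (Fin 3 → ℝ) where
  toFun x := x 0 • a.vec + x 1 • b.vec + x 2 • c.vec
  map_add' x y := by ext; simp; ring
  map_smul' t x := by ext; simp; ring

theorem Pt.realLin_vec (a b c p : Pt) : Pt.realLin a b c p.vec = (Pt.lin a b c p).vec := by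
  rw [Pt.vec_lin]; rfl

theorem Pt.image_hull (a b c : Pt) (S : Set Pt) :
    Pt.realLin a b c '' Pt.hull S = Pt.hull (Pt.lin a b c '' S) := by
  rw [Pt.hull, LinearMap.image_convexHull, Pt.hull, Set.image_image, Set.image_image]
  simp_rw [Pt.realLin_vec]

theorem Pt.IsBasis.latticeEquivTo_hull {a b c : Pt} (h : Pt.IsBasis a b c) (S : Set Pt) :
    LatticeEquivTo (Pt.hull S) (Pt.hull (Pt.lin a b c '' S)) := by
  have hinj : Function.Injective (Pt.realLin a b c) := fun x y hxy => by
    obtain ⟨h0, h1, h2⟩ := coords_unique h.linearIndependent hxy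
    ext i; fin_cases i <;> assumption
  have hsurj : Function.Surjective (Pt.realLin a b c) := fun x => by
    obtain ⟨α, β, γ, rfl⟩ := exists_coords h.linearIndependent x
    exact ⟨![α, β, γ], rfl⟩
  have hbij : Function.Bijective (Pt.realLin a b c) := ⟨hinj, hsurj⟩
  refine ⟨LinearEquiv.ofBijective _ hbij, fun x => ?_, Pt.image_hull a b c S⟩
  change IsLatticePoint x ↔ IsLatticePoint (Pt.realLin a b c x)
  constructor
  · intro hx
    obtain ⟨p, rfl⟩ := hx.exists_pt
    rw [Pt.realLin_vec]
    exact Pt.isLatticePoint_vec _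
  · intro hx
    obtain ⟨p, hp⟩ := hx.exists_pt
    obtain ⟨q, rfl⟩ := h.exists_lin_eq p
    rw [← Pt.realLin_vec] at hp
    rw [← hinj hp]
    exact q.isLatticePoint_vec

namespace Pt

def e₁ : Pt := ⟨1, 0, 0⟩
def e₂ : Pt := ⟨0, 1, 0⟩
def e₃ : Pt := ⟨0, 0, 1⟩

/-- The sum of the coordinates. -/
def height (p : Pt) : ℤ := p.x + p.y + p.z

/-- The sum of a list of lattice points. -/
def total (l : List Pt) : Pt := ⟨(l.map x).sum, (l.map y).sum, (l.map z).sum⟩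

theorem total_perm {l l' : List Pt} (h : l.Perm l') : total l = total l' := by
  simp only [total, (h.map x).sum_eq, (h.map y).sum_eq, (h.map z).sum_eq]

theorem total_append (l l' : List Pt) : total (l ++ l') = (total l).add (total l') := by
  simp [total, add]

theorem dot_total (u : Pt) (l : List Pt) : u.dot (total l) = (l.map u.dot).sum := by
  induction l with
  | nil => simp [total, dot]
  | cons p l ih =>
    rw [List.map_cons, List.sum_cons, ← ih]
    simp only [total, dot, List.map_cons, List.sum_cons]; ring

theorem lin_total (a b c : Pt) (l : List Pt) :
    lin a b c (total l) = total (l.map (lin a b c)) := by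
  induction l with
  | nil => simp [total, lin]
  | cons p l ih =>
    simp only [lin, total, Pt.mk.injEq, List.map_cons, List.sum_cons] at ih ⊢
    obtain ⟨h1, h2, h3⟩ := ih
    exact ⟨by linear_combination h1, by linear_combination h2, by linear_combination h3⟩

theorem dot_one (q : Pt) : (⟨1, 1, 1⟩ : Pt).dot q = q.height := by
  simp [height, dot]

theorem dot_sub' (u v p : Pt) : (u.sub v).dot p = u.dot p - v.dot p := by
  simp only [sub, dot]; ring

end Pt

/-- If `u` defines a facet containing the edge `a, b`, and `ℓ` vanishes on that edge and computes
the volume over it, then the neighbouring facet bounds `ℓ` from below. -/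
theorem Good.neighbor {S : Set Pt} (hS : Good S) (hfin : S.Finite) {u ℓ a b : Pt} (ha : a ∈ S)
    (hb : b ∈ S) (hua : u.dot a = 1) (hub : u.dot b = 1) (hla : ℓ.dot a = 0) (hlb : ℓ.dot b = 0)
    (hdet : ∀ s, Pt.det a b s = ℓ.dot s ∨ Pt.det a b s = -ℓ.dot s)
    (hle : ∀ s ∈ S, u.dot s ≤ 1) (hneg : ∀ s ∈ S, ℓ.dot s < 0 → u.dot s ≤ 0) :
    ∀ s ∈ S, u.dot s - 1 ≤ ℓ.dot s := by
  by_cases hex : ∃ s ∈ S, ℓ.dot s < 0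
  swap
  · push Not at hex
    intro s hs
    linarith [hex s hs, hle s hs]
  obtain ⟨t₀, ht₀, hlt₀⟩ := hex
  have hne : (hfin.subset (Set.sep_subset S fun s => ℓ.dot s < 0)).toFinset.Nonempty :=
    ⟨t₀, by simp [ht₀, hlt₀]⟩
  obtain ⟨t, ht, hmin⟩ := Finset.exists_min_image _
    (fun s => ((1 - u.dot s : ℤ) : ℚ) / ((-ℓ.dot s : ℤ) : ℚ)) hne
  simp only [Set.Finite.mem_toFinset, Set.mem_ofPred_eq] at ht hmin
  have hmin' : ∀ s ∈ S, ℓ.dot s < 0 →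
      (1 - u.dot t) * (-ℓ.dot s) ≤ (1 - u.dot s) * (-ℓ.dot t) := by
    intro s hs hls
    have h := hmin s ⟨hs, hls⟩
    have p1 : (0 : ℚ) < ((-ℓ.dot t : ℤ) : ℚ) := by exact_mod_cast neg_pos.2 ht.2
    have p2 : (0 : ℚ) < ((-ℓ.dot s : ℤ) : ℚ) := by exact_mod_cast neg_pos.2 hls
    rw [div_le_div_iff₀ p1 p2] at h
    exact_mod_cast h
  set d := -ℓ.dot t with hd
  have hdpos : 0 < d := by omega
  have hut := hneg t ht.1 ht.2
  set y : Pt := Pt.lin u ℓ Pt.zero ⟨d, -(1 - u.dot t), 0⟩ with hy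
  have hydot : ∀ s, y.dot s = d * u.dot s - (1 - u.dot t) * ℓ.dot s := by
    intro s; rw [hy]; simp only [Pt.dot, Pt.lin, Pt.zero]; ring
  have hdt : Pt.IsBasis a b t := by
    refine hS.unimod a ha b hb t ht.1 y d hdpos ?_ ?_ ?_ ?_ ?_
    · rw [hydot, hua, hla]; ring
    · rw [hydot, hub, hlb]; ring
    · rw [hydot]; rw [hd]; ring
    · intro s hs
      rw [hydot]
      rcases lt_or_ge (ℓ.dot s) 0 with h | h
      · nlinarith [hmin' s hs h]
      · nlinarith [hle s hs, mul_nonneg (show 0 ≤ 1 - u.dot t by omega) h]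
    · rcases hdet t with h | h <;> rw [h] <;> omega
  have hd1 : d = 1 := by
    rcases hdt with h | h <;> rcases hdet t with h' | h' <;> omega
  intro s hs
  rcases lt_or_ge (ℓ.dot s) 0 with h | h
  · have := hmin' s hs h
    rw [hd1] at this
    nlinarith
  · linarith [hle s hs]

/-- The change of coordinates turning a lattice basis into the standard basis. -/
theorem Good.preimage {S : Set Pt} (hS : Good S) {a b c : Pt} (h : Pt.IsBasis a b c) :
    Good (Pt.lin a b c ⁻¹' S) := by
  have hdual : ∀ y : Pt, ∃ m : Pt, ∀ q, m.dot (Pt.lin a b c q) = y.dot q := by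
    intro y
    obtain ⟨m, h1, h2, h3⟩ := h.exists_dot_eq y.x y.y y.z
    exact ⟨m, fun q => by rw [Pt.dot_lin, h1, h2, h3, Pt.dot]; ring⟩
  refine ⟨?_, ?_, ?_, ?_⟩
  · rintro v hv ⟨⟨i, hi⟩, ⟨j, hj⟩, ⟨k, hk⟩⟩
    refine hS.odd _ hv ⟨⟨i * a.x + j * b.x + k * c.x, ?_⟩, ⟨i * a.y + j * b.y + k * c.y, ?_⟩,
      ⟨i * a.z + j * b.z + k * c.z, ?_⟩⟩ <;> simp only [Pt.lin, hi, hj, hk] <;> ring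
  · rintro v hv w hw hne ⟨i, hi⟩ ⟨j, hj⟩ ⟨k, hk⟩
    have := hS.cong _ hv _ hw (fun he => hne ((Pt.lin_eq_iff a b c h.ne_zero v w).1 he))
      ⟨i * a.x + j * b.x + k * c.x, by
        simp only [Pt.lin]; linear_combination a.x * hi + b.x * hj + c.x * hk⟩
      ⟨i * a.y + j * b.y + k * c.y, by
        simp only [Pt.lin]; linear_combination a.y * hi + b.y * hj + c.y * hk⟩
      ⟨i * a.z + j * b.z + k * c.z, by
        simp only [Pt.lin]; linear_combination a.z * hi + b.z * hj + c.z * hk⟩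
    refine (Pt.lin_eq_iff a b c h.ne_zero _ _).1 ?_
    have h0 : Pt.lin a b c Pt.zero = Pt.zero := by simp [Pt.lin, Pt.zero]
    rw [h0, ← this]
    simp only [Pt.lin, Pt.add, Pt.mk.injEq]
    refine ⟨?_, ?_, ?_⟩ <;> ring
  · intro n hn
    obtain ⟨m, hm⟩ := hdual n
    obtain ⟨s, hs, hpos⟩ := hS.pos m (by
      rintro rfl
      refine hn ?_
      have h1 := hm Pt.e₁
      have h2 := hm Pt.e₂
      have h3 := hm Pt.e₃
      simp [Pt.dot, Pt.zero, Pt.e₁, Pt.e₂, Pt.e₃] at h1 h2 h3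
      ext <;> simp [Pt.zero, ← h1, ← h2, ← h3])
    obtain ⟨q, rfl⟩ := h.exists_lin_eq s
    exact ⟨q, hs, by rwa [← hm]⟩
  · intro p hp q hq r hr y d hd h1 h2 h3 hle hdet
    obtain ⟨m, hm⟩ := hdual y
    have := hS.unimod _ hp _ hq _ hr m d hd (by rw [hm, h1]) (by rw [hm, h2]) (by rw [hm, h3])
      (fun s hs => by
        obtain ⟨t, rfl⟩ := h.exists_lin_eq s
        rw [hm]; exact hle t hs)
      (by rw [Pt.det_lin]; exact mul_ne_zero h.ne_zero hdet)
    rw [Pt.IsBasis, Pt.det_lin] at this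
    rcases h with h | h <;> rw [h] at this <;> unfold Pt.IsBasis <;> omega

/-- Vertex sets in a coordinate system adapted to a facet (with vertices `F`) chosen as far as
possible in the direction of the vertex sum. -/
structure Normalized (S : Set Pt) (F : List Pt) (l : List Pt) : Prop where
  good : Good S
  nodup : l.Nodup
  mem_iff : ∀ p, p ∈ l ↔ p ∈ S
  height_le : ∀ s ∈ S, s.height ≤ 1
  mem_facet_iff : ∀ s, s ∈ F ↔ s ∈ S ∧ s.height = 1
  special : ∀ y : Pt, (∀ s ∈ S, y.dot s ≤ 1) → y.dot (Pt.total l) ≤ (Pt.total l).height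

/-- Passing to the coordinates with respect to a lattice basis in the facet with normal `u`. -/
theorem Good.exists_normalized {S : Set Pt} (hS : Good S) {L F : List Pt} {u a b c : Pt}
    (hnd : L.Nodup) (hL : ∀ p, p ∈ L ↔ p ∈ S) (hbas : Pt.IsBasis a b c)
    (hua : u.dot a = 1) (hub : u.dot b = 1) (huc : u.dot c = 1) (hle : ∀ s ∈ S, u.dot s ≤ 1)
    (hmax : ∀ y : Pt, (∀ s ∈ S, y.dot s ≤ 1) → y.dot (Pt.total L) ≤ u.dot (Pt.total L))
    (hF : ∀ q, q ∈ F ↔ Pt.lin a b c q ∈ tight S u) :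
    ∃ l, Normalized (Pt.lin a b c ⁻¹' S) F l ∧ Pt.lin a b c (Pt.total l) = Pt.total L ∧
      LatticeEquivTo (Pt.hull S) (Pt.hull (Pt.lin a b c ⁻¹' S)) := by
  have hht : ∀ q, u.dot (Pt.lin a b c q) = q.height := fun q => by
    rw [Pt.dot_lin, hua, hub, huc, Pt.height]; ring
  choose g hg using fun p => hbas.exists_lin_eq p
  have hg' : ∀ q, g (Pt.lin a b c q) = q := fun q =>
    (Pt.lin_eq_iff a b c hbas.ne_zero _ _).1 (hg _)
  have hginj : Function.Injective g := fun p q h => by rw [← hg p, h, hg]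
  have htot : Pt.lin a b c (Pt.total (L.map g)) = Pt.total L := by
    rw [Pt.lin_total, List.map_map, show Pt.lin a b c ∘ g = id from funext hg, List.map_id]
  refine ⟨L.map g, ⟨hS.preimage hbas, hnd.map hginj, fun q => ?_, fun q hq => ?_,
    fun q => ?_, fun y hy => ?_⟩, htot, ?_⟩
  · rw [List.mem_map]
    constructor
    · rintro ⟨p, hp, rfl⟩
      rw [Set.mem_preimage, hg]; exact (hL p).1 hp
    · intro hq; exact ⟨_, (hL _).2 hq, hg' q⟩
  · rw [← hht]; exact hle _ hq
  · rw [hF, ← hht]; rfl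
  · obtain ⟨m, h1, h2, h3⟩ := hbas.exists_dot_eq y.x y.y y.z
    have hm : ∀ q, m.dot (Pt.lin a b c q) = y.dot q := fun q => by
      rw [Pt.dot_lin, h1, h2, h3, Pt.dot]; ring
    rw [← hht, ← hm, htot]
    refine hmax m fun s hs => ?_
    obtain ⟨q, rfl⟩ := hbas.exists_lin_eq s
    rw [hm]; exact hy q hs
  · have := (hbas.latticeEquivTo_hull (Pt.lin a b c ⁻¹' S)).symm
    rwa [Set.image_preimage_eq S fun p => ⟨g p, hg p⟩] at this

/-- A symmetry of the facet yields another normalization. -/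
theorem Normalized.changeBasis {S : Set Pt} {F l : List Pt} (h : Normalized S F l) {a b c : Pt}
    (hbas : Pt.IsBasis a b c) (ha : a.height = 1) (hb : b.height = 1) (hc : c.height = 1)
    (hF : (F.map (Pt.lin a b c)).Perm F) :
    ∃ S' l', LatticeEquivTo (Pt.hull S) (Pt.hull S') ∧ Normalized S' F l' ∧
      Pt.lin a b c (Pt.total l') = Pt.total l := by
  obtain ⟨l', h1, h2, h3⟩ := h.good.exists_normalized (F := F) (u := ⟨1, 1, 1⟩) h.nodup h.mem_iff
    hbas (by rw [Pt.dot_one, ha]) (by rw [Pt.dot_one, hb]) (by rw [Pt.dot_one, hc])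
    (by simpa only [Pt.dot_one] using h.height_le) (by simpa only [Pt.dot_one] using h.special)
    fun q => by
      rw [tight, Set.mem_ofPred_eq, Pt.dot_one, ← h.mem_facet_iff, ← hF.mem_iff (a := Pt.lin a b c q),
        List.mem_map]
      exact ⟨fun hq => ⟨q, hq, rfl⟩, fun ⟨q', hq', he⟩ =>
        (Pt.lin_eq_iff a b c hbas.ne_zero _ _).1 he ▸ hq'⟩
  exact ⟨_, l', h3, h1, h2⟩

theorem exists_normalized {P : Set (Fin 3 → ℝ)} (hP : IsReflexive P) (hT : IsTerminalPolytope P) :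
    ∃ (S : Set Pt) (l : List Pt), LatticeEquivTo P (Pt.hull S) ∧
      (Normalized S [Pt.e₁, Pt.e₂, Pt.e₃] l ∨ Normalized S [Pt.e₁, Pt.e₂, Pt.e₃, ⟨1, 1, -1⟩] l) := by
  obtain ⟨S, hfin, hhull, himg, hS⟩ := exists_good hP hT
  set L := hfin.toFinset.toList with hL
  have hLmem : ∀ p, p ∈ L ↔ p ∈ S := by simp [hL]
  obtain ⟨_, hu, hmax⟩ := exists_extremePoint_max (isCompact_polar hP.2.1) ⟨0, zero_mem_polar P⟩
    (Pt.total L).vec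
  obtain ⟨u, rfl⟩ := hP.exists_pt_of_extremePoint hu
  have hmax' : ∀ y : Pt, (∀ s ∈ S, y.dot s ≤ 1) → y.dot (Pt.total L) ≤ u.dot (Pt.total L) := by
    intro y hy
    have := hmax y.vec (by
      rw [hhull, Pt.hull, polar_convexHull]
      rintro _ ⟨s, hs, rfl⟩
      rw [dotProd_vec]; exact_mod_cast hy s hs)
    rw [dotProd_vec, dotProd_vec] at this
    exact_mod_cast this
  rw [hhull, Pt.hull, polar_convexHull] at hu
  have hle : ∀ s ∈ S, u.dot s ≤ 1 := fun s hs => by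
    have := hu.1 _ ⟨s, hs, rfl⟩
    rw [dotProd_vec] at this
    exact_mod_cast this
  obtain ⟨_, ⟨a, ha, rfl⟩, _, ⟨b, hb, rfl⟩, _, ⟨c, hc, rfl⟩, hli, hua, hub, huc⟩ :=
    exists_triple_of_extremePoint (hfin.image _) hu
  rw [dotProd_vec] at hua hub huc
  obtain ⟨a, b, c, hbas, htight⟩ := hS.isUnimodularSet ha hb hc
    ((linearIndependent_vec_iff a b c).1 hli) (by exact_mod_cast hua) (by exact_mod_cast hub)
    (by exact_mod_cast huc) hle
  have hmem : a ∈ tight S u ∧ b ∈ tight S u ∧ c ∈ tight S u := by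
    rcases htight with h | h <;> rw [h] <;> simp
  obtain ⟨⟨ha, hua⟩, ⟨hb, hub⟩, ⟨hc, huc⟩⟩ := hmem
  have ea : Pt.lin a b c Pt.e₁ = a := by ext <;> simp [Pt.lin, Pt.e₁]
  have eb : Pt.lin a b c Pt.e₂ = b := by ext <;> simp [Pt.lin, Pt.e₂]
  have ec : Pt.lin a b c Pt.e₃ = c := by ext <;> simp [Pt.lin, Pt.e₃]
  have ed : Pt.lin a b c ⟨1, 1, -1⟩ = Pt.fourth a b c := by
    ext <;> simp [Pt.lin, Pt.fourth, Pt.add, Pt.sub] <;> ring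
  have himage : ∀ {p e : Pt}, Pt.lin a b c e = p → ∀ q, Pt.lin a b c q = p ↔ q = e := by
    rintro _ e rfl q
    exact Pt.lin_eq_iff a b c hbas.ne_zero q e
  have hnorm : ∀ F : List Pt, (∀ q, q ∈ F ↔ Pt.lin a b c q ∈ tight S u) →
      ∃ l, Normalized (Pt.lin a b c ⁻¹' S) F l ∧
        LatticeEquivTo P (Pt.hull (Pt.lin a b c ⁻¹' S)) := fun F hF => by
    obtain ⟨l, h1, -, h3⟩ := hS.exists_normalized (Finset.nodup_toList _) hLmem hbas hua hub huc
      hle hmax' hF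
    exact ⟨l, h1, hhull ▸ h3⟩
  rcases htight with h | h
  · obtain ⟨l, h1, h2⟩ := hnorm [Pt.e₁, Pt.e₂, Pt.e₃] fun q => by
      simp only [h, Set.mem_insert_iff, Set.mem_singleton_iff, List.mem_cons, List.not_mem_nil,
        or_false, himage ea, himage eb, himage ec]
    exact ⟨_, l, h2, Or.inl h1⟩
  · obtain ⟨l, h1, h2⟩ := hnorm [Pt.e₁, Pt.e₂, Pt.e₃, ⟨1, 1, -1⟩] fun q => by
      simp only [h, Set.mem_insert_iff, Set.mem_singleton_iff, List.mem_cons, List.not_mem_nil,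
        or_false, himage ea, himage eb, himage ec, himage ed]
    exact ⟨_, l, h2, Or.inr h1⟩

instance : DecidableEq Pt := fun _ _ => decidable_of_iff' _ Pt.ext_iff

namespace Pt

def neg (p : Pt) : Pt := ⟨-p.x, -p.y, -p.z⟩

theorem eq_neg_of_add_eq_zero {p q : Pt} (h : p.add q = zero) : q = p.neg := by
  simp only [add, zero, neg, Pt.mk.injEq] at h ⊢
  ext <;> simp <;> omega

/-- Congruence of lattice points modulo two. -/
def Cong (p q : Pt) : Prop := 2 ∣ p.x - q.x ∧ 2 ∣ p.y - q.y ∧ 2 ∣ p.z - q.z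

instance (p q : Pt) : Decidable (Cong p q) := inferInstanceAs (Decidable (_ ∧ _ ∧ _))

/-- `List.foldr`, defined by the recursor in order to be evaluated fast by the kernel. -/
def fold {α β : Type} (f : α → β → β) (b : β) (l : List α) : β :=
  List.rec b (fun a _ r => f a r) l

theorem fold_cons {α β : Type} (f : α → β → β) (b : β) (a : α) (l : List α) :
    fold f b (a :: l) = f a (fold f b l) := rfl

theorem fold_eq_foldr {α β : Type} (f : α → β → β) (b : β) (l : List α) :
    fold f b l = l.foldr f b := by
  induction l with
  | nil => rfl
  | cons a l ih => rw [fold_cons, ih, List.foldr_cons]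

/-- The sum of the values of `f` on a list. -/
def weight {α : Type} (f : α → ℕ) (l : List α) : ℕ := fold (fun p n => Nat.add (f p) n) 0 l

theorem weight_eq {α : Type} (f : α → ℕ) (l : List α) : weight f l = (l.map f).sum := by
  rw [weight, fold_eq_foldr, List.sum, List.foldr_map]; rfl

theorem weight_weight {α : Type} (f : α → ℕ) (l : List (List α)) :
    weight (weight f) l = weight f l.flatten := by
  simp only [weight_eq, List.map_flatten, List.sum_flatten, List.map_map]
  congr 2; ext; simp [weight_eq]

def depth (p : Pt) : ℕ := (-p.height).toNat

def loss (p : Pt) : ℕ := Nat.succ (depth p)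

/-- On the points under consideration, `ℓ` is `gain ℓ - loss`. -/
def gain (ℓ p : Pt) : ℕ := (ℓ.dot p - p.height + 1).toNat

theorem height_total (l : List Pt) : (total l).height = (l.map height).sum := by
  rw [← dot_one, dot_total, funext dot_one]

theorem weight_depth {l : List Pt} (h : ∀ p ∈ l, p.height ≤ 0) :
    (weight depth l : ℤ) = -(total l).height := by
  rw [height_total, weight_eq]
  induction l with
  | nil => rfl
  | cons p l ih =>
    have h1 := h p (by simp)
    have h2 := ih fun q hq => h q (by simp [hq])
    simp only [List.map_cons, List.sum_cons, depth]
    rw [Nat.cast_add]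
    omega

theorem weight_gain {l : List Pt} {ℓ : Pt} (h : ∀ p ∈ l, p.height ≤ 0)
    (h' : ∀ p ∈ l, p.height - 1 ≤ ℓ.dot p) :
    (weight (gain ℓ) l : ℤ) = ℓ.dot (total l) + weight loss l := by
  rw [dot_total, weight_eq, weight_eq]
  induction l with
  | nil => rfl
  | cons p l ih =>
    have h1 := h p (by simp)
    have h2 := h' p (by simp)
    have h3 := ih (fun q hq => h q (by simp [hq])) fun q hq => h' q (by simp [hq])
    simp only [List.map_cons, List.sum_cons, depth, gain, loss]
    rw [Nat.cast_add, Nat.cast_add]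
    omega

theorem le_weight {l : List Pt} (f : Pt → ℕ) {p : Pt} (h : p ∈ l) : f p ≤ weight f l := by
  rw [weight_eq]
  exact List.single_le_sum (by simp) _ (List.mem_map_of_mem h)

/-- The ways to choose points from a congruence class: none, one, or two opposite ones. -/
def options : List Pt → List (List Pt)
  | [] => [[]]
  | v :: K => [v] :: if v.neg ∈ K then [v, v.neg] :: options K else options K

theorem exists_option (S : Pt → Bool) (K : List Pt) (hK : K.Nodup)
    (h : ∀ p ∈ K, ∀ q ∈ K, S p → S q → p ≠ q → p.add q = zero) :
    ∃ o ∈ options K, o.Perm (K.filter S) := by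
  induction K with
  | nil => exact ⟨[], by simp [options], by simp⟩
  | cons v K ih =>
    rw [List.nodup_cons] at hK
    by_cases hv : S v
    · have hneg : ∀ q ∈ K.filter S, q = v.neg := fun q hq => by
        rw [List.mem_filter] at hq
        exact eq_neg_of_add_eq_zero (h v (by simp) q (by simp [hq.1]) hv hq.2
          fun e => hK.1 (e ▸ hq.1))
      by_cases hm : v.neg ∈ K.filter S
      · refine ⟨[v, v.neg], ?_, ?_⟩
        · simp [options, (List.mem_filter.1 hm).1]
        · rw [List.filter_cons_of_pos hv]
          refine List.Perm.cons _ ((List.perm_ext_iff_of_nodup (by simp) (hK.2.filter _)).2 ?_)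
          exact fun q => ⟨fun hq => by rwa [List.mem_singleton.1 hq],
            fun hq => by rw [hneg q hq]; simp⟩
      · refine ⟨[v], by simp [options], ?_⟩
        have : K.filter S = [] := List.eq_nil_iff_forall_not_mem.2 fun q hq =>
          hm (hneg q hq ▸ hq)
        rw [List.filter_cons_of_pos hv, this]
    · obtain ⟨o, ho, hp⟩ := ih hK.2 fun p hp q hq => h p (by simp [hp]) q (by simp [hq])
      refine ⟨o, ?_, by rwa [List.filter_cons_of_neg hv]⟩
      rw [options]
      split_ifs <;> simp [ho]

/-- Whether `n ≤ f ℓ₁ ≤ f ℓ₂ ≤ …`, where the `ℓᵢ` are the entries of `ls`. -/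
def chain (f : Pt → ℕ) (ls : List Pt) : ℕ → Bool :=
  fold (fun ℓ r n => cond (Nat.ble n (f ℓ)) (r (f ℓ)) false) (fun _ => true) ls

theorem chain_of_isChain {f : Pt → ℕ} {φ : Pt → ℤ} {d : ℤ} {ls : List Pt} :
    ∀ {n : ℕ} {m : ℤ}, (m :: ls.map φ).IsChain (· ≤ ·) → (n : ℤ) ≤ m + d →
      (∀ ℓ ∈ ls, (f ℓ : ℤ) = φ ℓ + d) → chain f ls n = true := by
  induction ls with
  | nil => intros; rfl
  | cons ℓ ls ih =>
    intro n m h hn hf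
    rw [List.map_cons, List.isChain_cons_cons] at h
    have hℓ := hf ℓ (by simp)
    change cond (Nat.ble n (f ℓ)) (chain f ls (f ℓ)) false = true
    rw [Nat.ble_eq_true_of_le (by omega), ih h.2 hℓ.le fun x hx => hf x (by simp [hx])]
    rfl

/-- Whether the values of the functionals `ls` on the vertex sum are nonnegative and increasing,
if they all take the value `c` on the sum of the vertices not in `T`. -/
def inCone (ls : List Pt) (c : ℕ) (T : List (List Pt)) : Bool :=
  chain (fun ℓ => Nat.add c (weight (weight (gain ℓ)) T)) ls (weight (weight loss) T)

/-- Depth-first enumeration of the unions of `F` with one option per class, with total depth at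
most `b`, such that the functionals `ls` are nonnegative and increasing on the vertex sum. The
list `T` holds the options chosen so far, and `acc` collects the results. -/
def search (ls F : List Pt) (c : ℕ) (gs : List (List (List Pt))) :
    List (List Pt) → ℕ → List (List Pt) → List (List Pt) :=
  List.rec (fun T _ acc => cond (inCone ls c T) ((T.flatten ++ F) :: acc) acc)
    (fun g _ ih T b acc => fold (fun o acc => cond (Nat.ble (weight depth o) b)
      (ih (o :: T) (Nat.sub b (weight depth o)) acc) acc) acc g) gs

theorem search_cons (ls F : List Pt) (c : ℕ) (g : List (List Pt)) (gs : List (List (List Pt)))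
    (T : List (List Pt)) (b : ℕ) (acc : List (List Pt)) :
    search ls F c (g :: gs) T b acc = fold (fun o acc => cond (Nat.ble (weight depth o) b)
      (search ls F c gs (o :: T) (b - weight depth o) acc) acc) acc g := rfl

theorem subset_search (ls F : List Pt) (c : ℕ) (gs : List (List (List Pt))) :
    ∀ T b acc, acc ⊆ search ls F c gs T b acc := by
  induction gs with
  | nil =>
    intro T b acc
    change acc ⊆ cond _ _ _
    cases inCone ls c T <;> simp
  | cons g gs ih =>
    intro T b acc
    rw [search_cons]
    induction g with
    | nil => exact List.Subset.refl _
    | cons o g ihg =>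
      rw [fold_cons]
      cases Nat.ble (weight depth o) b
      · exact ihg
      · exact List.Subset.trans ihg (ih _ _ _)

theorem exists_mem_search (ls F : List Pt) (c : ℕ) {os : List (List Pt)} {gs : List (List (List Pt))}
    (h : List.Forall₂ (· ∈ ·) os gs) : ∀ T b acc, weight depth os.flatten ≤ b →
      inCone ls c (os.reverse ++ T) →
      ∃ T' ∈ search ls F c gs T b acc, T'.Perm (os.flatten ++ (T.flatten ++ F)) := by
  induction h with
  | nil =>
    intro T b acc _ hl
    refine ⟨T.flatten ++ F, ?_, by simp⟩
    change _ ∈ cond (inCone ls c T) _ _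
    rw [show inCone ls c T = true from hl]
    simp
  | @cons o g os gs ho _ ih =>
    intro T b acc hb hl
    have hb' : weight depth o + weight depth os.flatten ≤ b := by
      simpa [weight_eq] using hb
    have hle : Nat.ble (weight depth o) b = true := Nat.ble_eq_true_of_le (by omega)
    rw [List.reverse_cons, List.append_assoc] at hl
    rw [search_cons]
    induction g with
    | nil => simp at ho
    | cons o' g ihg =>
      rw [fold_cons]
      rcases List.mem_cons.1 ho with rfl | ho
      · rw [hle]
        obtain ⟨T', hT', hp⟩ := ih (o :: T) (b - weight depth o) _ (by omega) hl
        refine ⟨T', hT', hp.trans ?_⟩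
        simp only [List.flatten_cons, ← List.append_assoc]
        exact (List.perm_append_comm.append_right _).append_right _
      · obtain ⟨T', hT', hp⟩ := ihg ho
        refine ⟨T', ?_, hp⟩
        cases Nat.ble (weight depth o') b
        · exact hT'
        · exact subset_search _ _ _ _ _ _ _ hT'

end Pt

/-- The data of an enumeration: the points of `Ks`, sorted by congruence class, contain all those
of `cands` that are compatible with the facet `F`. -/
structure Separates (F cands : List Pt) (Ks : List (List Pt)) : Prop where
  exhaust : ∀ p ∈ cands, Pt.Cong p Pt.zero ∨ (∃ f ∈ F, Pt.Cong p f ∧ p.add f ≠ Pt.zero) ∨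
    p ∈ Ks.flatten
  cong : ∀ K ∈ Ks, ∀ p ∈ K, ∀ q ∈ K, Pt.Cong p q
  nodup : (F ++ Ks.flatten).Nodup

theorem Normalized.exists_mem_search {S : Set Pt} {F l cands ls : List Pt} {Ks : List (List Pt)}
    (h : Normalized S F l) (hK : Separates F cands Ks)
    (hls : ∀ ℓ ∈ ls, ∀ s ∈ S, s.height - 1 ≤ ℓ.dot s)
    (hF : (Pt.total F).height = F.length) {c : ℕ} (hc : ∀ ℓ ∈ ls, ℓ.dot (Pt.total F) = c)
    (hsort : (ls.map fun ℓ => ℓ.dot (Pt.total l)).IsChain (· ≤ ·))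
    (hcands : ∀ p, p.height ≤ 0 → -(F.length : ℤ) ≤ p.height →
      (∀ ℓ ∈ ls, p.height - 1 ≤ ℓ.dot p) → p ∈ cands) :
    ∃ T ∈ Pt.search ls F c (Ks.map Pt.options) [] F.length [], T.Perm l := by
  classical
  set σ : Pt → Bool := fun p => decide (p ∈ S) with hσ
  have hnd := List.nodup_append.1 hK.nodup
  have hFS : ∀ f ∈ F, f ∈ S := fun f hf => ((h.mem_facet_iff f).1 hf).1
  have hlow : ∀ s ∈ S, s ∉ F → s.height ≤ 0 := fun s hs hsF => by
    have h1 := h.height_le s hs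
    have h2 : s.height ≠ 1 := fun e => hsF ((h.mem_facet_iff s).2 ⟨hs, e⟩)
    omega
  have hperm : l.Perm (F ++ l.filter fun p => p ∉ F) := by
    refine (List.perm_ext_iff_of_nodup h.nodup (List.nodup_append.2
      ⟨hnd.1, h.nodup.filter _, ?_⟩)).2 fun p => ?_
    · rintro a ha b hb rfl
      simp [ha] at hb
    · rw [List.mem_append, List.mem_filter, h.mem_iff]
      have := hFS p
      by_cases hp : p ∈ F <;> simp_all
  set R := l.filter fun p => p ∉ F with hR
  have hRmem : ∀ p, p ∈ R ↔ p ∈ S ∧ p ∉ F := fun p => by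
    rw [hR, List.mem_filter, h.mem_iff]; simp
  have htot : Pt.total l = (Pt.total F).add (Pt.total R) := by
    rw [Pt.total_perm hperm, Pt.total_append]
  have hRlow : ∀ p ∈ R, p.height ≤ 0 := fun p hp =>
    hlow p ((hRmem p).1 hp).1 ((hRmem p).1 hp).2
  have hdepth : Pt.weight Pt.depth R ≤ F.length := by
    have h1 := h.special Pt.zero (by simp [Pt.dot, Pt.zero])
    have h2 := Pt.weight_depth hRlow
    have h3 : (Pt.total l).height = (Pt.total F).height + (Pt.total R).height := by
      rw [htot]; simp only [Pt.height, Pt.add]; ring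
    have h4 : Pt.zero.dot (Pt.total l) = 0 := by simp [Pt.dot, Pt.zero]
    omega
  have hcone : ∀ ℓ ∈ ls, 0 ≤ ℓ.dot (Pt.total l) := fun ℓ hℓ => by
    have := h.special ((⟨1, 1, 1⟩ : Pt).sub ℓ) fun s hs => by
      rw [Pt.dot_sub', Pt.dot_one]; linarith [hls ℓ hℓ s hs]
    rw [Pt.dot_sub', Pt.dot_one] at this
    linarith
  have hRK : R.Perm (Ks.flatten.filter σ) := by
    refine (List.perm_ext_iff_of_nodup (h.nodup.filter _) (hnd.2.1.filter _)).2 fun p => ?_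
    rw [hRmem, List.mem_filter, hσ, decide_eq_true_iff]
    constructor
    · rintro ⟨hp, hpF⟩
      refine ⟨?_, hp⟩
      have hp0 := hlow p hp hpF
      have hdp : (-p.height).toNat ≤ _ := Pt.le_weight Pt.depth ((hRmem p).2 ⟨hp, hpF⟩)
      rcases hK.exhaust p (hcands p hp0 (by omega) fun ℓ hℓ => hls ℓ hℓ p hp) with
        h1 | ⟨f, hf, ⟨h1, h2, h3⟩, hne⟩ | h1
      · refine absurd ?_ (h.good.odd p hp)
        simpa [Pt.Cong, Pt.zero] using h1
      · exact absurd (h.good.cong p hp f (hFS f hf) (fun e => hpF (e ▸ hf)) h1 h2 h3) hne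
      · exact h1
    · rintro ⟨hp, hpS⟩
      exact ⟨hpS, fun hpF => hnd.2.2 p hpF p hp rfl⟩
  have hnodupK : ∀ K ∈ Ks, K.Nodup := (List.nodup_flatten.1 hnd.2.1).1
  have hos : ∀ Ks' : List (List Pt), Ks' ⊆ Ks → ∃ os : List (List Pt),
      List.Forall₂ (· ∈ ·) os (Ks'.map Pt.options) ∧ os.flatten.Perm (Ks'.flatten.filter σ) := by
    intro Ks' hsub
    induction Ks' with
    | nil => exact ⟨[], by simp, by simp⟩
    | cons K Ks' ih =>
      obtain ⟨os, h1, h2⟩ := ih fun _ hx => hsub (by simp [hx])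
      have hKmem : K ∈ Ks := hsub (by simp)
      obtain ⟨o, ho, hp⟩ := Pt.exists_option σ K (hnodupK K hKmem) fun p hp q hq hpS hqS hne => by
        obtain ⟨c1, c2, c3⟩ := hK.cong K hKmem p hp q hq
        exact h.good.cong p (of_decide_eq_true hpS) q (of_decide_eq_true hqS) hne c1 c2 c3
      exact ⟨o :: os, List.Forall₂.cons ho h1, by
        rw [List.flatten_cons, List.flatten_cons, List.filter_append]; exact hp.append h2⟩
  obtain ⟨os, hos1, hos2⟩ := hos Ks (List.Subset.refl _)
  have hosR := hos2.trans hRK.symm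
  have hweight : ∀ f : Pt → ℕ, Pt.weight f (os.reverse ++ []).flatten = Pt.weight f R := by
    intro f
    rw [Pt.weight_eq, Pt.weight_eq, List.append_nil]
    exact (((List.reverse_perm os).flatten.trans hosR).map f).sum_eq
  have hchain : Pt.inCone ls c (os.reverse ++ []) := by
    refine Pt.chain_of_isChain (m := 0) (φ := fun ℓ => ℓ.dot (Pt.total l))
      (d := Pt.weight Pt.loss R) (List.isChain_cons.2 ⟨fun y hy => ?_, hsort⟩) ?_
      fun ℓ hℓ => ?_
    · obtain ⟨ℓ, hℓ, rfl⟩ := List.mem_map.1 (List.mem_of_mem_head? hy)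
      exact hcone ℓ hℓ
    · rw [Pt.weight_weight, hweight, zero_add]
    · have h2 := Pt.weight_gain hRlow fun p hp => hls ℓ hℓ p ((hRmem p).1 hp).1
      rw [Pt.weight_weight, hweight, htot, Pt.dot_add, hc ℓ hℓ]
      exact (Nat.cast_add _ _).trans (by rw [h2]; ring)
  obtain ⟨T, hT, hTp⟩ := Pt.exists_mem_search ls F c hos1 [] F.length []
    (by rw [Pt.weight_eq, (hosR.map _).sum_eq, ← Pt.weight_eq]; exact hdepth) hchain
  exact ⟨T, hT, hTp.trans ((hosR.append_right _).trans (List.perm_append_comm.trans hperm.symm))⟩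

namespace Pt

/-- The points of nonpositive height that may occur together with the facet `F`, sorted by their
class modulo two. -/
def classes (F cands : List Pt) : List (List Pt) :=
  [e₁, e₂, e₃, ⟨1, 1, 1⟩, ⟨0, 1, 1⟩, ⟨1, 0, 1⟩, ⟨1, 1, 0⟩].map fun c =>
    cands.filter fun p => Cong p c ∧ ∀ f ∈ F, Cong p f → p.add f = zero

def triangle : List Pt := [e₁, e₂, e₃]

def parallelogram : List Pt := [e₁, e₂, e₃, ⟨1, 1, -1⟩]

/-- The functionals computing the volume over the edges of `triangle`. -/
def triangleEdges : List Pt := [e₁, e₂, e₃]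

/-- The functionals computing the volume over the edges of `parallelogram`. -/
def parallelogramEdges : List Pt := [e₁, e₂, ⟨1, 0, 1⟩, ⟨0, 1, 1⟩]

/-- The points of height between `-3` and `0` allowed by the facets adjacent to `triangle`. -/
def triangleCands : List Pt :=
  (List.range 4).flatMap fun k : ℕ => (List.range (2 * k + 4)).flatMap fun i : ℕ =>
    (List.range (2 * k + 4 - i)).map fun j : ℕ =>
      ⟨(i : ℤ) - (k : ℤ) - 1, (j : ℤ) - (k : ℤ) - 1, (k : ℤ) + 2 - (i : ℤ) - (j : ℤ)⟩

/-- The points of height between `-4` and `0` allowed by the facets adjacent to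
`parallelogram`. -/
def parallelogramCands : List Pt :=
  (List.range 5).flatMap fun k : ℕ => (List.range (k + 3)).flatMap fun i : ℕ =>
    (List.range (k + 3)).map fun j : ℕ =>
      ⟨(i : ℤ) - (k : ℤ) - 1, (j : ℤ) - (k : ℤ) - 1, (k : ℤ) + 2 - (i : ℤ) - (j : ℤ)⟩

def triangleLeaves : List (List Pt) :=
  search triangleEdges triangle 1 ((classes triangle triangleCands).map options) [] 3 []

def parallelogramLeaves : List (List Pt) :=
  search parallelogramEdges parallelogram 2
    ((classes parallelogram parallelogramCands).map options) [] 4 []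

end Pt

namespace Pt

instance (a b c : Pt) : Decidable (IsBasis a b c) := inferInstanceAs (Decidable (_ ∨ _))

/-- The lattice point whose coordinates are the decimal digits of a number, decreased by five. -/
def ofDigits (n : ℕ) : Pt := ⟨(n / 100 : ℕ) - 5, (n / 10 % 10 : ℕ) - 5, (n % 10 : ℕ) - 5⟩

/-- The vertices of the representatives other than the unit vectors, as triples of digits. -/
def repDigits : List (List ℕ) :=
  [[444], [544, 455], [554, 446], [664, 445], [554, 447], [546, 454], [554, 545, 455], [664, 545,
   455], [554, 546, 455], [654, 455, 446], [664, 554, 447], [654, 455, 445], [564, 545, 456], [644,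
   456, 455], [554, 546, 456], [546, 545, 474], [644, 465, 456], [664, 545, 455, 446], [664, 554,
   546, 455], [564, 546, 545, 455], [645, 545, 464, 455], [564, 554, 546, 447], [664, 663, 447,
   446], [645, 546, 464, 455], [645, 554, 456, 455], [654, 545, 465, 456], [564, 546, 545, 465],
   [664, 554, 456, 447], [654, 546, 456, 455], [654, 546, 465, 455], [664, 645, 456, 455], [664,
   564, 546, 445], [654, 564, 447, 446], [744, 465, 456, 455], [664, 554, 546, 456], [664, 554, 545,
   455, 446], [654, 564, 545, 455, 446], [564, 554, 546, 545, 455], [664, 645, 545, 465, 455], [645,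
   554, 546, 465, 455], [654, 554, 546, 456, 455], [664, 564, 546, 545, 455], [654, 546, 545, 465,
   455], [664, 546, 545, 465, 455], [654, 564, 546, 456, 455], [664, 645, 546, 465, 455], [645, 564,
   545, 465, 456], [654, 564, 554, 447, 446], [654, 645, 465, 456, 455], [645, 554, 546, 465, 456],
   [645, 564, 546, 456, 455], [664, 564, 554, 546, 447], [664, 654, 456, 455, 447], [664, 654, 564,
   447, 446], [664, 663, 546, 456, 446], [664, 654, 546, 456, 455], [664, 546, 545, 465, 456], [664,
   554, 546, 456, 447], [654, 564, 546, 545, 456, 455], [654, 554, 546, 545, 465, 455], [645, 564,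
   554, 546, 456, 455], [645, 564, 546, 545, 465, 455], [664, 645, 545, 465, 456, 455], [664, 654,
   546, 545, 465, 455], [654, 564, 554, 546, 456, 447], [664, 654, 554, 546, 456, 455], [664, 663,
   564, 546, 447, 446], [654, 564, 546, 545, 465, 456], [664, 663, 554, 546, 456, 447], [654, 645,
   546, 465, 456, 455], [664, 645, 564, 546, 456, 455], [664, 645, 546, 465, 456, 455], [664, 654,
   564, 456, 447, 446], [664, 654, 564, 546, 456, 446], [664, 564, 554, 546, 456, 447], [664, 654,
   546, 456, 455, 447], [654, 564, 554, 546, 545, 456, 455], [664, 645, 564, 546, 545, 465, 455],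
   [654, 645, 554, 546, 465, 456, 455], [664, 654, 564, 546, 545, 456, 455], [664, 654, 554, 546,
   456, 455, 447], [664, 654, 546, 545, 465, 456, 455], [654, 645, 564, 546, 465, 456, 455], [664,
   645, 546, 545, 465, 456, 455], [664, 654, 645, 546, 465, 456, 455], [664, 654, 564, 554, 546,
   456, 447], [664, 645, 564, 546, 465, 456, 446], [664, 654, 564, 546, 456, 455, 447], [664, 654,
   564, 546, 456, 447, 446], [654, 645, 564, 546, 545, 465, 456, 455], [664, 645, 564, 546, 545,
   465, 456, 455], [664, 654, 564, 554, 546, 456, 447, 446], [664, 654, 645, 546, 465, 456, 455,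
   446], [664, 654, 645, 564, 546, 465, 456, 446], [664, 663, 654, 564, 546, 456, 447, 446], [654,
   645, 564, 554, 546, 545, 465, 456, 455], [664, 654, 645, 564, 546, 545, 465, 456, 455], [664,
   654, 645, 564, 546, 465, 456, 455, 446], [664, 654, 645, 564, 546, 545, 465, 456, 455, 446],
   [664, 654, 645, 564, 554, 546, 545, 465, 456, 455, 446]]

/-- The vertices of the terminal reflexive polytopes of dimension three. -/
def reps : List (List Pt) := repDigits.map fun l => triangle ++ l.map ofDigits

/-- The coordinates with respect to some basis in `r` map `r` to `T`. -/
def IsPreimage (r T : List Pt) (a b c : Pt) : Prop :=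
  T.length = r.length ∧ IsBasis a b c ∧ ∀ t ∈ T, lin a b c t ∈ r

/-- The plane through `a, b, c` supports `T`, and `a, b, c` is not a lattice basis. -/
def IsBadFacet (T : List Pt) (a b c : Pt) : Prop :=
  1 < det a b c ∧ ∀ t ∈ T, (((b.cross c).add (c.cross a)).add (a.cross b)).dot t ≤ det a b c

/-- The plane through `0, a, b` supports `T`. -/
def IsHalfSpace (T : List Pt) (a b : Pt) : Prop :=
  a.cross b ≠ zero ∧ ∀ t ∈ T, (a.cross b).dot t ≤ 0

instance (r T : List Pt) (a b c : Pt) : Decidable (IsPreimage r T a b c) :=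
  inferInstanceAs (Decidable (_ ∧ _))

instance (T : List Pt) (a b c : Pt) : Decidable (IsBadFacet T a b c) :=
  inferInstanceAs (Decidable (_ ∧ _))

instance (T : List Pt) (a b : Pt) : Decidable (IsHalfSpace T a b) :=
  inferInstanceAs (Decidable (_ ∧ _))

/-- The number `n = (m, i, j, k)` tells that `T` is equivalent to the representative with number
`m`, or that the points of `T` with numbers `i, j, k` show that it is not admissible. -/
def Resolves (T : List Pt) (n : ℕ) : Prop :=
  (fun r : List Pt => IsPreimage r T (r.getD (n / 10000 % 100) zero) (r.getD (n / 100 % 100) zero)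
    (r.getD (n % 100) zero)) (reps.getD (n / 1000000) []) ∨
  (fun a b c => IsBadFacet T a b c ∨ IsHalfSpace T a b) (T.getD (n / 10000 % 100) zero)
    (T.getD (n / 100 % 100) zero) (T.getD (n % 100) zero)

instance (T : List Pt) (n : ℕ) : Decidable (Resolves T n) :=
  inferInstanceAs (Decidable (_ ∨ _ ∨ _))

/-- Whether the numbers `ns` resolve the lists `Ts`, one by one. -/
def resolveAll (Ts : List (List Pt)) : List ℕ → Bool :=
  fold (fun T r ns => List.casesOn ns false fun n ns => cond (decide (Resolves T n)) (r ns) false)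
    (fun _ => true) Ts

theorem exists_resolves {Ts : List (List Pt)} :
    ∀ {ns : List ℕ}, resolveAll Ts ns = true → ∀ T ∈ Ts, ∃ n, Resolves T n := by
  induction Ts with
  | nil => simp
  | cons T Ts ih =>
    rintro (_ | ⟨n, ns⟩) h
    · exact absurd h (by simp [resolveAll, fold_cons])
    · change cond (decide (Resolves T n)) (resolveAll Ts ns) false = true at h
      rw [Bool.cond_false_right, Bool.and_eq_true, decide_eq_true_iff] at h
      exact List.forall_mem_cons.2 ⟨⟨n, h.1⟩, ih h.2⟩

theorem det_eq_dot (a b c : Pt) : ∀ p ∈ [a, b, c],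
    (((b.cross c).add (c.cross a)).add (a.cross b)).dot p = det a b c := by
  intro p hp
  simp only [List.mem_cons, List.not_mem_nil, or_false] at hp
  rcases hp with rfl | rfl | rfl <;> simp only [dot, add, cross, det] <;> ring

end Pt

theorem Normalized.exists_rep {S : Set Pt} {F l T : List Pt} (h : Normalized S F l)
    (hT : T.Perm l) {n : ℕ} (hn : Pt.Resolves T n) :
    ∃ r ∈ Pt.reps, LatticeEquivTo (Pt.hull S) (Pt.hull {p | p ∈ r}) := by
  have hmem : ∀ p, p ∈ T ↔ p ∈ S := fun p => hT.mem_iff.trans (h.mem_iff p)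
  have hget : ∀ i, T.getD i Pt.zero ∈ T ∨ T.getD i Pt.zero = Pt.zero := fun i => by
    by_cases hi : i < T.length
    · left; rw [List.getD_eq_getElem _ _ hi]; exact List.getElem_mem hi
    · right; rw [List.getD_eq_default _ _ (not_lt.1 hi)]
  rcases hn with ⟨hlen, hbas, hsub⟩ | ⟨h1, hle⟩ | ⟨hne, hle⟩
  · set r := Pt.reps.getD (n / 1000000) [] with hr
    have hrmem : r ∈ Pt.reps := by
      by_cases hi : n / 1000000 < Pt.reps.length
      · rw [hr, List.getD_eq_getElem _ _ hi]; exact List.getElem_mem hi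
      · rw [List.getD_eq_default _ _ (not_lt.1 hi)] at hr
        rw [hr] at hbas
        exact absurd hbas (show ¬Pt.IsBasis Pt.zero Pt.zero Pt.zero by decide)
    refine ⟨r, hrmem, ?_⟩
    have hequiv := hbas.latticeEquivTo_hull S
    have hnd : (T.map (Pt.lin (r.getD (n / 10000 % 100) Pt.zero) (r.getD (n / 100 % 100) Pt.zero)
        (r.getD (n % 100) Pt.zero))).Nodup :=
      (hT.nodup_iff.2 h.nodup).map fun p q he => (Pt.lin_eq_iff _ _ _ hbas.ne_zero p q).1 he
    have hp := (hnd.subperm (List.forall_mem_map.2 hsub)).perm_of_length_le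
      (by rw [List.length_map, hlen])
    convert hequiv using 2
    ext p
    rw [Set.mem_ofPred_eq, ← hp.mem_iff, List.mem_map, Set.mem_image]
    simp only [hmem]
  · set a := T.getD (n / 10000 % 100) Pt.zero
    set b := T.getD (n / 100 % 100) Pt.zero
    set c := T.getD (n % 100) Pt.zero
    have hS : ∀ p ∈ [a, b, c], p ∈ S := fun p hp => by
      have hp0 : p ≠ Pt.zero := by
        rintro rfl
        have := Pt.det_eq_dot a b c _ hp
        rw [Pt.dot_zero] at this
        omega
      rw [← hmem]
      simp only [List.mem_cons, List.not_mem_nil, or_false] at hp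
      rcases hp with rfl | rfl | rfl <;> exact (hget _).resolve_right hp0
    have hdot := Pt.det_eq_dot a b c
    have := h.good.unimod a (hS a (by simp)) b (hS b (by simp)) c (hS c (by simp)) _ _
      (by omega) (hdot a (by simp)) (hdot b (by simp)) (hdot c (by simp))
      (fun s hs => hle s ((hmem s).2 hs)) (by omega)
    rcases this with h2 | h2 <;> omega
  · obtain ⟨s, hs, hpos⟩ := h.good.pos _ hne
    exact absurd (hle s ((hmem s).2 hs)) (not_le.2 hpos)

namespace Pt

def triangleHints : List ℕ :=
  [100010305, 59000102, 95000102, 76000102, 76000201, 37000102, 59000201, 100000406, 100020307,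
   100000105, 76020001, 37010002, 37010200, 6000102, 100000409, 36000102, 100000409, 100000103,
   100020408, 100000206, 100010905, 59000205, 100030408, 100000602, 100010703, 20000102, 100020406,
   100000204, 100030508, 100010306, 100030406, 100010204, 59000103, 20010002, 100010407, 42000102,
   89000102, 58000102, 61000102, 19000102, 42010002, 100000305, 100020703, 100000104, 61010002,
   19010002, 100000400, 100000100, 100000510, 59000502, 100000405, 100000203, 100030405, 100000207,
   100000308, 20000201, 100010804, 36000201, 100000307, 100000105, 100030407, 100010205, 100030705,
   100010306, 100000407, 100000205, 59000301, 20010200, 78000102, 40000102, 39000102, 8000102,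
   60000102, 100000705, 24000102, 100000503, 100000509, 42000402, 100000804, 100000602, 100030405,
   100000206, 100000307, 9000102, 100010704, 23000102, 100000306, 100000104, 100030406, 100010204,
   100030605, 100010305, 100000406, 100000204, 42010602, 13000102, 69000102, 28000102, 100010306,
   29000102, 100000400, 100000100, 50000102, 100000204, 82000102, 44000102, 100000103, 100000604,
   100000102, 100000103, 100010204, 100000102, 44000201, 100000200, 29000201, 100000503, 33000102,
   100000103, 100000304, 20000203, 20000302, 1000102, 100000200, 100000204, 48000102, 100000200,
   100000103, 100000402, 11000102, 11000201, 100010305, 100000103, 100000300, 100000200, 100010409,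
   100000409, 100000605, 59030100, 100000308, 20020001, 100000702, 100000207, 100020507, 100000305,
   59030001, 20020100, 100010406, 100000406, 100010204, 100000204, 100020407, 100000105, 36020001,
   100000103, 60010002, 24010002, 78010002, 40010002, 100000506, 100000304, 39010002, 8010002,
   100010408, 100000408, 100010905, 42040002, 100000307, 9010002, 100000602, 100000206, 100020506,
   100000304, 42060102, 13010002, 100010405, 100000405, 100010203, 100000203, 100020406, 100000105,
   23010002, 100000103, 50010002, 100000106, 43060102, 15000102, 100000300, 100000302, 69010002,
   28010002, 67000102, 100000203, 20020003, 26000102, 46000102, 12000102, 100000405, 100000103,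
   100000203, 11010002, 100000106, 100000102, 100010304, 100010205, 100000203, 11010402, 100000103,
   100000102, 100000400, 100000300, 25000102, 20030002, 1010002, 100000200, 100000304, 100000307,
   100000706, 60010702, 100000408, 24010502, 100000304, 47000102, 100000403, 100000103, 100000504,
   24050102, 100000206, 2000102, 100010603, 100000304, 100000205, 100020305, 100000104, 100000305,
   49000102, 14000102, 46000201, 100000203, 11010200, 12000201, 67000201, 26000201, 64000102,
   100000104, 21000102, 20020300, 43060201, 100000207, 100000203, 15000201, 100000207, 100000105,
   100000307, 100010402, 100000203, 100000105, 100000302, 11010204, 25000201, 100000100, 21010002,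
   20030200, 4000102, 1010200, 100010306, 100000104, 100000306, 100000103, 100000104, 100000103,
   83050802, 50010602, 100010407, 100000407, 100000407, 100000200, 100000603, 100000204, 100010805,
   29050201, 100000102, 32000102, 100000201, 100000102, 100000103, 100000104, 100000306, 100000200,
   100020603, 100000105, 100000103, 100000102, 100000102, 100000603, 100000103, 100000103,
   100000201, 100000302, 100000102, 100000204, 100000502, 100000306, 100000203, 100000103,
   100010704, 100000400, 100000502, 100000205, 100000300, 100000200, 100010503, 100000103,
   100030507, 100000503, 100000104, 100000503, 100000102, 100000201, 100010203, 100000102, 29050102,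
   100000100, 100010604, 100000604, 100000103, 100000104, 100000103, 100000104, 100000204,
   100000103, 100000103, 100000206, 100000102, 100000106, 100000102, 100000201, 100000203,
   100000206, 100000102, 100000204, 100010206, 100000103, 100000204, 100010402, 100000402,
   100020304, 100000105, 100000103, 100000103, 100000103, 100010206, 100000102, 100000103,
   100020405, 100000104, 100000304, 100000102, 100000103, 100000203, 100000103, 100000106,
   100000103, 100000105, 100000103, 100000106, 100000103, 100000203, 100000206, 100010203,
   100000203, 100000102, 100000201, 100000102, 100000102, 16000102, 100000102, 100000301, 100000302,
   100000103, 100000203, 100000103, 100000204, 100000302, 100000203, 100000103, 100000203,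
   100000103, 100000506, 100000304, 100000304, 100000203, 100000103, 100000203, 100000203,
   100000103, 100000304, 100000402, 100000205, 102, 100000203, 100000302, 100000103, 100000103,
   100000203, 100000103, 100000301, 100000103, 100000103, 100000400, 100000300, 100000200,
   100000200, 100000100, 100000203, 5000102, 100000200, 100000400, 100000200, 100000100, 100000300,
   100000104, 100000300, 100000200, 100000300, 13010402, 100000300, 100000100, 100000100, 100000200,
   100000206, 100000204, 100000100, 100000200, 100000100, 100000206, 100000104, 100000203,
   100010403, 100000203, 100000104, 100000302, 5010002, 100000300, 100000200, 100000100, 100000300,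
   13040102, 100000300, 100000200, 100000200, 100000200, 100000200]

def parallelogramHints : List ℕ :=
  [100000608, 100000309, 99020300, 99000102, 95000501, 100000907, 100000410, 76000401, 100000410,
   100000507, 100000608, 100001105, 76000403, 100000406, 100000208, 35000102, 100000605, 100001004,
   60000602, 100000706, 100000504, 100000406, 100000204, 100000405, 100000308, 100010708, 98000102,
   89000602, 100000806, 100000409, 61000502, 100000803, 100000406, 100000507, 100010904, 61050002,
   100000305, 100000207, 17000102, 100000504, 83000102, 100000304, 50000502, 81000102, 63000102,
   100000204, 100000902, 100000507, 43000102, 100000605, 90000102, 67080102, 100000605, 100000706,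
   96000102, 100000301, 79000102, 100000403, 100000504, 77000102, 59000605, 41000102, 63010002,
   100000406, 100000305, 100000206, 100000208, 100000406, 100000204, 100000304, 100000308,
   100010206, 100000406, 100000903, 100010307, 100000305, 62000102, 25060102, 100000305, 100000406,
   77000103, 59000603, 41000103, 100000103, 100000204, 38000102, 20010602, 7000102, 100010709,
   100001106, 78000602, 100000705, 100000308, 39000502, 100000405, 100000806, 100000203, 100000604,
   100010507, 100000904, 46060201, 80000102, 100010608, 100001005, 100000203, 65000102, 100000503,
   100000604, 100000803, 36000401, 18000102, 100000409, 90080201, 100000705, 100000203, 100000209,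
   100000305, 100000604, 100000105, 100000204, 100000507, 100000305, 100000304, 100000102,
   100000904, 100000106, 100000306, 100000104, 100000207, 62060201, 100000503, 100000205, 100000207,
   100000103, 100000402, 100000406, 100010608, 92000102, 100000507, 69000502, 100000307, 100000604,
   100000307, 100000305, 100000100, 83000502, 100000204, 97030201, 97000102, 82070201, 100000705,
   100000806, 100000509, 100000102, 65000103, 100000105, 100000109, 100000408, 100000705, 100000705,
   100000408, 100000200, 100000703, 100000804, 100000604, 100000602, 100000407, 100001004,
   100020304, 100000205, 100000307, 100000102, 100000602, 100000203, 100010507, 100010804, 48050201,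
   100000503, 100000604, 100000307, 36000403, 18000103, 100000103, 100000107, 100000206, 100000104,
   100000503, 100000206, 100000100, 100010406, 71000102, 100010200, 75000102, 100010507, 84000102,
   100000203, 55000102, 100010200, 100000503, 45000102, 23000402, 100000100, 70000102, 87000102,
   100000604, 100000203, 100000208, 100000603, 100010300, 100000104, 100000305, 100000203,
   100000102, 100000302, 100000501, 100010307, 100000105, 100000305, 100000103, 30000102, 52000102,
   100000402, 100000204, 100000206, 100000204, 100000100, 100000504, 100000207, 100010807,
   100000605, 78010802, 100000607, 100000405, 100000506, 100000403, 39050002, 100000803, 100000904,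
   100000702, 80010002, 100010706, 100010510, 100000103, 65010002, 100000208, 100000605, 100000409,
   100000108, 100000105, 100000405, 100000506, 100000304, 100000204, 100000402, 100020304,
   100000204, 100000207, 100000102, 100000304, 100000405, 100000803, 36020500, 18010002, 100000203,
   100000105, 100000207, 100000106, 100000103, 83050002, 100000107, 100000206, 100000205, 100010706,
   92010002, 100000605, 69010702, 90090102, 100000408, 100000802, 100000205, 100000306, 100000307,
   100000506, 100010804, 46070102, 100000506, 100000607, 100010905, 100000103, 65010003, 100000304,
   100000405, 100000307, 36020507, 18010003, 100000307, 100000105, 100000804, 100000107, 100000304,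
   100000102, 100000506, 100000304, 100000405, 100010703, 100000403, 100000400, 62070102, 100000206,
   100000405, 100000203, 100000104, 100000105, 56000102, 70010002, 30010002, 75010002, 100010605,
   84010002, 100000103, 55010002, 100000207, 100000103, 100010207, 100000107, 100000104, 100000304,
   100000405, 100000203, 100000204, 100000304, 100020306, 100000203, 100000206, 100000104,
   100010400, 100000304, 45010002, 23010602, 100000300, 100000205, 100000104, 100000501, 100000105,
   100000102, 80010902, 100000504, 63020300, 49000502, 100000504, 100000307, 100000702, 100000204,
   100000205, 100000206, 90030201, 100000605, 67070201, 91000102, 96020300, 100000706, 100000104,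
   79020300, 64080002, 77020300, 100000408, 59030506, 41020300, 100000304, 81030201, 63020301,
   100000206, 100000408, 100000304, 43030201, 100000703, 100000308, 100010503, 100000306, 100000304,
   100010402, 62030201, 100000403, 25050201, 64000802, 77020301, 100000504, 59030500, 41020301,
   21000602, 38020300, 100000206, 20020501, 7020300, 57000102, 68000102, 100000804, 100000201,
   34000102, 100000206, 100000105, 100000103, 100000106, 100000102, 74000102, 85000102, 51000102,
   100000103, 100000104, 100000103, 100000104, 100000402, 100000206, 100000203, 100000201,
   100000201, 100000102, 27000102, 51010002, 10000102, 75010802, 100000800, 54000102, 100000400,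
   71070102, 100000306, 100000602, 100000204, 100000204, 100000600, 87090102, 86000102, 100010300,
   88000102, 94000102, 93000102, 100000104, 73000102, 100010300, 66000102, 100000407, 42060402,
   100000200, 100000603, 72000102, 53000102, 100000205, 100000302, 100000305, 100010300, 100000603,
   100000203, 100010504, 100000305, 100000304, 100010302, 52070102, 100000700, 100000300, 100010500,
   66010002, 100010704, 42040602, 100000400, 100010300, 22000102, 100000600, 9010502, 100000200,
   100000100, 100000200, 100000600, 100000700, 100000200, 100000201, 100000104, 100000300,
   100000200, 100000100, 100000102, 100000102, 100000104, 100000104, 100000201, 100000106,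
   100000105, 100000104, 100000102, 100000203, 100000203, 100010406, 100000305, 100000102,
   100000102, 100000104, 100000106, 100000102, 100000102, 100000500, 100000100, 100000200,
   100000400, 100000103, 100000200, 100000100, 100000200, 100000300, 100000104, 100000300,
   100000102, 100000103, 100000103, 100000106, 100000102, 100000200, 100000300, 100000300, 31000102,
   100000300, 100000100, 100000100, 100000102, 100000102, 100000100, 100000200, 100000103,
   100000103, 100000102, 100000102, 100000102, 100000103, 100000204, 100000206, 100010305,
   100000204, 100000103, 100000105, 100000103, 100000102, 100000102, 100000105, 100000103,
   100000100, 100000201, 100000104, 100000102, 100000102, 100000104, 100000102, 100000502,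
   100000204, 100000204, 100000304, 33040201, 100000201, 100000302, 100000203, 100020504, 100010403,
   100000102, 100000106, 100000102, 100000103, 100000402, 100000205, 100000400, 100000102,
   100000103, 100000102, 100000103, 100000201, 100000104, 100000102, 100000104, 100000102,
   100000102, 100000203, 100000302, 100020603, 100010502, 100000203, 100000104, 100000102,
   100000105, 100000102, 100000102, 100000103, 100000102, 100000103, 100000102, 100000201,
   100000201, 100000102, 100000102, 100000201, 100000201, 100000102, 100000100, 100000200,
   100000600, 16040201, 100000200, 100000100, 100000200, 100000300, 31000103, 100000300, 100000403,
   100000103, 100000401, 100000104, 100000301, 100000200, 100000300, 100000500, 3000102, 100000200]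

theorem resolveAll_triangleLeaves : resolveAll triangleLeaves triangleHints = true := by
  decide +kernel

theorem resolveAll_parallelogramLeaves :
    resolveAll parallelogramLeaves parallelogramHints = true := by
  decide +kernel

end Pt

theorem Normalized.mem_of_mem_facet {S : Set Pt} {F l : List Pt} (h : Normalized S F l) {f : Pt}
    (hf : f ∈ F) : f ∈ S ∧ f.height = 1 :=
  (h.mem_facet_iff f).1 hf

theorem Normalized.neighbor {S : Set Pt} {F l : List Pt} (h : Normalized S F l) {ℓ a b : Pt}
    (ha : a ∈ F) (hb : b ∈ F) (hla : ℓ.dot a = 0) (hlb : ℓ.dot b = 0)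
    (hdet : ∀ s, Pt.det a b s = ℓ.dot s ∨ Pt.det a b s = -ℓ.dot s) (hF : ∀ f ∈ F, 0 ≤ ℓ.dot f) :
    ∀ s ∈ S, s.height - 1 ≤ ℓ.dot s := by
  have hfin : S.Finite := (List.finite_toSet l).subset fun s hs => (h.mem_iff s).2 hs
  have := h.good.neighbor hfin (u := ⟨1, 1, 1⟩) (ℓ := ℓ) (h.mem_of_mem_facet ha).1
    (h.mem_of_mem_facet hb).1 (by rw [Pt.dot_one, (h.mem_of_mem_facet ha).2])
    (by rw [Pt.dot_one, (h.mem_of_mem_facet hb).2]) hla hlb hdet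
    (by simpa only [Pt.dot_one] using h.height_le) fun s hs hlt => by
      rw [Pt.dot_one]
      have h1 := h.height_le s hs
      have h2 : s.height ≠ 1 := fun e => (hF s ((h.mem_facet_iff s).2 ⟨hs, e⟩)).not_gt hlt
      omega
  simpa only [Pt.dot_one] using this

theorem Normalized.exists_total_eq {S : Set Pt} {F l : List Pt} (h : Normalized S F l)
    {t a b c : Pt} (ht : Pt.lin a b c t = Pt.total l) (hbas : Pt.IsBasis a b c)
    (ha : a.height = 1) (hb : b.height = 1) (hc : c.height = 1)
    (hF : (F.map (Pt.lin a b c)).Perm F) :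
    ∃ S' l', LatticeEquivTo (Pt.hull S) (Pt.hull S') ∧ Normalized S' F l' ∧ Pt.total l' = t := by
  obtain ⟨S', l', h1, h2, h3⟩ := h.changeBasis hbas ha hb hc hF
  exact ⟨S', l', h1, h2, (Pt.lin_eq_iff a b c hbas.ne_zero _ _).1 (h3.trans ht.symm)⟩

theorem Normalized.exists_total_triangle {S : Set Pt} {l : List Pt}
    (h : Normalized S Pt.triangle l) :
    ∃ S' l', LatticeEquivTo (Pt.hull S) (Pt.hull S') ∧ Normalized S' Pt.triangle l' ∧
      (Pt.total l').x ≤ (Pt.total l').y ∧ (Pt.total l').y ≤ (Pt.total l').z := by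
  by_contra hno
  rcases ht : Pt.total l with ⟨x, y, z⟩
  have key : ∀ t a b c : Pt, Pt.lin a b c t = ⟨x, y, z⟩ → Pt.IsBasis a b c ∧ a.height = 1 ∧
      b.height = 1 ∧ c.height = 1 ∧ (Pt.triangle.map (Pt.lin a b c)).Perm Pt.triangle →
      t.x ≤ t.y ∧ t.y ≤ t.z → False := fun t a b c h1 ⟨h2, h3, h4, h5, h6⟩ h7 => by
    obtain ⟨S', l', h8, h9, rfl⟩ := h.exists_total_eq (h1.trans ht.symm) h2 h3 h4 h5 h6
    exact hno ⟨S', l', h8, h9, h7⟩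
  have hcases : (x ≤ y ∧ y ≤ z) ∨ (x ≤ z ∧ z ≤ y) ∨ (y ≤ x ∧ x ≤ z) ∨ (y ≤ z ∧ z ≤ x) ∨
      (z ≤ x ∧ x ≤ y) ∨ (z ≤ y ∧ y ≤ x) := by omega
  rcases hcases with h | h | h | h | h | h
  · exact key ⟨x, y, z⟩ Pt.e₁ Pt.e₂ Pt.e₃ (by simp [Pt.lin, Pt.e₁, Pt.e₂, Pt.e₃]) (by decide) h
  · exact key ⟨x, z, y⟩ Pt.e₁ Pt.e₃ Pt.e₂ (by simp [Pt.lin, Pt.e₁, Pt.e₂, Pt.e₃]) (by decide) h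
  · exact key ⟨y, x, z⟩ Pt.e₂ Pt.e₁ Pt.e₃ (by simp [Pt.lin, Pt.e₁, Pt.e₂, Pt.e₃]) (by decide) h
  · exact key ⟨y, z, x⟩ Pt.e₂ Pt.e₃ Pt.e₁ (by simp [Pt.lin, Pt.e₁, Pt.e₂, Pt.e₃]) (by decide) h
  · exact key ⟨z, x, y⟩ Pt.e₃ Pt.e₁ Pt.e₂ (by simp [Pt.lin, Pt.e₁, Pt.e₂, Pt.e₃]) (by decide) h
  · exact key ⟨z, y, x⟩ Pt.e₃ Pt.e₂ Pt.e₁ (by simp [Pt.lin, Pt.e₁, Pt.e₂, Pt.e₃]) (by decide) h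

theorem Normalized.exists_total_parallelogram {S : Set Pt} {l : List Pt}
    (h : Normalized S Pt.parallelogram l) :
    ∃ S' l', LatticeEquivTo (Pt.hull S) (Pt.hull S') ∧ Normalized S' Pt.parallelogram l' ∧
      (Pt.total l').x ≤ (Pt.total l').y ∧ (Pt.total l').y ≤ (Pt.total l').x + (Pt.total l').z := by
  by_contra hno
  rcases ht : Pt.total l with ⟨x, y, z⟩
  have key : ∀ t a b c : Pt, Pt.lin a b c t = ⟨x, y, z⟩ → Pt.IsBasis a b c ∧ a.height = 1 ∧
      b.height = 1 ∧ c.height = 1 ∧ (Pt.parallelogram.map (Pt.lin a b c)).Perm Pt.parallelogram →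
      t.x ≤ t.y ∧ t.y ≤ t.x + t.z → False := fun t a b c h1 ⟨h2, h3, h4, h5, h6⟩ h7 => by
    obtain ⟨S', l', h8, h9, rfl⟩ := h.exists_total_eq (h1.trans ht.symm) h2 h3 h4 h5 h6
    exact hno ⟨S', l', h8, h9, h7⟩
  have hcases : (x ≤ y ∧ y ≤ x + z) ∨ (y ≤ x ∧ x ≤ y + z) ∨ (x + z ≤ y + z ∧ y + z ≤ x) ∨
      (y + z ≤ x + z ∧ x + z ≤ y) ∨ (y + z ≤ y ∧ y ≤ x + z) ∨ (y ≤ y + z ∧ y + z ≤ x) ∨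
      (x + z ≤ x ∧ x ≤ y + z) ∨ (x ≤ x + z ∧ x + z ≤ y) := by omega
  rcases hcases with h | h | h | h | h | h | h | h
  · exact key ⟨x, y, z⟩ Pt.e₁ Pt.e₂ Pt.e₃ (by simp [Pt.lin, Pt.e₁, Pt.e₂, Pt.e₃]) (by decide) h
  · exact key ⟨y, x, z⟩ Pt.e₂ Pt.e₁ Pt.e₃ (by simp [Pt.lin, Pt.e₁, Pt.e₂, Pt.e₃]) (by decide) h
  · exact key ⟨x + z, y + z, -z⟩ Pt.e₁ Pt.e₂ ⟨1, 1, -1⟩ (by simp [Pt.lin, Pt.e₁, Pt.e₂])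
      (by decide) (by simpa using h)
  · exact key ⟨y + z, x + z, -z⟩ Pt.e₂ Pt.e₁ ⟨1, 1, -1⟩ (by simp [Pt.lin, Pt.e₁, Pt.e₂])
      (by decide) (by simpa using h)
  · exact key ⟨y + z, y, x - y⟩ Pt.e₃ ⟨1, 1, -1⟩ Pt.e₁ (by simp [Pt.lin, Pt.e₁, Pt.e₃])
      (by decide) ⟨h.1, by simp only; omega⟩
  · exact key ⟨y, y + z, x - y⟩ ⟨1, 1, -1⟩ Pt.e₃ Pt.e₁ (by simp [Pt.lin, Pt.e₁, Pt.e₃])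
      (by decide) ⟨h.1, by simp only; omega⟩
  · exact key ⟨x + z, x, y - x⟩ Pt.e₃ ⟨1, 1, -1⟩ Pt.e₂ (by simp [Pt.lin, Pt.e₂, Pt.e₃])
      (by decide) ⟨h.1, by simp only; omega⟩
  · exact key ⟨x, x + z, y - x⟩ ⟨1, 1, -1⟩ Pt.e₃ Pt.e₂ (by simp [Pt.lin, Pt.e₂, Pt.e₃])
      (by decide) ⟨h.1, by simp only; omega⟩

namespace Pt

theorem separates_triangle : Separates triangle triangleCands (classes triangle triangleCands) :=
  ⟨by decide +kernel, by decide +kernel, by decide +kernel⟩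

theorem separates_parallelogram :
    Separates parallelogram parallelogramCands (classes parallelogram parallelogramCands) :=
  ⟨by decide +kernel, by decide +kernel, by decide +kernel⟩

theorem mem_triangleCands {p : Pt} (h : p.height ≤ 0) (h' : -3 ≤ p.height)
    (hx : p.height - 1 ≤ p.x) (hy : p.height - 1 ≤ p.y) (hz : p.height - 1 ≤ p.z) :
    p ∈ triangleCands := by
  simp only [height] at *
  simp only [triangleCands, List.mem_flatMap, List.mem_map, List.mem_range]
  refine ⟨(-p.height).toNat, ?_, (p.x - p.height + 1).toNat, ?_, (p.y - p.height + 1).toNat, ?_,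
    Pt.ext ?_ ?_ ?_⟩ <;> simp only [height] <;> omega

theorem mem_parallelogramCands {p : Pt} (h : p.height ≤ 0) (h' : -4 ≤ p.height)
    (hx : p.height - 1 ≤ p.x) (hy : p.height - 1 ≤ p.y) (hxz : p.height - 1 ≤ p.x + p.z)
    (hyz : p.height - 1 ≤ p.y + p.z) : p ∈ parallelogramCands := by
  simp only [height] at *
  simp only [parallelogramCands, List.mem_flatMap, List.mem_map, List.mem_range]
  refine ⟨(-p.height).toNat, ?_, (p.x - p.height + 1).toNat, ?_, (p.y - p.height + 1).toNat, ?_,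
    Pt.ext ?_ ?_ ?_⟩ <;> simp only [height] <;> omega

end Pt

theorem Normalized.exists_rep_of_triangle {S : Set Pt} {l : List Pt}
    (h : Normalized S Pt.triangle l) :
    ∃ r ∈ Pt.reps, LatticeEquivTo (Pt.hull S) (Pt.hull {p | p ∈ r}) := by
  obtain ⟨S', l', he, h', hxy, hyz⟩ := h.exists_total_triangle
  have hls : ∀ ℓ ∈ Pt.triangleEdges, ∀ s ∈ S', s.height - 1 ≤ ℓ.dot s := by
    simp only [Pt.triangleEdges, List.forall_mem_cons, List.not_mem_nil, false_imp_iff,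
      implies_true, and_true]
    refine ⟨h'.neighbor (a := Pt.e₂) (b := Pt.e₃) (by decide) (by decide) rfl rfl (fun s => ?_)
        (by decide),
      h'.neighbor (a := Pt.e₁) (b := Pt.e₃) (by decide) (by decide) rfl rfl (fun s => ?_)
        (by decide),
      h'.neighbor (a := Pt.e₁) (b := Pt.e₂) (by decide) (by decide) rfl rfl (fun s => ?_)
        (by decide)⟩ <;>
    simp [Pt.det, Pt.dot, Pt.cross, Pt.e₁, Pt.e₂, Pt.e₃]
  obtain ⟨T, hT, hperm⟩ := h'.exists_mem_search Pt.separates_triangle hls rfl (c := 1) (by decide)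
    (by simpa [Pt.triangleEdges, Pt.dot, Pt.e₁, Pt.e₂, Pt.e₃] using ⟨hxy, hyz⟩)
    fun p h1 h2 h3 => by
      simp only [Pt.triangleEdges, List.forall_mem_cons] at h3
      exact Pt.mem_triangleCands h1 h2 (by simpa [Pt.dot, Pt.e₁] using h3.1)
        (by simpa [Pt.dot, Pt.e₂] using h3.2.1) (by simpa [Pt.dot, Pt.e₃] using h3.2.2.1)
  obtain ⟨n, hn⟩ := Pt.exists_resolves Pt.resolveAll_triangleLeaves T hT
  obtain ⟨r, hr, he'⟩ := h'.exists_rep hperm hn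
  exact ⟨r, hr, he.trans he'⟩

theorem Normalized.exists_rep_of_parallelogram {S : Set Pt} {l : List Pt}
    (h : Normalized S Pt.parallelogram l) :
    ∃ r ∈ Pt.reps, LatticeEquivTo (Pt.hull S) (Pt.hull {p | p ∈ r}) := by
  obtain ⟨S', l', he, h', hxy, hyz⟩ := h.exists_total_parallelogram
  have hls : ∀ ℓ ∈ Pt.parallelogramEdges, ∀ s ∈ S', s.height - 1 ≤ ℓ.dot s := by
    simp only [Pt.parallelogramEdges, List.forall_mem_cons, List.not_mem_nil, false_imp_iff,
      implies_true, and_true]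
    refine ⟨h'.neighbor (a := Pt.e₂) (b := Pt.e₃) (by decide) (by decide) rfl rfl (fun s => ?_)
        (by decide),
      h'.neighbor (a := Pt.e₁) (b := Pt.e₃) (by decide) (by decide) rfl rfl (fun s => ?_)
        (by decide),
      h'.neighbor (a := Pt.e₂) (b := ⟨1, 1, -1⟩) (by decide) (by decide) rfl rfl (fun s => ?_)
        (by decide),
      h'.neighbor (a := Pt.e₁) (b := ⟨1, 1, -1⟩) (by decide) (by decide) rfl rfl (fun s => ?_)
        (by decide)⟩ <;>
    simp only [Pt.det, Pt.dot, Pt.cross, Pt.e₁, Pt.e₂, Pt.e₃] <;> omega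
  obtain ⟨T, hT, hperm⟩ := h'.exists_mem_search Pt.separates_parallelogram hls rfl (c := 2)
    (by decide)
    (by simpa [Pt.parallelogramEdges, Pt.dot, Pt.e₁, Pt.e₂] using ⟨hxy, hyz, hxy⟩)
    fun p h1 h2 h3 => by
      simp only [Pt.parallelogramEdges, List.forall_mem_cons] at h3
      exact Pt.mem_parallelogramCands h1 h2 (by simpa [Pt.dot, Pt.e₁] using h3.1)
        (by simpa [Pt.dot, Pt.e₂] using h3.2.1) (by simpa [Pt.dot] using h3.2.2.1)
        (by simpa [Pt.dot] using h3.2.2.2.1)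
  obtain ⟨n, hn⟩ := Pt.exists_resolves Pt.resolveAll_parallelogramLeaves T hT
  obtain ⟨r, hr, he'⟩ := h'.exists_rep hperm hn
  exact ⟨r, hr, he.trans he'⟩

theorem exists_rep {P : Set (Fin 3 → ℝ)} (hP : IsReflexive P) (hT : IsTerminalPolytope P) :
    ∃ r ∈ Pt.reps, LatticeEquivTo P (Pt.hull {p | p ∈ r}) := by
  obtain ⟨S, l, he, h | h⟩ := exists_normalized hP hT
  · obtain ⟨r, hr, he'⟩ := Normalized.exists_rep_of_triangle h
    exact ⟨r, hr, he.trans he'⟩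
  · obtain ⟨r, hr, he'⟩ := Normalized.exists_rep_of_parallelogram h
    exact ⟨r, hr, he.trans he'⟩

theorem zero_mem_interior_convexHull {A : Set (Fin 3 → ℝ)} (hne : A.Nonempty)
    (h : ∀ z : Fin 3 → ℝ, (∀ a ∈ A, dotProd z a ≤ 0) → z = 0) :
    (0 : Fin 3 → ℝ) ∈ interior (convexHull ℝ A) := by
  have hne0 : (interior (convexHull ℝ A)).Nonempty := by
    rw [interior_convexHull_nonempty_iff_affineSpan_eq_top]
    by_contra hs
    rw [AffineSubspace.affineSpan_eq_top_iff_vectorSpan_eq_top_of_nonempty ℝ _ _ hne,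
      vectorSpan_def] at hs
    obtain ⟨z, hz, hzA⟩ := exists_dotProd_eq_zero hs
    obtain ⟨p, hp⟩ := hne
    have hconst : ∀ a ∈ A, dotProd z a = dotProd z p := fun a ha => by
      have := hzA (a -ᵥ p) (Set.vsub_mem_vsub ha hp)
      rw [vsub_eq_sub, dotProd_sub] at this
      linarith
    rcases le_total (dotProd z p) 0 with hle | hle
    · exact hz (h z fun a ha => (hconst a ha).trans_le hle)
    · refine hz (neg_eq_zero.1 (h (-z) fun a ha => ?_))
      rw [neg_dotProd, hconst a ha]; linarith
  by_contra h0
  obtain ⟨f, hf⟩ := geometric_hahn_banach_open_point (convex_convexHull ℝ A).interior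
    isOpen_interior h0
  obtain ⟨z, hz⟩ := exists_dotProd_eq (f : (Fin 3 → ℝ) →ₗ[ℝ] ℝ)
  have hcl : ∀ x ∈ closure (interior (convexHull ℝ A)), f x ≤ 0 := fun x hx =>
    closure_minimal (fun y hy => by simpa using (hf y hy).le)
      (isClosed_le f.continuous continuous_const) hx
  rw [(convex_convexHull ℝ A).closure_interior_eq_closure_of_nonempty_interior hne0] at hcl
  have hz0 := h z fun a ha => by
    rw [← hz]; exact hcl a (subset_closure (subset_convexHull ℝ A ha))
  obtain ⟨x, hx⟩ := hne0
  have := hf x hx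
  have hx0 := hz x
  simp only [hz0, dotProd, Pi.zero_apply, zero_mul, Finset.sum_const_zero,
    ContinuousLinearMap.coe_coe] at hx0
  simp [hx0] at this

namespace Pt

/-- The normal vector of the plane through three lattice points, of norm `det a b c`. -/
def normal (a b c : Pt) : Pt := ((b.cross c).add (c.cross a)).add (a.cross b)

theorem normal_dot (a b c : Pt) :
    (normal a b c).dot a = det a b c ∧ (normal a b c).dot b = det a b c ∧
      (normal a b c).dot c = det a b c := by
  refine ⟨?_, ?_, ?_⟩ <;> simp only [normal, det, dot, cross, add] <;> ring

/-- Every supporting plane spanned by points of `r` is at lattice distance one from the origin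
and contains a unimodular triangle or parallelogram. -/
def HasUnimodularFacets (r : List Pt) : Prop :=
  ∀ t ∈ r.tails, ∀ a ∈ t.head?, ∀ b ∈ t, ∀ c ∈ t, 0 < det a b c → (∀ s ∈ r, (normal a b c).dot s ≤ det a b c) →
    det a b c = 1 ∧ ∀ s ∈ r, (normal a b c).dot s = 1 → s ≠ a → s ≠ b → s ≠ c →
      (s = fourth a b c ∨ s = fourth a c b ∨ s = fourth b c a) ∧
        ∀ t ∈ r, (normal a b c).dot t = 1 → t ≠ a → t ≠ b → t ≠ c → s = t

/-- The unit vectors and some points with a strictly negative sum belong to `r`. -/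
def Surrounds (r ws : List Pt) : Prop :=
  e₁ ∈ r ∧ e₂ ∈ r ∧ e₃ ∈ r ∧ (∀ w ∈ ws, w ∈ r) ∧
    (total ws).x < 0 ∧ (total ws).y < 0 ∧ (total ws).z < 0

instance (r : List Pt) : Decidable (HasUnimodularFacets r) :=
  inferInstanceAs (Decidable (∀ t ∈ r.tails, ∀ a ∈ t.head?, ∀ b ∈ t, ∀ c ∈ t, _ → _))

instance (r ws : List Pt) : Decidable (Surrounds r ws) :=
  inferInstanceAs (Decidable (_ ∧ _))

theorem dotProd_vec_total (z : Fin 3 → ℝ) (l : List Pt) (h : ∀ p ∈ l, dotProd z p.vec ≤ 0) :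
    dotProd z (total l).vec ≤ 0 := by
  induction l with
  | nil => simp [total, vec, dotProd_three]
  | cons p l ih =>
    have : total (p :: l) = p.add (total l) := by simp [total, add]
    rw [this, vec_add, dotProd_add]
    linarith [h p (by simp), ih fun q hq => h q (by simp [hq])]

theorem Surrounds.zero_mem_interior {r ws : List Pt} (h : Surrounds r ws) :
    (0 : Fin 3 → ℝ) ∈ interior (hull {p | p ∈ r}) := by
  obtain ⟨h1, h2, h3, hws, hx, hy, hz⟩ := h
  refine zero_mem_interior_convexHull ⟨_, e₁, h1, rfl⟩ fun z hle => ?_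
  have hle' : ∀ p ∈ r, dotProd z p.vec ≤ 0 := fun p hp => hle _ ⟨p, hp, rfl⟩
  have ht := dotProd_vec_total z ws fun p hp => hle' p (hws p hp)
  have hz1 := hle' _ h1
  have hz2 := hle' _ h2
  have hz3 := hle' _ h3
  simp only [dotProd_three, vec, e₁, e₂, e₃, Matrix.cons_val_zero, Matrix.cons_val_one,
    Matrix.cons_val, Int.cast_one, Int.cast_zero, mul_one, mul_zero, add_zero, zero_add]
    at ht hz1 hz2 hz3
  have hx' : ((total ws).x : ℝ) < 0 := by exact_mod_cast hx
  have hy' : ((total ws).y : ℝ) < 0 := by exact_mod_cast hy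
  have hz' : ((total ws).z : ℝ) < 0 := by exact_mod_cast hz
  have p1 := mul_nonneg_of_nonpos_of_nonpos hz1 hx'.le
  have p2 := mul_nonneg_of_nonpos_of_nonpos hz2 hy'.le
  have p3 := mul_nonneg_of_nonpos_of_nonpos hz3 hz'.le
  have q1 : z 0 = 0 := (mul_eq_zero.1 (by linarith : z 0 * ((total ws).x : ℝ) = 0)).resolve_right
    hx'.ne
  have q2 : z 1 = 0 := (mul_eq_zero.1 (by linarith : z 1 * ((total ws).y : ℝ) = 0)).resolve_right
    hy'.ne
  have q3 : z 2 = 0 := (mul_eq_zero.1 (by linarith : z 2 * ((total ws).z : ℝ) = 0)).resolve_right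
    hz'.ne
  ext i; fin_cases i <;> assumption

theorem exists_mem_tails {r : List Pt} {a b c : Pt} (ha : a ∈ r) (hb : b ∈ r) (hc : c ∈ r) :
    ∃ t ∈ r.tails, b ∈ t ∧ c ∈ t ∧ a ∈ t.head? ∨ c ∈ t ∧ a ∈ t ∧ b ∈ t.head? ∨
      a ∈ t ∧ b ∈ t ∧ c ∈ t.head? := by
  induction r with
  | nil => simp at ha
  | cons p l ih =>
    by_cases h : a = p ∨ b = p ∨ c = p
    · refine ⟨p :: l, by simp, ?_⟩
      simp only [List.head?_cons, Option.mem_some_iff]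
      rcases h with rfl | rfl | rfl
      exacts [.inl ⟨hb, hc, rfl⟩, .inr (.inl ⟨hc, ha, rfl⟩), .inr (.inr ⟨ha, hb, rfl⟩)]
    · obtain ⟨h1, h2, h3⟩ : a ≠ p ∧ b ≠ p ∧ c ≠ p := by tauto
      obtain ⟨t, ht, h⟩ := ih ((List.mem_cons.1 ha).resolve_left h1)
        ((List.mem_cons.1 hb).resolve_left h2) ((List.mem_cons.1 hc).resolve_left h3)
      exact ⟨t, by simp [List.tails, ht], h⟩

theorem HasUnimodularFacets.exists_normal {r : List Pt} (h : HasUnimodularFacets r)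
    {y : Fin 3 → ℝ} (hy : y ∈ polar (vec '' {p | p ∈ r})) {a b c : Pt} (ha : a ∈ r) (hb : b ∈ r)
    (hc : c ∈ r) (hdet : det a b c ≠ 0) (hya : dotProd y a.vec = 1) (hyb : dotProd y b.vec = 1)
    (hyc : dotProd y c.vec = 1) :
    ∃ i ∈ r, ∃ j ∈ r, ∃ k ∈ r, (normal i j k).vec = y ∧
      IsUnimodularSet (tight {p | p ∈ r} (normal i j k)) := by
  wlog hpos : 0 < det a b c generalizing a b
  · have hswap : det b a c = -det a b c := by simp only [det, dot, cross]; ring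
    exact this hb ha (by simpa [hswap] using hdet) hyb hya (by omega)
  wlog hrot : ∃ t ∈ r.tails, b ∈ t ∧ c ∈ t ∧ a ∈ t.head? generalizing a b c
  · have h1 : det b c a = det a b c := by simp only [det, dot, cross]; ring
    have h2 : det c a b = det a b c := by simp only [det, dot, cross]; ring
    obtain ⟨t, ht, h | h | h⟩ := exists_mem_tails ha hb hc
    · exact absurd ⟨t, ht, h⟩ hrot
    · exact this (a := b) (b := c) (c := a) (ha := hb) (hb := hc) (hc := ha) (hya := hyb)
        (hyb := hyc) (hyc := hya) (hdet := h1 ▸ hdet) (hpos := h1 ▸ hpos) ⟨t, ht, h⟩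
    · exact this (a := c) (b := a) (c := b) (ha := hc) (hb := ha) (hc := hb) (hya := hyc)
        (hyb := hya) (hyc := hyb) (hdet := h2 ▸ hdet) (hpos := h2 ▸ hpos) ⟨t, ht, h⟩
  obtain ⟨t, ht, hbt, hct, hat⟩ := hrot
  obtain ⟨na, nb, nc⟩ := normal_dot a b c
  have hyn : ((det a b c : ℤ) : ℝ) • y = (normal a b c).vec :=
    eq_of_dotProd_eq ((linearIndependent_vec_iff a b c).2 hdet)
      (by rw [smul_dotProd, dotProd_vec, na, hya, mul_one])
      (by rw [smul_dotProd, dotProd_vec, nb, hyb, mul_one])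
      (by rw [smul_dotProd, dotProd_vec, nc, hyc, mul_one])
  have hle : ∀ s ∈ r, (normal a b c).dot s ≤ det a b c := fun s hs => by
    have h1 := hy _ ⟨s, hs, rfl⟩
    have h2 : ((normal a b c).dot s : ℝ) = det a b c * dotProd y s.vec := by
      rw [← dotProd_vec, ← hyn, smul_dotProd]
    have h3 : (0 : ℝ) < det a b c := by exact_mod_cast hpos
    have h4 : ((normal a b c).dot s : ℝ) ≤ det a b c := by rw [h2]; nlinarith
    exact_mod_cast h4
  obtain ⟨h1, h2⟩ := h t ht a hat b hbt c hct hpos hle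
  rw [h1, Int.cast_one, one_smul] at hyn
  rw [h1] at na nb nc
  exact ⟨a, ha, b, hb, c, hc, hyn.symm, IsUnimodularSet.of_subset (.inl h1) ⟨ha, na⟩ ⟨hb, nb⟩ ⟨hc, nc⟩
    (fun s hs sa sb sc => (h2 s hs.1 hs.2 sa sb sc).1)
    fun s hs t ht sa sb sc ta tb tc => (h2 s hs.1 hs.2 sa sb sc).2 t ht.1 ht.2 ta tb tc⟩

theorem HasUnimodularFacets.isReflexive {r ws : List Pt} (h : HasUnimodularFacets r)
    (hs : Surrounds r ws) : IsReflexive (hull {p | p ∈ r}) := by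
  have h0 := hs.zero_mem_interior
  have hfin : (vec '' {p | p ∈ r}).Finite := r.finite_toSet.image _
  have hsub : (polar (vec '' {p | p ∈ r})).extremePoints ℝ ⊆
      (fun t : Pt × Pt × Pt => (normal t.1 t.2.1 t.2.2).vec) ''
        ({p | p ∈ r} ×ˢ {p | p ∈ r} ×ˢ {p | p ∈ r}) := fun y hy => by
    obtain ⟨_, ⟨a, ha, rfl⟩, _, ⟨b, hb, rfl⟩, _, ⟨c, hc, rfl⟩, hli, hya, hyb, hyc⟩ :=
      exists_triple_of_extremePoint hfin hy
    obtain ⟨i, hi, j, hj, k, hk, rfl, -⟩ :=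
      h.exists_normal hy.1 ha hb hc ((linearIndependent_vec_iff a b c).1 hli) hya hyb hyc
    exact ⟨(i, j, k), ⟨hi, hj, hk⟩, rfl⟩
  have hext := (r.finite_toSet.prod (r.finite_toSet.prod r.finite_toSet)).image
    (fun t : Pt × Pt × Pt => (normal t.1 t.2.1 t.2.2).vec) |>.subset hsub
  have hcpt := isCompact_polar h0
  rw [hull, polar_convexHull] at hcpt
  refine ⟨⟨hfin.toFinset, ?_, by rw [hfin.coe_toFinset]; rfl⟩, h0,
    isLatticePolytope_polar_iff.1 ⟨hext.toFinset, fun y hy => ?_, ?_⟩⟩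
  · simpa using fun p _ => p.isLatticePoint_vec
  · obtain ⟨t, -, rfl⟩ := hsub (hext.mem_toFinset.1 hy)
    exact isLatticePoint_vec _
  · rw [hull, polar_convexHull, hext.coe_toFinset]
    exact eq_convexHull_extremePoints hcpt (convex_polar _) hext

theorem HasUnimodularFacets.isTerminalPolytope {r ws : List Pt} (h : HasUnimodularFacets r)
    (hs : Surrounds r ws) : IsTerminalPolytope (hull {p | p ∈ r}) := by
  refine isTerminalPolytope_of_facets (h.isReflexive hs) fun F hF => ?_
  have hfin : {p | p ∈ r}.Finite := r.finite_toSet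
  obtain ⟨y, hy, rfl, _, ⟨a, ha, rfl⟩, _, ⟨b, hb, rfl⟩, _, ⟨c, hc, rfl⟩, hli, hya, hyb, hyc⟩ :=
    hF.exists_normal (hfin.image _) hs.zero_mem_interior
  obtain ⟨i, -, j, -, k, -, rfl, hu⟩ :=
    h.exists_normal hy ha hb hc ((linearIndependent_vec_iff a b c).1 hli) hya hyb hyc
  have hle : ∀ s ∈ {p | p ∈ r}, (normal i j k).dot s ≤ 1 := fun s hs => by
    have := hy _ ⟨s, hs, rfl⟩
    rw [dotProd_vec] at this
    exact_mod_cast this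
  have hface := hull_face hfin hle
  rw [hull] at hface
  rw [hface]
  exact hu.isUnimodularFacet

/-- Collections of lattice points with a strictly negative sum, as triples of digits. -/
def surroundDigits : List (List ℕ) :=
  [[654, 654, 546, 455, 455, 455], [554, 554, 554, 447], [664, 545, 545, 455, 455], [654, 654,
   564, 564, 446, 446, 446], [554, 554, 546, 455], [564, 545, 545, 545, 465], [664, 645, 645, 455,
   455, 455, 455], [554, 554, 554, 546, 456], [663, 663, 446, 446, 446], [664, 445, 445], [645,
   645, 464, 455, 455], [444], [544, 455], [554, 554, 446], [546, 454, 454], [554, 545, 455],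
   [654, 445, 445], [644, 455, 455], [545, 545, 545, 474], [564, 545, 545, 455], [645, 554, 455,
   455], [744, 455, 455, 455], [654, 654, 455, 455, 446], [654, 645, 455, 455, 455], [564, 564,
   545, 545, 545, 456], [654, 545, 545, 545, 465, 465], [645, 645, 564, 455, 455, 455], [644, 644,
   644, 465, 465, 456, 456], [664, 545, 545, 545, 545, 465, 465], [654, 654, 654, 455, 455, 455,
   447], [645, 645, 564, 564, 564, 564, 446, 446, 446]]

theorem hasUnimodularFacets_of_mem_reps : ∀ r ∈ reps, HasUnimodularFacets r := by
  decide +kernel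

theorem exists_surrounds_of_mem_reps :
    ∀ r ∈ reps, ∃ l ∈ surroundDigits, Surrounds r (l.map ofDigits) := by
  decide +kernel

end Pt

namespace Pt

/-- The number of ways to write `v` as an ordered sum of two points of `r`. -/
def decomps (r : List Pt) (v : Pt) : ℕ := r.countP fun w => v.sub w ∈ r

/-- A second moment of the points of `r`, weighted by the number of decompositions. -/
def moment (r : List Pt) (f g : Pt → ℤ) : ℤ :=
  (r.map fun v => ((2 ^ decomps r v : ℕ) : ℤ) * (f v * g v)).sum

/-- A number which distinguishes the representatives up to equivalence. -/
def key (r : List Pt) : ℤ :=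
  10 ^ 9 * r.length + det ⟨moment r x x, moment r x y, moment r x z⟩
    ⟨moment r x y, moment r y y, moment r y z⟩ ⟨moment r x z, moment r y z, moment r z z⟩

theorem isChain_key_reps : (reps.map key).IsChain (· < ·) := by
  decide +kernel

theorem nodup_key_reps : (reps.map key).Nodup :=
  (List.isChain_iff_pairwise.1 isChain_key_reps).imp fun h => h.ne

theorem nodup_reps : reps.Nodup := nodup_key_reps.of_map

theorem nodup_of_mem_reps : ∀ r ∈ reps, r.Nodup ∧ zero ∉ r := by
  decide +kernel

theorem decomps_perm {r r' : List Pt} (h : r.Perm r') (v : Pt) : decomps r v = decomps r' v := by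
  simp only [decomps, h.mem_iff, h.countP_eq]

theorem moment_perm {r r' : List Pt} (h : r.Perm r') (f g : Pt → ℤ) :
    moment r f g = moment r' f g := by
  simp only [moment, decomps_perm h, (h.map _).sum_eq]

theorem key_perm {r r' : List Pt} (h : r.Perm r') : key r = key r' := by
  simp only [key, moment_perm h, h.length_eq]

theorem lin_sub (a b c p q : Pt) : lin a b c (p.sub q) = (lin a b c p).sub (lin a b c q) := by
  simp only [lin, sub, Pt.mk.injEq]
  refine ⟨?_, ?_, ?_⟩ <;> ring

theorem IsBasis.lin_injective {a b c : Pt} (h : IsBasis a b c) :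
    Function.Injective (lin a b c) := fun p q => (lin_eq_iff a b c h.ne_zero p q).1

theorem IsBasis.decomps_map {a b c : Pt} (h : IsBasis a b c) (r : List Pt) (v : Pt) :
    decomps (r.map (lin a b c)) (lin a b c v) = decomps r v := by
  simp only [decomps, List.countP_map, Function.comp_def, ← lin_sub,
    List.mem_map_of_injective h.lin_injective]

theorem sum_map_weighted_mul (l : List Pt) (w : Pt → ℤ) (i j k i' j' k' : ℤ) :
    (l.map fun v => w v * ((v.x * i + v.y * j + v.z * k) * (v.x * i' + v.y * j' + v.z * k'))).sum =
      i * i' * (l.map fun v => w v * (v.x * v.x)).sum +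
      j * j' * (l.map fun v => w v * (v.y * v.y)).sum +
      k * k' * (l.map fun v => w v * (v.z * v.z)).sum +
      (i * j' + j * i') * (l.map fun v => w v * (v.x * v.y)).sum +
      (i * k' + k * i') * (l.map fun v => w v * (v.x * v.z)).sum +
      (j * k' + k * j') * (l.map fun v => w v * (v.y * v.z)).sum := by
  induction l with
  | nil => simp
  | cons p l ih => simp only [List.map_cons, List.sum_cons, ih]; ring

theorem IsBasis.key_map {a b c : Pt} (h : IsBasis a b c) (r : List Pt) :
    key (r.map (lin a b c)) = key r := by
  have hm : ∀ f g : Pt → ℤ, moment (r.map (lin a b c)) f g =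
      (r.map fun v => ((2 ^ decomps r v : ℕ) : ℤ) * (f (lin a b c v) * g (lin a b c v))).sum := by
    intro f g
    simp only [moment, List.map_map, Function.comp_def, h.decomps_map]
  have hs := h.sq
  simp only [key, hm, lin, sum_map_weighted_mul, List.length_map]
  simp only [moment]
  generalize (r.map fun v => ((2 ^ decomps r v : ℕ) : ℤ) * (v.x * v.x)).sum = xx
  generalize (r.map fun v => ((2 ^ decomps r v : ℕ) : ℤ) * (v.x * v.y)).sum = xy
  generalize (r.map fun v => ((2 ^ decomps r v : ℕ) : ℤ) * (v.x * v.z)).sum = xz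
  generalize (r.map fun v => ((2 ^ decomps r v : ℕ) : ℤ) * (v.y * v.y)).sum = yy
  generalize (r.map fun v => ((2 ^ decomps r v : ℕ) : ℤ) * (v.y * v.z)).sum = yz
  generalize (r.map fun v => ((2 ^ decomps r v : ℕ) : ℤ) * (v.z * v.z)).sum = zz
  have : det ⟨xx, xy, xz⟩ ⟨xy, yy, yz⟩ ⟨xz, yz, zz⟩ =
    det a b c * det a b c * det ⟨xx, xy, xz⟩ ⟨xy, yy, yz⟩ ⟨xz, yz, zz⟩ := by rw [hs, one_mul]
  rw [this]
  simp only [det, dot, cross]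
  ring

end Pt

theorem LatticeEquivTo.exists_lin {A B : Set Pt} (hA : (Pt.hull A).extremePoints ℝ = Pt.vec '' A)
    (hB : (Pt.hull B).extremePoints ℝ = Pt.vec '' B) (h : LatticeEquivTo (Pt.hull A) (Pt.hull B)) :
    ∃ a b c, Pt.IsBasis a b c ∧ Pt.lin a b c '' A = B := by
  obtain ⟨f, hf, himg⟩ := h
  obtain ⟨a, ha⟩ := ((hf _).1 Pt.e₁.isLatticePoint_vec).exists_pt
  obtain ⟨b, hb⟩ := ((hf _).1 Pt.e₂.isLatticePoint_vec).exists_pt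
  obtain ⟨c, hc⟩ := ((hf _).1 Pt.e₃.isLatticePoint_vec).exists_pt
  have hlin : ∀ p : Pt, f p.vec = (Pt.lin a b c p).vec := fun p => by
    have : p.vec = (p.x : ℝ) • Pt.e₁.vec + (p.y : ℝ) • Pt.e₂.vec + (p.z : ℝ) • Pt.e₃.vec := by
      ext i; fin_cases i <;> simp [Pt.vec, Pt.e₁, Pt.e₂, Pt.e₃]
    rw [this, map_add, map_add, map_smul, map_smul, map_smul, ← ha, ← hb, ← hc, Pt.vec_lin]
  have hsurj : ∀ q : Pt, ∃ p, Pt.lin a b c p = q := fun q => by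
    have : IsLatticePoint (f.symm q.vec) := (hf _).2 (by simpa using q.isLatticePoint_vec)
    obtain ⟨p, hp⟩ := this.exists_pt
    exact ⟨p, Pt.vec_injective (by rw [← hlin, hp, f.apply_symm_apply])⟩
  obtain ⟨p, hp⟩ := hsurj Pt.e₁
  obtain ⟨q, hq⟩ := hsurj Pt.e₂
  obtain ⟨r, hr⟩ := hsurj Pt.e₃
  have hdet := Pt.det_lin a b c p q r
  rw [hp, hq, hr] at hdet
  refine ⟨a, b, c, Int.isUnit_iff.1 (IsUnit.of_mul_eq_one _ hdet.symm), ?_⟩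
  apply Pt.vec_injective.image_injective
  have hext := image_extremePoints (𝕜 := ℝ) f (Pt.hull A)
  rw [himg, hA, hB, Set.image_image] at hext
  rw [← hext, Set.image_image]
  simp only [hlin]

namespace Pt

theorem extremePoints_hull_of_mem_reps {r : List Pt} (hr : r ∈ reps) :
    (hull {p | p ∈ r}).extremePoints ℝ = vec '' {p | p ∈ r} := by
  refine Set.Subset.antisymm extremePoints_convexHull_subset ?_
  rintro _ ⟨p, hp, rfl⟩
  obtain ⟨l, -, hl⟩ := exists_surrounds_of_mem_reps r hr
  have hT := (hasUnimodularFacets_of_mem_reps r hr).isTerminalPolytope hl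
  have hmem : p.vec ∈ {x ∈ hull {p | p ∈ r} | IsLatticePoint x} :=
    ⟨subset_convexHull ℝ _ ⟨p, hp, rfl⟩, p.isLatticePoint_vec⟩
  rw [hT] at hmem
  refine hmem.resolve_left fun h0 => (nodup_of_mem_reps r hr).2 ?_
  rw [← vec_zero] at h0
  rwa [← vec_injective h0]

theorem eq_of_latticeEquivTo {r r' : List Pt} (hr : r ∈ reps) (hr' : r' ∈ reps)
    (h : LatticeEquivTo (hull {p | p ∈ r}) (hull {p | p ∈ r'})) : r = r' := by
  obtain ⟨a, b, c, hb, himg⟩ := h.exists_lin (extremePoints_hull_of_mem_reps hr)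
    (extremePoints_hull_of_mem_reps hr')
  have hperm : (r.map (lin a b c)).Perm r' := by
    rw [List.perm_ext_iff_of_nodup ((nodup_of_mem_reps r hr).1.map hb.lin_injective)
      (nodup_of_mem_reps r' hr').1]
    intro p
    simpa using (Set.ext_iff.1 himg p)
  have hkey : key r = key r' := by rw [← hb.key_map, key_perm hperm]
  exact List.inj_on_of_nodup_map nodup_key_reps hr hr' hkey

end Pt

theorem exists_classification : ∃ L : Finset (Set (Fin 3 → ℝ)), L.card = 100 ∧
    (∀ Q ∈ L, IsReflexive Q ∧ IsTerminalPolytope Q) ∧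
    (∀ P : Set (Fin 3 → ℝ), IsReflexive P → IsTerminalPolytope P →
      ∃ Q ∈ L, LatticeEquivTo P Q) ∧
    (∀ Q ∈ L, ∀ Q' ∈ L, LatticeEquivTo Q Q' → Q = Q') := by
  classical
  have hinj : ∀ r ∈ Pt.reps.toFinset, ∀ r' ∈ Pt.reps.toFinset,
      Pt.hull {p | p ∈ r} = Pt.hull {p | p ∈ r'} → r = r' := fun r hr r' hr' h =>
    Pt.eq_of_latticeEquivTo (List.mem_toFinset.1 hr) (List.mem_toFinset.1 hr')
      ⟨.refl ℝ _, fun _ => Iff.rfl, (Set.image_id _).trans h⟩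
  refine ⟨Pt.reps.toFinset.image fun r => Pt.hull {p | p ∈ r}, ?_, ?_, ?_, ?_⟩
  · rw [Finset.card_image_of_injOn fun r hr r' hr' h => hinj r hr r' hr' h,
      List.toFinset_card_of_nodup Pt.nodup_reps]
    rfl
  · simp only [Finset.forall_mem_image, List.mem_toFinset]
    intro r hr
    obtain ⟨l, -, hl⟩ := Pt.exists_surrounds_of_mem_reps r hr
    have h := Pt.hasUnimodularFacets_of_mem_reps r hr
    exact ⟨h.isReflexive hl, h.isTerminalPolytope hl⟩
  · intro P hP hT
    obtain ⟨r, hr, h⟩ := exists_rep hP hT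
    exact ⟨_, Finset.mem_image_of_mem _ (List.mem_toFinset.2 hr), h⟩
  · simp only [Finset.forall_mem_image, List.mem_toFinset]
    exact fun r hr r' hr' h => by rw [Pt.eq_of_latticeEquivTo hr hr' h]

/-- A three-dimensional reflexive polytope is terminal iff every facet is either
a triangle whose vertices form a `ℤ`-basis of `ℤ³`, or a parallelogram `conv(v,w,x,y)` with
`v, x, w` a `ℤ`-basis and `v + x = w + y`; and there are exactly 100 three-dimensional
terminal reflexive polytopes up to unimodular equivalence. -/
theorem terminal_reflexive_threefolds :
    (∀ P : Set (Fin 3 → ℝ), IsReflexive P →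
      (IsTerminalPolytope P ↔
        ∀ F, IsFacet P F →
          (∃ x y z : Fin 3 → ℝ, Set.extremePoints ℝ F = {x, y, z} ∧
            IsZBasisFamily ![x, y, z]) ∨
          (∃ v w x y : Fin 3 → ℝ, Set.extremePoints ℝ F = {v, w, x, y} ∧
            F = convexHull ℝ ({v, w, x, y} : Set (Fin 3 → ℝ)) ∧
            IsZBasisFamily ![v, x, w] ∧ v + x = w + y))) ∧
    (∃ L : Finset (Set (Fin 3 → ℝ)), L.card = 100 ∧
      (∀ Q ∈ L, IsReflexive Q ∧ IsTerminalPolytope Q) ∧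
      (∀ P : Set (Fin 3 → ℝ), IsReflexive P → IsTerminalPolytope P →
        ∃ Q ∈ L, LatticeEquivTo P Q) ∧
      (∀ Q ∈ L, ∀ Q' ∈ L, LatticeEquivTo Q Q' → Q = Q')) :=
  ⟨fun _ hP => ⟨fun hT _ hF => hT.isUnimodularFacet hP hF, isTerminalPolytope_of_facets hP⟩,
    exists_classification⟩

end
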